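/- arXiv:1906.09638 — 6 statements merged into one kernel-verified Lean document; each statement's English description precedes it below -/
import Mathlib

section
/- Fix an integer d ≥ 2 and a real number σ > 0. There exist δ ∈ (0,1) and C > 0, depending only on d and σ, with the following property. Let 0 < r < R ≤ 1 satisfy r/R ≤ δ. Let u be C² on a neighbourhood of the closed annulus closure(A_{r,R}), harmonic in A_{r,R}, and satisfying the Steklov condition on the inner sphere: −⟨∇u(x), x/r⟩ = σ·u(x) for every x with |x| = r. Let h be continuous on the closed ball closure(B(0,r)), harmonic in B(0,r), and equal to u on the sphere {x : |x| = r}. Then ∫_{B(0,r)} |∇h|² dx ≤ 5·(r/R)^d·(1 + C·(r/R)^d)·∫_{A_{r,R}} |∇u|² dx. -/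
open MeasureTheory RealInnerProductSpace

/-- The Laplacian of `u : ℝ^d → ℝ`: sum of pure second partial derivatives. -/
noncomputable def lap {d : ℕ} (u : EuclideanSpace ℝ (Fin d) → ℝ)
    (x : EuclideanSpace ℝ (Fin d)) : ℝ :=
  ∑ i : Fin d, fderiv ℝ (fun y => fderiv ℝ u y (EuclideanSpace.single i (1:ℝ))) x
    (EuclideanSpace.single i (1:ℝ))

/-- The open annulus `B(0,R) \ closure (B(0,r))` in `ℝ^d`. -/
def ann (d : ℕ) (r R : ℝ) : Set (EuclideanSpace ℝ (Fin d)) :=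
  Metric.ball 0 R \ Metric.closedBall 0 r

open Metric Set Filter Topology

section ParametricIntegral

variable {Y : Type*} [TopologicalSpace Y] [CompactSpace Y] [MeasurableSpace Y] [BorelSpace Y]

lemma integrable_of_continuous_compactSpace {μ : Measure Y} [IsFiniteMeasure μ] {f : Y → ℝ}
    (hf : Continuous f) : Integrable f μ :=
  hf.integrable_of_hasCompactSupport (HasCompactSupport.of_compactSpace f)

lemma continuousOn_integral_of_compactSpace {X : Type*} [TopologicalSpace X]
    (μ : Measure Y) [IsFiniteMeasure μ] {F : X → Y → ℝ} {A : Set X}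
    (hF : ContinuousOn (Function.uncurry F) (A ×ˢ univ)) :
    ContinuousOn (fun x => ∫ y, F x y ∂μ) A := by
  rw [continuousOn_iff_continuous_domRestrict]
  have h1 : Continuous (fun p : A × Y => F p.1 p.2) :=
    hF.comp_continuous (f := fun p : A × Y => ((p.1 : X), p.2)) (by fun_prop)
      (fun p => ⟨p.1.2, mem_univ _⟩)
  have h2 : Continuous (ContinuousMap.curry ⟨_, h1⟩) := (ContinuousMap.curry ⟨_, h1⟩).continuous
  have h3 : LipschitzWith ⟨μ.real univ, measureReal_nonneg⟩ (fun f : C(Y, ℝ) => ∫ y, f y ∂μ) := by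
    refine LipschitzWith.of_dist_le_mul fun f g => ?_
    rw [dist_eq_norm, dist_eq_norm, ← integral_sub
      (integrable_of_continuous_compactSpace f.continuous)
      (integrable_of_continuous_compactSpace g.continuous), mul_comm]
    refine norm_integral_le_of_norm_le_const (Eventually.of_forall fun y => ?_)
    exact (f - g).norm_coe_le_norm y
  exact h3.continuous.comp h2

lemma hasFDerivAt_integral_of_compactSpace {X : Type*} [NormedAddCommGroup X] [NormedSpace ℝ X]
    [FiniteDimensional ℝ X] [SecondCountableTopology Y]
    (μ : Measure Y) [IsFiniteMeasure μ] {F : X → Y → ℝ} {F' : X → Y → X →L[ℝ] ℝ} {A : Set X}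
    (hA : IsOpen A) (hF : ContinuousOn (Function.uncurry F) (A ×ˢ univ))
    (hF' : ContinuousOn (Function.uncurry F') (A ×ˢ univ))
    (h : ∀ x ∈ A, ∀ y, HasFDerivAt (F · y) (F' x y) x) {x₀ : X} (hx₀ : x₀ ∈ A) :
    HasFDerivAt (fun x => ∫ y, F x y ∂μ) (∫ y, F' x₀ y ∂μ) x₀ := by
  have : ProperSpace X := FiniteDimensional.proper ℝ X
  obtain ⟨K, hK, hxK, hKA⟩ := exists_compact_subset hA hx₀
  have hs : ∀ x ∈ A, Continuous (F x) := fun x hx =>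
    hF.comp_continuous (f := fun y => (x, y)) (by fun_prop) fun y => ⟨hx, mem_univ _⟩
  have hs' : ∀ x ∈ A, Continuous (F' x) := fun x hx =>
    hF'.comp_continuous (f := fun y => (x, y)) (by fun_prop) fun y => ⟨hx, mem_univ _⟩
  obtain ⟨C, hC⟩ := (hK.prod isCompact_univ).exists_bound_of_continuousOn
    (hF'.mono (prod_mono hKA (subset_refl (univ : Set Y))))
  have hKn : K ∈ 𝓝 x₀ := mem_interior_iff_mem_nhds.1 hxK
  refine hasFDerivAt_integral_of_dominated_of_fderiv_le (bound := fun _ => C) hKn ?_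
    (integrable_of_continuous_compactSpace (hs x₀ hx₀)) (hs' x₀ hx₀).aestronglyMeasurable
    (Eventually.of_forall fun y x hx => hC (x, y) ⟨hx, mem_univ _⟩) (integrable_const _)
    (Eventually.of_forall fun y x hx => h x (hKA hx) y)
  filter_upwards [hA.mem_nhds hx₀] with x hx using (hs x hx).aestronglyMeasurable

end ParametricIntegral

/-- The Euler (radial) derivative `x ↦ ⟨∇f(x), x⟩`. -/
noncomputable def euler {d : ℕ} (f : EuclideanSpace ℝ (Fin d) → ℝ)
    (x : EuclideanSpace ℝ (Fin d)) : ℝ :=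
  fderiv ℝ f x x

/-- The pairing `∫ f(aω) g(bω) dω` over the unit sphere. -/
noncomputable def sphPair {d : ℕ} (f g : EuclideanSpace ℝ (Fin d) → ℝ) (a b : ℝ) : ℝ :=
  ∫ ω : sphere (0 : EuclideanSpace ℝ (Fin d)) 1,
    f (a • (ω : EuclideanSpace ℝ (Fin d))) * g (b • (ω : EuclideanSpace ℝ (Fin d)))
      ∂(volume : Measure (EuclideanSpace ℝ (Fin d))).toSphere

section SpherePairing

variable {d : ℕ} {f g : EuclideanSpace ℝ (Fin d) → ℝ}

lemma ContDiffOn.euler {U : Set (EuclideanSpace ℝ (Fin d))} (hU : IsOpen U)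
    (hf : ContDiffOn ℝ 2 f U) : ContDiffOn ℝ 1 (euler f) U :=
  (hf.fderiv_of_isOpen hU (m := 1) (by norm_num)).clm_apply contDiffOn_id

lemma ContDiffOn.continuousOn_euler {U : Set (EuclideanSpace ℝ (Fin d))} (hU : IsOpen U)
    (hf : ContDiffOn ℝ 1 f U) : ContinuousOn (_root_.euler f) U :=
  (hf.continuousOn_fderiv_of_isOpen hU le_rfl).clm_apply continuousOn_id

lemma sphPair_comm (f g : EuclideanSpace ℝ (Fin d) → ℝ) (a b : ℝ) :
    sphPair f g a b = sphPair g f b a := by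
  simp only [sphPair, mul_comm]

lemma continuousOn_sphPair {U W : Set (EuclideanSpace ℝ (Fin d))} (hf : ContinuousOn f U)
    (hg : ContinuousOn g W) {A : Set (ℝ × ℝ)}
    (hA : ∀ p ∈ A, ∀ ω : sphere (0 : EuclideanSpace ℝ (Fin d)) 1,
      p.1 • (ω : EuclideanSpace ℝ (Fin d)) ∈ U ∧ p.2 • (ω : EuclideanSpace ℝ (Fin d)) ∈ W) :
    ContinuousOn (fun p : ℝ × ℝ => sphPair f g p.1 p.2) A := by
  refine continuousOn_integral_of_compactSpace _ (ContinuousOn.mul ?_ ?_)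
  · exact hf.comp (f := fun q : (ℝ × ℝ) × sphere (0 : EuclideanSpace ℝ (Fin d)) 1 =>
      q.1.1 • (q.2 : EuclideanSpace ℝ (Fin d))) (by fun_prop) fun q hq => (hA q.1 hq.1 q.2).1
  · exact hg.comp (f := fun q : (ℝ × ℝ) × sphere (0 : EuclideanSpace ℝ (Fin d)) 1 =>
      q.1.2 • (q.2 : EuclideanSpace ℝ (Fin d))) (by fun_prop) fun q hq => (hA q.1 hq.1 q.2).2

lemma hasDerivAt_smul_radial {U : Set (EuclideanSpace ℝ (Fin d))} (hU : IsOpen U)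
    (hf : ContDiffOn ℝ 1 f U) {a : ℝ} {x : EuclideanSpace ℝ (Fin d)} (hx : a • x ∈ U) :
    HasDerivAt (fun t : ℝ => f (t • x)) (fderiv ℝ f (a • x) x) a := by
  have h1 : HasFDerivAt f (fderiv ℝ f (a • x)) (a • x) :=
    ((hf.contDiffAt (hU.mem_nhds hx)).differentiableAt one_ne_zero).hasFDerivAt
  have h2 : HasDerivAt (fun t : ℝ => t • x) x a := by
    simpa using (hasDerivAt_id a).smul_const x
  exact h1.comp_hasDerivAt a h2

/-- The set of scalars whose dilations of the unit sphere stay in an open set is open. -/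
lemma isOpen_setOf_smul_sphere_subset {U : Set (EuclideanSpace ℝ (Fin d))} (hU : IsOpen U) :
    IsOpen {a : ℝ | ∀ ω : sphere (0 : EuclideanSpace ℝ (Fin d)) 1,
      a • (ω : EuclideanSpace ℝ (Fin d)) ∈ U} := by
  have h : IsClosed (Prod.fst '' ((fun q : ℝ × sphere (0 : EuclideanSpace ℝ (Fin d)) 1 =>
      q.1 • (q.2 : EuclideanSpace ℝ (Fin d))) ⁻¹' Uᶜ)) :=
    isClosedMap_fst_of_compactSpace _ (hU.isClosed_compl.preimage (by fun_prop))
  convert h.isOpen_compl using 1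
  ext a
  simp

lemma hasDerivAt_sphPair {U W : Set (EuclideanSpace ℝ (Fin d))} (hU : IsOpen U) (hW : IsOpen W)
    (hf : ContDiffOn ℝ 1 f U) (hg : ContDiffOn ℝ 1 g W) {α β : ℝ → ℝ} {α' β' t : ℝ}
    (hα : HasDerivAt α α' t) (hβ : HasDerivAt β β' t) (hα0 : α t ≠ 0) (hβ0 : β t ≠ 0)
    (hαU : ∀ ω : sphere (0 : EuclideanSpace ℝ (Fin d)) 1,
      α t • (ω : EuclideanSpace ℝ (Fin d)) ∈ U)
    (hβW : ∀ ω : sphere (0 : EuclideanSpace ℝ (Fin d)) 1,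
      β t • (ω : EuclideanSpace ℝ (Fin d)) ∈ W) :
    HasDerivAt (fun t => sphPair f g (α t) (β t))
      (α' / α t * sphPair (euler f) g (α t) (β t) + β' / β t * sphPair f (euler g) (α t) (β t))
      t := by
  set A : Set (ℝ × ℝ) :=
    {a : ℝ | ∀ ω : sphere (0 : EuclideanSpace ℝ (Fin d)) 1,
      a • (ω : EuclideanSpace ℝ (Fin d)) ∈ U} ×ˢ
    {a : ℝ | ∀ ω : sphere (0 : EuclideanSpace ℝ (Fin d)) 1,
      a • (ω : EuclideanSpace ℝ (Fin d)) ∈ W} with hAdef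
  have hA : IsOpen A :=
    (isOpen_setOf_smul_sphere_subset hU).prod (isOpen_setOf_smul_sphere_subset hW)
  have c1 : ∀ {k : EuclideanSpace ℝ (Fin d) → ℝ}, ContinuousOn k U → ContinuousOn
      (fun q : (ℝ × ℝ) × sphere (0 : EuclideanSpace ℝ (Fin d)) 1 =>
        k (q.1.1 • (q.2 : EuclideanSpace ℝ (Fin d)))) (A ×ˢ univ) := fun hk =>
    hk.comp (f := fun q : (ℝ × ℝ) × sphere (0 : EuclideanSpace ℝ (Fin d)) 1 =>
      q.1.1 • (q.2 : EuclideanSpace ℝ (Fin d))) (by fun_prop) fun q hq => hq.1.1 q.2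
  have c2 : ∀ {k : EuclideanSpace ℝ (Fin d) → ℝ}, ContinuousOn k W → ContinuousOn
      (fun q : (ℝ × ℝ) × sphere (0 : EuclideanSpace ℝ (Fin d)) 1 =>
        k (q.1.2 • (q.2 : EuclideanSpace ℝ (Fin d)))) (A ×ˢ univ) := fun hk =>
    hk.comp (f := fun q : (ℝ × ℝ) × sphere (0 : EuclideanSpace ℝ (Fin d)) 1 =>
      q.1.2 • (q.2 : EuclideanSpace ℝ (Fin d))) (by fun_prop) fun q hq => hq.1.2 q.2
  have d1 : ContinuousOn
      (fun q : (ℝ × ℝ) × sphere (0 : EuclideanSpace ℝ (Fin d)) 1 =>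
        fderiv ℝ f (q.1.1 • (q.2 : EuclideanSpace ℝ (Fin d))) q.2) (A ×ˢ univ) :=
    ((hf.continuousOn_fderiv_of_isOpen hU le_rfl).comp
      (f := fun q : (ℝ × ℝ) × sphere (0 : EuclideanSpace ℝ (Fin d)) 1 =>
      q.1.1 • (q.2 : EuclideanSpace ℝ (Fin d))) (by fun_prop) fun q hq => hq.1.1 q.2).clm_apply
      (by fun_prop)
  have d2 : ContinuousOn
      (fun q : (ℝ × ℝ) × sphere (0 : EuclideanSpace ℝ (Fin d)) 1 =>
        fderiv ℝ g (q.1.2 • (q.2 : EuclideanSpace ℝ (Fin d))) q.2) (A ×ˢ univ) :=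
    ((hg.continuousOn_fderiv_of_isOpen hW le_rfl).comp
      (f := fun q : (ℝ × ℝ) × sphere (0 : EuclideanSpace ℝ (Fin d)) 1 =>
      q.1.2 • (q.2 : EuclideanSpace ℝ (Fin d))) (by fun_prop) fun q hq => hq.1.2 q.2).clm_apply
      (by fun_prop)
  have hmem : (α t, β t) ∈ A := ⟨hαU, hβW⟩
  let F : ℝ × ℝ → sphere (0 : EuclideanSpace ℝ (Fin d)) 1 → ℝ := fun p ω =>
    f (p.1 • (ω : EuclideanSpace ℝ (Fin d))) * g (p.2 • (ω : EuclideanSpace ℝ (Fin d)))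
  let F' : ℝ × ℝ → sphere (0 : EuclideanSpace ℝ (Fin d)) 1 → ℝ × ℝ →L[ℝ] ℝ := fun p ω =>
    (f (p.1 • (ω : EuclideanSpace ℝ (Fin d))) *
        fderiv ℝ g (p.2 • (ω : EuclideanSpace ℝ (Fin d))) ω) • ContinuousLinearMap.snd ℝ ℝ ℝ +
      (fderiv ℝ f (p.1 • (ω : EuclideanSpace ℝ (Fin d))) ω *
        g (p.2 • (ω : EuclideanSpace ℝ (Fin d)))) • ContinuousLinearMap.fst ℝ ℝ ℝ
  have cF : ContinuousOn (Function.uncurry F) (A ×ˢ univ) :=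
    (c1 hf.continuousOn).fun_mul (c2 hg.continuousOn)
  have cF' : ContinuousOn (Function.uncurry F') (A ×ˢ univ) :=
    (((c1 hf.continuousOn).fun_mul d2).fun_smul continuousOn_const).fun_add
      ((d1.fun_mul (c2 hg.continuousOn)).fun_smul continuousOn_const)
  have key : HasFDerivAt (fun p => ∫ ω, F p ω ∂(volume : Measure (EuclideanSpace ℝ (Fin d))).toSphere)
      (∫ ω, F' (α t, β t) ω ∂(volume : Measure (EuclideanSpace ℝ (Fin d))).toSphere)
      (α t, β t) := by
    refine hasFDerivAt_integral_of_compactSpace _ hA cF cF' ?_ hmem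
    rintro p hp ω
    have e1 : HasFDerivAt (fun p : ℝ × ℝ => f (p.1 • (ω : EuclideanSpace ℝ (Fin d)))) _ p :=
      (hasDerivAt_smul_radial hU hf (hp.1 ω)).hasFDerivAt.comp p hasFDerivAt_fst
    have e2 : HasFDerivAt (fun p : ℝ × ℝ => g (p.2 • (ω : EuclideanSpace ℝ (Fin d)))) _ p :=
      (hasDerivAt_smul_radial hW hg (hp.2 ω)).hasFDerivAt.comp p hasFDerivAt_snd
    refine (e1.mul e2).congr_fderiv ?_
    ext <;> simp [F']
    ring
  have hcomp := key.comp_hasDerivAt t (hα.prodMk hβ)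
  refine hcomp.congr_deriv ?_
  have s1 : Continuous fun ω : sphere (0 : EuclideanSpace ℝ (Fin d)) 1 =>
      (f (α t • (ω : EuclideanSpace ℝ (Fin d))) *
        fderiv ℝ g (β t • (ω : EuclideanSpace ℝ (Fin d))) ω) :=
    ((c1 hf.continuousOn).mul d2).comp_continuous (f := fun ω => ((α t, β t), ω))
      (by fun_prop) fun ω => ⟨hmem, mem_univ _⟩
  have s2 : Continuous fun ω : sphere (0 : EuclideanSpace ℝ (Fin d)) 1 =>
      (fderiv ℝ f (α t • (ω : EuclideanSpace ℝ (Fin d))) ω *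
        g (β t • (ω : EuclideanSpace ℝ (Fin d)))) :=
    (d1.mul (c2 hg.continuousOn)).comp_continuous (f := fun ω => ((α t, β t), ω))
      (by fun_prop) fun ω => ⟨hmem, mem_univ _⟩
  simp only [F']
  rw [integral_add
    ((integrable_of_continuous_compactSpace s1).smul_const _)
    ((integrable_of_continuous_compactSpace s2).smul_const _),
    integral_smul_const, integral_smul_const]
  simp only [add_apply, smul_apply,
    ContinuousLinearMap.coe_snd', ContinuousLinearMap.coe_fst', smul_eq_mul, sphPair, euler,
    map_smul]
  rw [add_comm, ← integral_mul_const, ← integral_mul_const, ← integral_const_mul,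
    ← integral_const_mul]
  congr 1 <;> congr 1 <;> ext ω <;> field_simp

end SpherePairing

/-- The pointwise pairing of gradients `⟨∇f, ∇g⟩`, in the standard coordinates. -/
noncomputable def gradDot {d : ℕ} (f g : EuclideanSpace ℝ (Fin d) → ℝ)
    (x : EuclideanSpace ℝ (Fin d)) : ℝ :=
  ∑ i, fderiv ℝ f x (EuclideanSpace.single i 1) * fderiv ℝ g x (EuclideanSpace.single i 1)

section Polar

variable {m : ℕ}

/-- Integration in polar coordinates. -/
lemma integral_eq_integral_Ioi_sphere {G : EuclideanSpace ℝ (Fin (m + 2)) → ℝ}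
    (hG : Integrable G) :
    ∫ x, G x = ∫ ρ in Ioi (0 : ℝ), ρ ^ (m + 1) *
      ∫ ω : sphere (0 : EuclideanSpace ℝ (Fin (m + 2))) 1,
        G (ρ • (ω : EuclideanSpace ℝ (Fin (m + 2))))
        ∂(volume : Measure (EuclideanSpace ℝ (Fin (m + 2)))).toSphere := by
  let E := EuclideanSpace ℝ (Fin (m + 2))
  let μ : Measure E := volume
  have hmp := μ.measurePreserving_homeomorphUnitSphereProd
  have hfr : Module.finrank ℝ E - 1 = m + 1 := by simp [E]
  rw [hfr] at hmp
  have hemb := (homeomorphUnitSphereProd E).measurableEmbedding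
  let H : sphere (0 : E) 1 × Ioi (0 : ℝ) → ℝ := fun p => G ((p.2 : ℝ) • (p.1 : E))
  have hH : ∀ x : ({(0 : E)}ᶜ : Set E), H (homeomorphUnitSphereProd E x) = G x := by
    intro x
    have hx : (x : E) ≠ 0 := x.2
    have : ‖(x : E)‖ ≠ 0 := norm_ne_zero_iff.2 hx
    simp [H, smul_smul, this]
  have hint : Integrable H (μ.toSphere.prod (Measure.volumeIoiPow (m + 1))) := by
    rw [← hmp.integrable_comp_emb hemb]
    have : Integrable G (μ.restrict ({(0 : E)}ᶜ)) := hG.integrableOn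
    have h2 := (integrableOn_iff_comap_subtypeVal (measurableSet_singleton (0 : E)).compl).1 this
    refine h2.congr (Eventually.of_forall fun x => ?_)
    simp [Function.comp, hH]
  calc ∫ x, G x ∂μ = ∫ x : ({(0 : E)}ᶜ : Set E), G x ∂(μ.comap (↑)) := by
        rw [integral_subtype_comap (measurableSet_singleton _).compl G, restrict_compl_singleton]
    _ = ∫ p, H p ∂(μ.toSphere.prod (Measure.volumeIoiPow (m + 1))) := by
        rw [← hmp.integral_comp hemb]
        simp only [hH]
    _ = ∫ ρ : Ioi (0 : ℝ), (∫ ω, H (ω, ρ) ∂μ.toSphere) ∂(Measure.volumeIoiPow (m + 1)) :=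
        integral_prod_symm _ hint
    _ = _ := by
        simp only [Measure.volumeIoiPow, ENNReal.ofReal]
        rw [integral_withDensity_eq_integral_smul (by fun_prop),
          integral_subtype_comap measurableSet_Ioi fun a : ℝ ↦ Real.toNNReal (a ^ (m + 1)) •
            ∫ ω : sphere (0 : E) 1, G (a • (ω : E)) ∂μ.toSphere]
        refine setIntegral_congr_fun measurableSet_Ioi fun x hx ↦ ?_
        simp only [NNReal.smul_def, Real.coe_toNNReal _ (pow_nonneg (le_of_lt hx) _), smul_eq_mul]
        rfl

/-- Integration in polar coordinates over a radial set. -/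
lemma setIntegral_norm_preimage_eq {G : EuclideanSpace ℝ (Fin (m + 2)) → ℝ} {T : Set ℝ}
    (hT : MeasurableSet T) (hT0 : T ⊆ Ioi 0) (hG : IntegrableOn G (norm ⁻¹' T)) :
    ∫ x in norm ⁻¹' T, G x = ∫ ρ in T, ρ ^ (m + 1) *
      ∫ ω : sphere (0 : EuclideanSpace ℝ (Fin (m + 2))) 1,
        G (ρ • (ω : EuclideanSpace ℝ (Fin (m + 2))))
        ∂(volume : Measure (EuclideanSpace ℝ (Fin (m + 2)))).toSphere := by
  have hm : MeasurableSet (norm ⁻¹' T : Set (EuclideanSpace ℝ (Fin (m + 2)))) :=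
    measurable_norm hT
  rw [← integral_indicator hm,
    integral_eq_integral_Ioi_sphere ((integrable_indicator_iff hm).2 hG)]
  have : (Ioi (0 : ℝ)) ∩ T = T := inter_eq_right.2 hT0
  rw [← this, ← setIntegral_indicator hT]
  refine setIntegral_congr_fun measurableSet_Ioi fun ρ hρ => ?_
  have hρ' : (0 : ℝ) < ρ := hρ
  have hn : ∀ ω : sphere (0 : EuclideanSpace ℝ (Fin (m + 2))) 1,
      ‖ρ • (ω : EuclideanSpace ℝ (Fin (m + 2)))‖ = ρ := fun ω => by
    simp [norm_smul, abs_of_pos hρ']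
  by_cases h : ρ ∈ T
  · simp [indicator, hn, h, hρ']
  · simp [indicator, hn, h]

lemma integrable_mul_of_tsupport_subset {X : Type*} [TopologicalSpace X] [MeasurableSpace X]
    [OpensMeasurableSpace X] [T2Space X] {μ : Measure X} [IsFiniteMeasureOnCompacts μ]
    {φ k : X → ℝ} {U : Set X}
    (hφ : Continuous φ) (hc : HasCompactSupport φ) (hU : tsupport φ ⊆ U) (hk : ContinuousOn k U) :
    Integrable (fun x => φ x * k x) μ := by
  have h1 : IntegrableOn (fun x => φ x * k x) (tsupport φ) μ :=
    (hφ.continuousOn.mul (hk.mono hU)).integrableOn_compact hc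
  refine (integrableOn_iff_integrable_of_support_subset fun x hx => ?_).1 h1
  exact subset_tsupport _ (fun h => hx (by simp [h]))

lemma hasFDerivAt_comp_norm {d : ℕ} {η : ℝ → ℝ} {x : EuclideanSpace ℝ (Fin d)} (hx : x ≠ 0)
    (hη : DifferentiableAt ℝ η ‖x‖) :
    HasFDerivAt (fun y => η ‖y‖) ((deriv η ‖x‖ * ‖x‖⁻¹) • innerSL ℝ x) x := by
  have h0 : ‖x‖ ≠ 0 := norm_ne_zero_iff.2 hx
  have h1 := (hasStrictFDerivAt_norm_sq x).hasFDerivAt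
  have h2 : HasFDerivAt (fun y : EuclideanSpace ℝ (Fin d) => ‖y‖) (‖x‖⁻¹ • innerSL ℝ x) x := by
    have h3 := h1.sqrt (by positivity)
    simp only [Real.sqrt_sq (norm_nonneg _)] at h3
    refine h3.congr_fderiv ?_
    ext y
    simp
    field_simp
  refine (hη.hasDerivAt.comp_hasFDerivAt x h2).congr_fderiv ?_
  rw [smul_smul]

end Polar

section Green

variable {m : ℕ} {a b : ℝ} {f g : EuclideanSpace ℝ (Fin (m + 2)) → ℝ}

lemma isOpen_norm_preimage_Ioo {d : ℕ} :
    IsOpen (norm ⁻¹' Ioo a b : Set (EuclideanSpace ℝ (Fin d))) :=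
  isOpen_Ioo.preimage continuous_norm

lemma ContDiffOn.fderiv_single {d : ℕ} {g : EuclideanSpace ℝ (Fin d) → ℝ}
    {U : Set (EuclideanSpace ℝ (Fin d))} (hU : IsOpen U)
    (hg : ContDiffOn ℝ 2 g U) (v : EuclideanSpace ℝ (Fin d)) :
    ContDiffOn ℝ 1 (fun x => fderiv ℝ g x v) U :=
  (hg.fderiv_of_isOpen hU (m := 1) (by norm_num)).clm_apply contDiffOn_const

lemma continuousOn_gradDot {d : ℕ} {f g : EuclideanSpace ℝ (Fin d) → ℝ}
    {U : Set (EuclideanSpace ℝ (Fin d))} (hU : IsOpen U)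
    (hf : ContDiffOn ℝ 1 f U) (hg : ContDiffOn ℝ 1 g U) : ContinuousOn (gradDot f g) U :=
  continuousOn_finsetSum _ fun _ _ =>
    ((hf.continuousOn_fderiv_of_isOpen hU le_rfl).clm_apply continuousOn_const).mul
      ((hg.continuousOn_fderiv_of_isOpen hU le_rfl).clm_apply continuousOn_const)

lemma euler_eq_sum {d : ℕ} (f : EuclideanSpace ℝ (Fin d) → ℝ) (x : EuclideanSpace ℝ (Fin d)) :
    euler f x = ∑ i, x i * fderiv ℝ f x (EuclideanSpace.single i 1) := by
  have : x = ∑ i, x i • EuclideanSpace.single i (1 : ℝ) := by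
    ext j
    simp [Pi.single_apply]
  unfold euler
  conv_lhs => rw [this]
  rw [map_sum, ← this]
  simp

/-- The weak form of Green's identity against a radial cutoff. -/
lemma integral_cutoff_gradDot {d : ℕ} {f g : EuclideanSpace ℝ (Fin d) → ℝ} (ha : 0 ≤ a)
    (hf : ContDiffOn ℝ 1 f (norm ⁻¹' Ioo a b)) (hg : ContDiffOn ℝ 2 g (norm ⁻¹' Ioo a b))
    (hlap : ∀ x ∈ norm ⁻¹' Ioo a b, lap g x = 0) {η : ℝ → ℝ} (hη : ContDiff ℝ 1 η)
    (hηs : tsupport η ⊆ Ioo a b) :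
    ∫ x, η ‖x‖ * gradDot f g x = - ∫ x, deriv η ‖x‖ * ‖x‖⁻¹ * (f x * euler g x) := by
  set U : Set (EuclideanSpace ℝ (Fin d)) := norm ⁻¹' Ioo a b with hUdef
  have hU : IsOpen U := isOpen_norm_preimage_Ioo
  let φ : EuclideanSpace ℝ (Fin d) → ℝ := fun x => η ‖x‖
  have hφs' : tsupport φ ⊆ norm ⁻¹' tsupport η :=
    closure_minimal (fun x hx => subset_tsupport η hx)
      ((isClosed_tsupport η).preimage continuous_norm)
  have hφs : tsupport φ ⊆ U := hφs'.trans (preimage_mono hηs)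
  have hφ : ContDiff ℝ 1 φ := by
    rw [contDiff_iff_contDiffAt]
    intro x
    by_cases hx : x = 0
    · have : x ∉ tsupport φ := fun h => by
        have := (hφs h).1
        simp [hx] at this
        linarith
      exact contDiffAt_const (c := (0 : ℝ)) |>.congr_of_eventuallyEq
        (notMem_tsupport_iff_eventuallyEq.1 this)
    · exact hη.contDiffAt.comp x (contDiffAt_norm ℝ hx)
  have hφc : HasCompactSupport φ := by
    have hb : tsupport φ ⊆ closedBall 0 b := fun x hx => by
      simpa using (hφs hx).2.le
    exact (isCompact_closedBall 0 b).of_isClosed_subset (isClosed_tsupport φ) hb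
  have hne : ∀ x ∈ U, x ≠ 0 := fun x hx h => by
    have := hx.1
    simp [h] at this
    linarith
  have hdφ : ∀ x ∈ U, ∀ v, fderiv ℝ φ x v = deriv η ‖x‖ * ‖x‖⁻¹ * ⟪x, v⟫ := fun x hx v => by
    rw [(hasFDerivAt_comp_norm (hne x hx) (hη.differentiable one_ne_zero _)).fderiv]
    simp
  have hdφc : ∀ v, Continuous (fun x => fderiv ℝ φ x v) := fun v =>
    (hφ.continuous_fderiv one_ne_zero).clm_apply continuous_const
  have hdφs : ∀ v, tsupport (fun x => fderiv ℝ φ x v) ⊆ tsupport φ := fun v =>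
    closure_minimal (fun x hx => support_fderiv_subset ℝ (f := φ)
      (fun h => hx (by simp [h]))) (isClosed_tsupport φ)
  have hdφk : ∀ v, HasCompactSupport (fun x => fderiv ℝ φ x v) := fun v =>
    hφc.of_isClosed_subset (isClosed_tsupport _) (hdφs v)
  have hgi : ∀ v, ContDiffOn ℝ 1 (fun x => f x * fderiv ℝ g x v) U := fun v =>
    hf.mul (hg.fderiv_single hU v)
  have hparts : ∀ v, ∫ x, φ x * fderiv ℝ (fun x => f x * fderiv ℝ g x v) x v =
      - ∫ x, fderiv ℝ φ x v * (f x * fderiv ℝ g x v) := fun v => by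
    refine integral_mul_fderiv_eq_neg_fderiv_mul_of_integrable ?_ ?_ ?_ ?_ ?_
    · exact integrable_mul_of_tsupport_subset (hdφc v) (hdφk v) ((hdφs v).trans hφs)
        (hgi v).continuousOn
    · exact integrable_mul_of_tsupport_subset hφ.continuous hφc hφs
        (((hgi v).continuousOn_fderiv_of_isOpen hU le_rfl).clm_apply continuousOn_const)
    · exact integrable_mul_of_tsupport_subset hφ.continuous hφc hφs (hgi v).continuousOn
    · exact fun x _ => hφ.differentiable one_ne_zero x
    · exact fun x hx => ((hgi v).contDiffAt (hU.mem_nhds (hφs hx))).differentiableAt one_ne_zero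
  have hsum := Finset.sum_congr (rfl : (Finset.univ : Finset (Fin d)) = Finset.univ)
    fun i _ => hparts (EuclideanSpace.single i 1)
  rw [Finset.sum_neg_distrib, ← integral_finsetSum, ← integral_finsetSum] at hsum
  · convert hsum using 1
    · refine integral_congr_ae (Eventually.of_forall fun x => ?_)
      by_cases hx : x ∈ U
      · have hfx : DifferentiableAt ℝ f x :=
          (hf.contDiffAt (hU.mem_nhds hx)).differentiableAt one_ne_zero
        have hgx : ∀ v, DifferentiableAt ℝ (fun x => fderiv ℝ g x v) x := fun v =>
          ((hg.fderiv_single hU v).contDiffAt (hU.mem_nhds hx)).differentiableAt one_ne_zero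
        have hl := hlap x hx
        simp only [lap] at hl
        have : ∀ i : Fin d, φ x * fderiv ℝ (fun x => f x *
            fderiv ℝ g x (EuclideanSpace.single i 1)) x (EuclideanSpace.single i 1) =
            φ x * (fderiv ℝ f x (EuclideanSpace.single i 1) *
              fderiv ℝ g x (EuclideanSpace.single i 1)) + φ x * f x *
            fderiv ℝ (fun y => fderiv ℝ g y (EuclideanSpace.single i 1)) x
              (EuclideanSpace.single i 1) := fun i => by
          rw [fderiv_fun_mul hfx (hgx _)]
          simp
          ring
        simp only [this, Finset.sum_add_distrib, ← Finset.mul_sum, hl]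
        simp [gradDot, φ]
      · have : φ x = 0 := image_eq_zero_of_notMem_tsupport fun h => hx (hφs h)
        have h2 : η ‖x‖ = 0 := this
        simp [this, h2]
    · congr 1
      refine integral_congr_ae (Eventually.of_forall fun x => ?_)
      by_cases hx : x ∈ U
      · simp only [hdφ x hx, euler_eq_sum, Finset.mul_sum]
        refine Finset.sum_congr rfl fun i _ => ?_
        rw [EuclideanSpace.inner_single_right]
        simp
        ring
      · have h1 : ‖x‖ ∉ tsupport η := fun h => hx (hηs h)
        have h2 : deriv η ‖x‖ = 0 := by
          by_contra h
          exact h1 (support_deriv_subset h)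
        have h3 : fderiv ℝ φ x = 0 := by
          by_contra h
          exact hx (hφs (support_fderiv_subset ℝ h))
        simp [h2, h3]
  · exact fun i _ => integrable_mul_of_tsupport_subset (hdφc _) (hdφk _) ((hdφs _).trans hφs)
      (hgi _).continuousOn
  · exact fun i _ => integrable_mul_of_tsupport_subset hφ.continuous hφc hφs
      (((hgi _).continuousOn_fderiv_of_isOpen hU le_rfl).clm_apply continuousOn_const)

end Green

section StrongGreen

/-- The integral `∫ k(ρω) dω` over the unit sphere. -/
noncomputable def sphInt {d : ℕ} (k : EuclideanSpace ℝ (Fin d) → ℝ) (ρ : ℝ) : ℝ :=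
  ∫ ω : sphere (0 : EuclideanSpace ℝ (Fin d)) 1, k (ρ • (ω : EuclideanSpace ℝ (Fin d)))
    ∂(volume : Measure (EuclideanSpace ℝ (Fin d))).toSphere

lemma norm_smul_sphere {d : ℕ} {ρ : ℝ} (hρ : 0 ≤ ρ)
    (ω : sphere (0 : EuclideanSpace ℝ (Fin d)) 1) :
    ‖ρ • (ω : EuclideanSpace ℝ (Fin d))‖ = ρ := by
  simp [norm_smul, abs_of_nonneg hρ]

lemma sphPair_one {d : ℕ} (k : EuclideanSpace ℝ (Fin d) → ℝ) (ρ : ℝ) :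
    sphPair k (fun _ => 1) ρ ρ = sphInt k ρ := by
  simp [sphPair, sphInt]

lemma continuousOn_sphPair_comp {d : ℕ} {f g : EuclideanSpace ℝ (Fin d) → ℝ}
    {U W : Set (EuclideanSpace ℝ (Fin d))} (hf : ContinuousOn f U) (hg : ContinuousOn g W)
    {T : Set ℝ} {α β : ℝ → ℝ} (hα : ContinuousOn α T) (hβ : ContinuousOn β T)
    (hαU : ∀ t ∈ T, ∀ ω : sphere (0 : EuclideanSpace ℝ (Fin d)) 1,
      α t • (ω : EuclideanSpace ℝ (Fin d)) ∈ U)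
    (hβW : ∀ t ∈ T, ∀ ω : sphere (0 : EuclideanSpace ℝ (Fin d)) 1,
      β t • (ω : EuclideanSpace ℝ (Fin d)) ∈ W) :
    ContinuousOn (fun t => sphPair f g (α t) (β t)) T :=
  (continuousOn_sphPair (A := (fun t => (α t, β t)) '' T) hf hg (by
    rintro _ ⟨t, ht, rfl⟩ ω
    exact ⟨hαU t ht ω, hβW t ht ω⟩)).comp (f := fun t => (α t, β t)) (hα.prodMk hβ)
    (mapsTo_image _ _)

lemma continuousOn_sphInt {d : ℕ} {k : EuclideanSpace ℝ (Fin d) → ℝ}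
    {U : Set (EuclideanSpace ℝ (Fin d))} (hk : ContinuousOn k U) {T : Set ℝ}
    (hT : ∀ t ∈ T, ∀ ω : sphere (0 : EuclideanSpace ℝ (Fin d)) 1,
      t • (ω : EuclideanSpace ℝ (Fin d)) ∈ U) :
    ContinuousOn (sphInt k) T := by
  refine (continuousOn_sphPair_comp (g := fun _ => 1) (W := univ) hk continuousOn_const
    continuousOn_id continuousOn_id hT fun _ _ _ => mem_univ _).congr fun ρ _ => ?_
  exact (sphPair_one k ρ).symm

variable {m : ℕ} {a b : ℝ} {f g : EuclideanSpace ℝ (Fin (m + 2)) → ℝ}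

lemma integral_comp_norm_mul {ψ : ℝ → ℝ} {k : EuclideanSpace ℝ (Fin (m + 2)) → ℝ} (ha : 0 ≤ a)
    (hψ : Continuous ψ) (hψs : tsupport ψ ⊆ Ioo a b) (hk : ContinuousOn k (norm ⁻¹' Ioo a b)) :
    ∫ x, ψ ‖x‖ * k x = ∫ ρ, ψ ρ * (ρ ^ (m + 1) * sphInt k ρ) := by
  have hs : tsupport (fun x : EuclideanSpace ℝ (Fin (m + 2)) => ψ ‖x‖) ⊆ norm ⁻¹' tsupport ψ :=
    closure_minimal (fun x hx => subset_tsupport ψ hx)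
      ((isClosed_tsupport ψ).preimage continuous_norm)
  have hc : HasCompactSupport (fun x : EuclideanSpace ℝ (Fin (m + 2)) => ψ ‖x‖) :=
    (isCompact_closedBall 0 b).of_isClosed_subset (isClosed_tsupport _) fun x hx => by
      simpa using (hψs (hs hx)).2.le
  rw [integral_eq_integral_Ioi_sphere (integrable_mul_of_tsupport_subset (by fun_prop) hc
    (hs.trans (preimage_mono hψs)) hk), ← setIntegral_eq_integral_of_forall_compl_eq_zero
    (s := Ioi 0) (f := fun ρ => ψ ρ * (ρ ^ (m + 1) * sphInt k ρ))]
  · refine setIntegral_congr_fun measurableSet_Ioi fun ρ hρ => ?_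
    have hρ' : (0 : ℝ) < ρ := hρ
    simp only [norm_smul_sphere hρ'.le, integral_const_mul, sphInt]
    ring
  · intro ρ hρ
    have : ψ ρ = 0 := image_eq_zero_of_notMem_tsupport fun h =>
      hρ (ha.trans_lt (hψs h).1)
    simp [this]

lemma smul_sphere_mem_shell (ha : 0 ≤ a) {ρ : ℝ} (hρ : ρ ∈ Ioo a b)
    (ω : sphere (0 : EuclideanSpace ℝ (Fin (m + 2))) 1) :
    ρ • (ω : EuclideanSpace ℝ (Fin (m + 2))) ∈ norm ⁻¹' Ioo a b := by
  rwa [mem_preimage, norm_smul_sphere (ha.trans hρ.1.le)]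

lemma hasDerivAt_pow_mul_sphPair_euler_aux (ha : 0 ≤ a)
    (hf : ContDiffOn ℝ 1 f (norm ⁻¹' Ioo a b)) (hg : ContDiffOn ℝ 2 g (norm ⁻¹' Ioo a b))
    {ρ : ℝ} (hρ : ρ ∈ Ioo a b) :
    HasDerivAt (fun ρ => ρ ^ m * sphPair f (euler g) ρ ρ)
      (m * ρ ^ (m - 1) * sphPair f (euler g) ρ ρ + ρ ^ m * (1 / ρ * sphPair (euler f) (euler g) ρ ρ +
        1 / ρ * sphPair f (euler (euler g)) ρ ρ)) ρ := by
  have hU := isOpen_norm_preimage_Ioo (a := a) (b := b) (d := m + 2)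
  have h0 : ρ ≠ 0 := (ha.trans_lt hρ.1).ne'
  exact (hasDerivAt_pow m ρ).mul (hasDerivAt_sphPair hU hU hf (hg.euler hU) (hasDerivAt_id ρ)
    (hasDerivAt_id ρ) h0 h0 (smul_sphere_mem_shell ha hρ) (smul_sphere_mem_shell ha hρ))

/-- Green's identity on spheres. -/
lemma hasDerivAt_pow_mul_sphPair_euler (ha : 0 ≤ a)
    (hf : ContDiffOn ℝ 1 f (norm ⁻¹' Ioo a b)) (hg : ContDiffOn ℝ 2 g (norm ⁻¹' Ioo a b))
    (hlap : ∀ x ∈ norm ⁻¹' Ioo a b, lap g x = 0) {ρ : ℝ} (hρ : ρ ∈ Ioo a b) :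
    HasDerivAt (fun ρ => ρ ^ m * sphPair f (euler g) ρ ρ)
      (ρ ^ (m + 1) * sphInt (gradDot f g) ρ) ρ := by
  have hU := isOpen_norm_preimage_Ioo (a := a) (b := b) (d := m + 2)
  have hg1 := hg.euler hU
  have hmem := fun t (ht : t ∈ Ioo a b) => smul_sphere_mem_shell (m := m) ha ht
  set M : ℝ → ℝ := fun ρ => ρ ^ m * sphPair f (euler g) ρ ρ with hM
  set M' : ℝ → ℝ := fun ρ => m * ρ ^ (m - 1) * sphPair f (euler g) ρ ρ +
    ρ ^ m * (1 / ρ * sphPair (euler f) (euler g) ρ ρ +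
        1 / ρ * sphPair f (euler (euler g)) ρ ρ) with hM'
  have hder : ∀ ρ ∈ Ioo a b, HasDerivAt M (M' ρ) ρ := fun ρ hρ =>
    hasDerivAt_pow_mul_sphPair_euler_aux ha hf hg hρ
  have hne : ∀ ρ ∈ Ioo a b, ρ ≠ 0 := fun ρ hρ => (ha.trans_lt hρ.1).ne'
  have hinv : ContinuousOn (fun ρ : ℝ => 1 / ρ) (Ioo a b) :=
    continuousOn_const.div continuousOn_id hne
  have hMc : ContinuousOn M (Ioo a b) := fun ρ hρ => (hder ρ hρ).continuousAt.continuousWithinAt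
  have hf0 := hf.continuousOn_euler hU
  have hg2 := hg1.continuousOn_euler hU
  have hM'c : ContinuousOn M' (Ioo a b) := by
    have h1 := continuousOn_sphPair_comp hf.continuousOn hg1.continuousOn
      (continuousOn_id (s := Ioo a b)) continuousOn_id hmem hmem
    have h2 := continuousOn_sphPair_comp hf0 hg1.continuousOn
      (continuousOn_id (s := Ioo a b)) continuousOn_id hmem hmem
    have h3 := continuousOn_sphPair_comp hf.continuousOn hg2
      (continuousOn_id (s := Ioo a b)) continuousOn_id hmem hmem
    simp only [id] at h1 h2 h3
    exact ((continuousOn_const.fun_mul (by fun_prop)).fun_mul h1).fun_add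
      ((by fun_prop : ContinuousOn (fun ρ : ℝ => ρ ^ m) _).fun_mul
      ((hinv.fun_mul h2).fun_add (hinv.fun_mul h3)))
  have hD := continuousOn_gradDot hU hf (hg.of_le (by norm_num))
  have hKc : ContinuousOn (fun ρ => ρ ^ (m + 1) * sphInt (gradDot f g) ρ) (Ioo a b) :=
    (by fun_prop : ContinuousOn (fun ρ : ℝ => ρ ^ (m + 1)) _).fun_mul (continuousOn_sphInt hD hmem)
  have hz : ∀ᵐ ρ, ρ ∈ Ioo a b → M' ρ - ρ ^ (m + 1) * sphInt (gradDot f g) ρ = 0 := by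
    refine isOpen_Ioo.ae_eq_zero_of_integral_contDiff_smul_eq_zero
      ((hM'c.fun_sub hKc).locallyIntegrableOn measurableSet_Ioo) fun η hη hηc hηs => ?_
    have hη1 : ContDiff ℝ 1 η := hη.of_le (by exact_mod_cast le_top)
    have hη' : Continuous (deriv η) := hη1.continuous_deriv le_rfl
    have hs' : tsupport (deriv η) ⊆ tsupport η := closure_minimal
      (fun x hx => support_deriv_subset hx) (isClosed_tsupport η)
    have hη'c : HasCompactSupport (deriv η) := hηc.deriv
    have hk : ContinuousOn (fun x : EuclideanSpace ℝ (Fin (m + 2)) =>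
        ‖x‖⁻¹ * (f x * euler g x)) (norm ⁻¹' Ioo a b) :=
      (continuous_norm.continuousOn.inv₀ fun x hx => hne _ hx).fun_mul
        (hf.continuousOn.fun_mul hg1.continuousOn)
    have hweak := integral_cutoff_gradDot ha hf hg hlap hη1 hηs
    simp only [mul_assoc] at hweak
    rw [integral_comp_norm_mul ha hη1.continuous hηs hD,
      integral_comp_norm_mul ha hη' (hs'.trans hηs) hk] at hweak
    have hpt : ∀ ρ, deriv η ρ * (ρ ^ (m + 1) * sphInt (fun x => ‖x‖⁻¹ * (f x * euler g x)) ρ) =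
        deriv η ρ * M ρ := by
      intro ρ
      by_cases hρ : ρ ∈ Ioo a b
      · have h0 : 0 < ρ := ha.trans_lt hρ.1
        simp only [sphInt, hM, sphPair, norm_smul_sphere h0.le, integral_const_mul]
        field_simp
        ring
      · have : deriv η ρ = 0 := image_eq_zero_of_notMem_tsupport fun h => hρ (hηs (hs' h))
        simp [this]
    simp only [hpt] at hweak
    have i1 : Integrable (fun ρ => η ρ * M' ρ) :=
      integrable_mul_of_tsupport_subset hη1.continuous hηc hηs hM'c
    have i2 : Integrable (fun ρ => η ρ * (ρ ^ (m + 1) * sphInt (gradDot f g) ρ)) :=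
      integrable_mul_of_tsupport_subset hη1.continuous hηc hηs hKc
    have i3 : Integrable (fun ρ => deriv η ρ * M ρ) :=
      integrable_mul_of_tsupport_subset hη' hη'c (hs'.trans hηs) hMc
    have i4 : Integrable (fun ρ => η ρ * M ρ) :=
      integrable_mul_of_tsupport_subset hη1.continuous hηc hηs hMc
    have hfd : ∀ ρ, η ρ * fderiv ℝ M ρ 1 = η ρ * M' ρ := by
      intro ρ
      by_cases hρ : ρ ∈ Ioo a b
      · rw [fderiv_apply_one_eq_deriv, (hder ρ hρ).deriv]
      · have : η ρ = 0 := image_eq_zero_of_notMem_tsupport fun h => hρ (hηs h)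
        simp [this]
    have hparts : ∫ ρ, η ρ * fderiv ℝ M ρ 1 = - ∫ ρ, fderiv ℝ η ρ 1 * M ρ := by
      refine integral_mul_fderiv_eq_neg_fderiv_mul_of_integrable ?_ ?_ i4
        (fun x _ => hη1.differentiable one_ne_zero x)
        (fun x hx => (hder x (hηs hx)).differentiableAt)
      · simpa only [fderiv_apply_one_eq_deriv] using i3
      · simpa only [hfd] using i1
    simp only [hfd] at hparts
    simp only [fderiv_apply_one_eq_deriv] at hparts
    simp only [smul_eq_mul, mul_sub]
    rw [integral_sub i1 i2, hparts, hweak, sub_self]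
  have heq : EqOn M' (fun ρ => ρ ^ (m + 1) * sphInt (gradDot f g) ρ) (Ioo a b) := by
    refine Measure.eqOn_open_of_ae_eq (μ := volume) ?_ isOpen_Ioo hM'c hKc
    rw [EventuallyEq, ae_restrict_iff' measurableSet_Ioo]
    filter_upwards [hz] with ρ h hρ
    exact sub_eq_zero.1 (h hρ)
  have := hder ρ hρ
  rwa [heq hρ] at this

/-- Green's identity on a spherical shell, which for `a = 0` is a punctured ball. -/
lemma integral_gradDot_shell {U : Set (EuclideanSpace ℝ (Fin (m + 2)))} (hU : IsOpen U)
    (ha : 0 ≤ a) (hab : a ≤ b) (hs : norm ⁻¹' Icc a b ⊆ U)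
    (hf : ContDiffOn ℝ 1 f U) (hg : ContDiffOn ℝ 2 g U)
    (hlap : ∀ x ∈ norm ⁻¹' Ioo a b, lap g x = 0) :
    IntegrableOn (gradDot f g) (norm ⁻¹' Ioo a b) ∧
    ∫ x in norm ⁻¹' Ioo a b, gradDot f g x =
      b ^ m * sphPair f (euler g) b b - a ^ m * sphPair f (euler g) a a := by
  have hD := continuousOn_gradDot hU hf (hg.of_le (by norm_num))
  have hsub : (norm ⁻¹' Ioo a b : Set (EuclideanSpace ℝ (Fin (m + 2)))) ⊆ norm ⁻¹' Icc a b :=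
    preimage_mono Ioo_subset_Icc_self
  have hcomp : IsCompact (norm ⁻¹' Icc a b : Set (EuclideanSpace ℝ (Fin (m + 2)))) :=
    (isCompact_closedBall 0 b).of_isClosed_subset (isClosed_Icc.preimage continuous_norm)
      fun x hx => by simpa using hx.2
  have hint : IntegrableOn (gradDot f g) (norm ⁻¹' Ioo a b) :=
    ((hD.mono hs).integrableOn_compact hcomp).mono_set hsub
  refine ⟨hint, ?_⟩
  have hmem : ∀ t ∈ Icc a b, ∀ ω : sphere (0 : EuclideanSpace ℝ (Fin (m + 2))) 1,
      t • (ω : EuclideanSpace ℝ (Fin (m + 2))) ∈ U := fun t ht ω => hs (by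
    rwa [mem_preimage, norm_smul_sphere (ha.trans ht.1)])
  rw [setIntegral_norm_preimage_eq measurableSet_Ioo (fun x hx => ha.trans_lt hx.1) hint,
    ← integral_Ioc_eq_integral_Ioo, ← intervalIntegral.integral_of_le hab]
  refine intervalIntegral.integral_eq_sub_of_hasDerivAt_of_le
    (f := fun ρ => ρ ^ m * sphPair f (euler g) ρ ρ) hab ?_ ?_ ?_
  · have := continuousOn_sphPair_comp hf.continuousOn (hg.euler hU).continuousOn
      (continuousOn_id (s := Icc a b)) continuousOn_id hmem hmem
    exact (by fun_prop : ContinuousOn (fun ρ : ℝ => ρ ^ m) _).fun_mul this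
  · exact fun ρ hρ => hasDerivAt_pow_mul_sphPair_euler ha (hf.mono (hsub.trans hs))
      (hg.mono (hsub.trans hs)) hlap hρ
  · refine ContinuousOn.intervalIntegrable ?_
    rw [uIcc_of_le hab]
    exact (by fun_prop : ContinuousOn (fun ρ : ℝ => ρ ^ (m + 1)) _).fun_mul
      (continuousOn_sphInt hD hmem)

lemma gradDot_comm {d : ℕ} (f g : EuclideanSpace ℝ (Fin d) → ℝ) : gradDot f g = gradDot g f := by
  ext x
  simp only [gradDot, mul_comm]

lemma gradDot_self_nonneg {d : ℕ} (f : EuclideanSpace ℝ (Fin d) → ℝ)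
    (x : EuclideanSpace ℝ (Fin d)) : 0 ≤ gradDot f f x :=
  Finset.sum_nonneg fun _ _ => mul_self_nonneg _

lemma euler_zero {d : ℕ} (f : EuclideanSpace ℝ (Fin d) → ℝ) : euler f 0 = 0 := by
  simp [euler]

lemma sphPair_euler_zero {d : ℕ} (f g : EuclideanSpace ℝ (Fin d) → ℝ) (a : ℝ) :
    sphPair f (euler g) a 0 = 0 := by
  simp [sphPair, euler_zero]

/-- A function that is `C²` and harmonic on a ball centred at the origin. -/
structure HarmonicBall {d : ℕ} (f : EuclideanSpace ℝ (Fin d) → ℝ) (b : ℝ) : Prop where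
  contDiffOn : ContDiffOn ℝ 2 f (ball 0 b)
  lap_eq_zero : ∀ x ∈ ball (0 : EuclideanSpace ℝ (Fin d)) b, lap f x = 0

lemma HarmonicBall.mono {d : ℕ} {f : EuclideanSpace ℝ (Fin d) → ℝ} {b c : ℝ}
    (hf : HarmonicBall f b) (hc : c ≤ b) : HarmonicBall f c :=
  ⟨hf.1.mono (ball_subset_ball hc), fun x hx => hf.2 x (ball_subset_ball hc hx)⟩

lemma preimage_norm_Icc_subset_ball {d : ℕ} {a b c : ℝ} (hc : b < c) :
    (norm ⁻¹' Icc a b : Set (EuclideanSpace ℝ (Fin d))) ⊆ ball 0 c := fun x hx => by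
  simpa using hx.2.trans_lt hc

lemma HarmonicBall.integral_gradDot {c : ℝ} (hf : ContDiffOn ℝ 1 f (ball 0 c))
    (hg : HarmonicBall g c) (hb : 0 ≤ b) (hbc : b < c) :
    ∫ x in norm ⁻¹' Ioo 0 b, gradDot f g x = b ^ m * sphPair f (euler g) b b := by
  rw [(integral_gradDot_shell isOpen_ball le_rfl hb (preimage_norm_Icc_subset_ball hbc) hf hg.1
    fun x hx => hg.2 x (preimage_norm_Icc_subset_ball hbc (Ioo_subset_Icc_self hx))).2,
    sphPair_euler_zero]
  simp

/-- The Dirichlet-to-Neumann pairing of two harmonic functions is symmetric. -/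
lemma HarmonicBall.sphPair_euler_comm {c : ℝ} (hf : HarmonicBall f c) (hg : HarmonicBall g c)
    (hb : 0 ≤ b) (hbc : b < c) : sphPair f (euler g) b b = sphPair (euler f) g b b := by
  rcases hb.eq_or_lt with rfl | hb0
  · simp [sphPair, euler_zero]
  have h1 := hg.integral_gradDot (hf.1.of_le (by norm_num)) hb hbc
  have h2 := hf.integral_gradDot (hg.1.of_le (by norm_num)) hb hbc
  rw [gradDot_comm, h1, sphPair_comm g] at h2
  exact mul_left_cancel₀ (pow_pos hb0 m).ne' h2

lemma HarmonicBall.sphPair_euler_nonneg {c : ℝ} (hf : HarmonicBall f c)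
    (hb : 0 ≤ b) (hbc : b < c) : 0 ≤ sphPair f (euler f) b b := by
  rcases hb.eq_or_lt with rfl | hb0
  · simp [sphPair_euler_zero]
  have h1 := hf.integral_gradDot (hf.1.of_le (by norm_num)) hb hbc
  have h2 : 0 ≤ ∫ x in norm ⁻¹' Ioo 0 b, gradDot f f x :=
    integral_nonneg fun x => gradDot_self_nonneg f x
  rw [h1] at h2
  exact nonneg_of_mul_nonneg_right h2 (pow_pos hb0 m)

lemma euler_comp_smul {d : ℕ} (f : EuclideanSpace ℝ (Fin d) → ℝ) (c : ℝ) :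
    euler (fun x => f (c • x)) = fun x => euler f (c • x) := by
  ext x
  simp [euler, fderiv_comp_smul]

lemma lap_comp_smul {d : ℕ} (f : EuclideanSpace ℝ (Fin d) → ℝ) (c : ℝ)
    (x : EuclideanSpace ℝ (Fin d)) :
    lap (fun x => f (c • x)) x = c ^ 2 * lap f (c • x) := by
  simp only [lap, fderiv_comp_smul, Finset.mul_sum]
  refine Finset.sum_congr rfl fun i _ => ?_
  have : (fun y => (c • fderiv ℝ f (c • y)) (EuclideanSpace.single i (1 : ℝ))) =
      c • fun y => (fun z => fderiv ℝ f z (EuclideanSpace.single i (1 : ℝ))) (c • y) := by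
    ext y
    simp
  rw [this, fderiv_const_smul_field, Pi.smul_apply,
    fderiv_comp_smul (f := fun z => fderiv ℝ f z (EuclideanSpace.single i (1 : ℝ)))]
  simp
  ring

lemma sphPair_comp_smul_right {d : ℕ} (f g : EuclideanSpace ℝ (Fin d) → ℝ) (a b c : ℝ) :
    sphPair f (fun x => g (c • x)) a b = sphPair f g a (c * b) := by
  simp [sphPair, smul_smul]

lemma HarmonicBall.comp_smul {d : ℕ} {f : EuclideanSpace ℝ (Fin d) → ℝ} {b c : ℝ}
    (hf : HarmonicBall f b) (hc : 0 < c) : HarmonicBall (fun x => f (c • x)) (b / c) := by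
  have hmem : ∀ x ∈ ball (0 : EuclideanSpace ℝ (Fin d)) (b / c), c • x ∈ ball 0 b := fun x hx => by
    rw [mem_ball_zero_iff, lt_div_iff₀ hc] at hx
    rw [mem_ball_zero_iff, norm_smul, Real.norm_eq_abs, abs_of_pos hc]
    linarith
  refine ⟨hf.1.comp (by fun_prop) hmem, fun x hx => ?_⟩
  rw [lap_comp_smul, hf.2 _ (hmem x hx), mul_zero]

end StrongGreen

section HarmonicBall

variable {m : ℕ} {f h : EuclideanSpace ℝ (Fin (m + 2)) → ℝ} {r c : ℝ}

lemma smul_sphere_mem_ball {d : ℕ} {a c : ℝ} (ha : 0 ≤ a) (hac : a < c)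
    (ω : sphere (0 : EuclideanSpace ℝ (Fin d)) 1) :
    a • (ω : EuclideanSpace ℝ (Fin d)) ∈ ball 0 c := by
  rwa [mem_ball_zero_iff, norm_smul_sphere ha]

lemma HarmonicBall.sphPair_euler_comm_of_lt (hh : HarmonicBall h r) {a b : ℝ} (ha : 0 < a)
    (har : a < r) (hb : 0 < b) (hbr : b < r) :
    sphPair h (euler h) a b = sphPair (euler h) h a b := by
  have hl : 0 < b / a := div_pos hb ha
  have h1 : a < min r (r / (b / a)) := by
    refine lt_min har ?_
    rw [lt_div_iff₀ hl, mul_div_cancel₀ _ ha.ne']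
    exact hbr
  have h2 := (hh.mono (min_le_left _ _)).sphPair_euler_comm
    ((hh.comp_smul hl).mono (min_le_right _ _)) ha.le h1
  rw [euler_comp_smul, sphPair_comp_smul_right, sphPair_comp_smul_right,
    div_mul_cancel₀ _ ha.ne'] at h2
  exact h2

/-- The spherical pairing of a harmonic function with itself at radii `a`, `b` depends only on
`a * b`. -/
lemma HarmonicBall.sphPair_self_eq (hh : HarmonicBall h r)
    (hc : ContinuousOn h (closedBall 0 r)) (hr : 0 < r) {x : ℝ} (hx : x ∈ Ioo (0 : ℝ) 1) :
    sphPair h h r (r * x ^ 2) = sphPair h h (r * x) (r * x) := by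
  obtain ⟨hx0, hx1⟩ := hx
  have hrx : 0 < r * x := mul_pos hr hx0
  have hle : r * x < r := by nlinarith
  set C := (r * x) ^ 2 with hC
  have hC0 : 0 < C := by positivity
  have hpos : ∀ a ∈ Icc (r * x) r, 0 < a := fun a ha => hrx.trans_le ha.1
  have hdiv : ∀ a ∈ Icc (r * x) r, C / a ≤ r * x := fun a ha => by
    rw [div_le_iff₀ (hpos a ha), hC]
    nlinarith [ha.1]
  have hcont : ContinuousOn (fun a => sphPair h h a (C / a)) (Icc (r * x) r) := by
    refine continuousOn_sphPair_comp hc hc continuousOn_id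
      (continuousOn_const.div continuousOn_id fun a ha => (hpos a ha).ne') ?_ ?_
    · intro a ha ω
      rw [mem_closedBall_zero_iff]
      exact (norm_smul_sphere (hpos a ha).le ω).le.trans ha.2
    · intro a ha ω
      rw [mem_closedBall_zero_iff, norm_smul_sphere (div_pos hC0 (hpos a ha)).le]
      exact (hdiv a ha).trans hle.le
  have hder : ∀ a ∈ Ico (r * x) r,
      HasDerivWithinAt (fun a => sphPair h h a (C / a)) 0 (Ici a) a := fun a ha => by
    have ha' := Ico_subset_Icc_self ha
    have ha0 := hpos a ha'
    have hb0 : 0 < C / a := div_pos hC0 ha0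
    have hbr : C / a < r := (hdiv a ha').trans_lt hle
    have h1 := hh.1.of_le (m := 1) (by norm_num)
    have hβ : HasDerivAt (fun a : ℝ => C / a) (-C / a ^ 2) a := by
      have := (hasDerivAt_inv ha0.ne').const_mul C
      refine this.congr_deriv ?_
      ring
    have := hasDerivAt_sphPair isOpen_ball isOpen_ball h1 h1 (hasDerivAt_id a) hβ
      ha0.ne' hb0.ne' (smul_sphere_mem_ball ha0.le ha.2) (smul_sphere_mem_ball hb0.le hbr)
    refine (this.congr_deriv ?_).hasDerivWithinAt
    simp only [id]
    rw [hh.sphPair_euler_comm_of_lt ha0 ha.2 hb0 hbr]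
    field_simp
    ring
  have := constant_of_has_deriv_right_zero hcont hder r ⟨hle.le, le_rfl⟩
  have e1 : C / r = r * x ^ 2 := by
    rw [hC]
    field_simp
  have e2 : C / (r * x) = r * x := by
    rw [hC]
    field_simp
  rwa [e1, e2] at this

lemma HarmonicBall.monotoneOn_sphPair_self (hf : HarmonicBall f c) :
    MonotoneOn (fun ρ => sphPair f f ρ ρ) (Ico 0 c) := by
  have h1 := hf.1.of_le (m := 1) (by norm_num)
  have hd : ∀ ρ ∈ Ioo 0 c, HasDerivAt (fun ρ => sphPair f f ρ ρ)
      (1 / ρ * sphPair (euler f) f ρ ρ + 1 / ρ * sphPair f (euler f) ρ ρ) ρ := fun ρ hρ =>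
    hasDerivAt_sphPair isOpen_ball isOpen_ball h1 h1 (hasDerivAt_id ρ) (hasDerivAt_id ρ)
      hρ.1.ne' hρ.1.ne' (smul_sphere_mem_ball hρ.1.le hρ.2) (smul_sphere_mem_ball hρ.1.le hρ.2)
  refine monotoneOn_of_deriv_nonneg (convex_Ico 0 c) ?_ ?_ ?_
  · have hm : ∀ ρ ∈ Ico 0 c, ∀ ω : sphere (0 : EuclideanSpace ℝ (Fin (m + 2))) 1,
      ρ • (ω : EuclideanSpace ℝ (Fin (m + 2))) ∈ ball 0 c := fun ρ hρ =>
        smul_sphere_mem_ball hρ.1 hρ.2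
    exact continuousOn_sphPair_comp hf.1.continuousOn hf.1.continuousOn continuousOn_id
      continuousOn_id hm hm
  · rw [interior_Ico]
    exact fun ρ hρ => (hd ρ hρ).differentiableAt.differentiableWithinAt
  · rw [interior_Ico]
    intro ρ hρ
    have h0 := hρ.1
    rw [(hd ρ hρ).deriv, sphPair_comm (euler f)]
    have := hf.sphPair_euler_nonneg hρ.1.le hρ.2
    positivity

lemma lap_smul_sub {d : ℕ} {f g : EuclideanSpace ℝ (Fin d) → ℝ}
    {U : Set (EuclideanSpace ℝ (Fin d))} (hU : IsOpen U) (hf : ContDiffOn ℝ 2 f U)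
    (hg : ContDiffOn ℝ 2 g U) (k : ℝ) {x : EuclideanSpace ℝ (Fin d)} (hx : x ∈ U) :
    lap (fun y => k * (f y - g y)) x = k * (lap f x - lap g x) := by
  simp only [lap, ← Finset.sum_sub_distrib, Finset.mul_sum]
  refine Finset.sum_congr rfl fun i _ => ?_
  have hd : ∀ {f : EuclideanSpace ℝ (Fin d) → ℝ}, ContDiffOn ℝ 2 f U → ∀ y ∈ U,
      DifferentiableAt ℝ f y := fun hf y hy =>
    (hf.contDiffAt (hU.mem_nhds hy)).differentiableAt two_ne_zero
  have hd2 : ∀ {f : EuclideanSpace ℝ (Fin d) → ℝ}, ContDiffOn ℝ 2 f U →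
      DifferentiableAt ℝ (fun y => fderiv ℝ f y (EuclideanSpace.single i (1 : ℝ))) x := fun hf =>
    ((hf.fderiv_single hU _).contDiffAt (hU.mem_nhds hx)).differentiableAt one_ne_zero
  have he : (fun y => fderiv ℝ (fun y => k * (f y - g y)) y (EuclideanSpace.single i (1 : ℝ)))
      =ᶠ[𝓝 x] fun y => k * (fderiv ℝ f y (EuclideanSpace.single i (1 : ℝ)) -
        fderiv ℝ g y (EuclideanSpace.single i (1 : ℝ))) := by
    filter_upwards [hU.mem_nhds hx] with y hy
    rw [fderiv_const_mul ((hd hf y hy).fun_sub (hd hg y hy)), fderiv_fun_sub (hd hf y hy) (hd hg y hy)]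
    simp
  rw [he.fderiv_eq, fderiv_const_mul ((hd2 hf).fun_sub (hd2 hg)), fderiv_fun_sub (hd2 hf) (hd2 hg)]
  simp

lemma HarmonicBall.difference_quotient {d : ℕ} {h : EuclideanSpace ℝ (Fin d) → ℝ}
    (hh : HarmonicBall h r) (w : EuclideanSpace ℝ (Fin d)) (k : ℝ) :
    HarmonicBall (fun x => k * (h (x + w) - h x)) (r - ‖w‖) := by
  have hm : ∀ x ∈ ball (0 : EuclideanSpace ℝ (Fin d)) (r - ‖w‖), x + w ∈ ball 0 r := fun x hx => by
    rw [mem_ball_zero_iff] at hx ⊢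
    linarith [norm_add_le x w]
  have hsub : ball (0 : EuclideanSpace ℝ (Fin d)) (r - ‖w‖) ⊆ ball 0 r :=
    ball_subset_ball (by linarith [norm_nonneg w])
  have h1 : ContDiffOn ℝ 2 (fun x => h (x + w)) (ball 0 (r - ‖w‖)) :=
    hh.1.comp (by fun_prop) hm
  have h2 := hh.1.mono hsub
  refine ⟨contDiffOn_const.mul (h1.sub h2), fun x hx => ?_⟩
  rw [lap_smul_sub isOpen_ball h1 h2 k hx, hh.2 x (hsub hx)]
  have : lap (fun x => h (x + w)) x = lap h (x + w) := by
    simp only [lap]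
    refine Finset.sum_congr rfl fun i _ => ?_
    simp only [fderiv_comp_add_right]
    rw [fderiv_comp_add_right (f := fun y => fderiv ℝ h y (EuclideanSpace.single i (1 : ℝ)))]
  rw [this, hh.2 _ (hm x hx)]
  simp

lemma tendsto_sphPair_difference_quotient {d : ℕ} {h : EuclideanSpace ℝ (Fin d) → ℝ}
    (hh : ContDiffOn ℝ 1 h (ball 0 r)) (v : EuclideanSpace ℝ (Fin d)) {ρ : ℝ} (h0 : 0 ≤ ρ)
    (hρ : ρ < r) :
    Tendsto (fun ε : ℝ => sphPair (fun x => ε⁻¹ * (h (x + ε • v) - h x))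
      (fun x => ε⁻¹ * (h (x + ε • v) - h x)) ρ ρ) (𝓝[≠] 0)
      (𝓝 (sphPair (fun x => fderiv ℝ h x v) (fun x => fderiv ℝ h x v) ρ ρ)) := by
  obtain ⟨c, hρc, hcr⟩ := exists_between hρ
  have hcs : closedBall (0 : EuclideanSpace ℝ (Fin d)) c ⊆ ball 0 r := closedBall_subset_ball hcr
  obtain ⟨C, hC⟩ := (isCompact_closedBall (0 : EuclideanSpace ℝ (Fin d)) c).exists_bound_of_continuousOn
    ((hh.continuousOn_fderiv_of_isOpen isOpen_ball le_rfl).mono hcs)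
  have hsm : ∀ᶠ ε : ℝ in 𝓝[≠] 0, ρ + ‖ε • v‖ < c := by
    have : Tendsto (fun ε : ℝ => ρ + ‖ε • v‖) (𝓝 0) (𝓝 (ρ + ‖(0 : ℝ) • v‖)) := by
      exact Continuous.tendsto (by fun_prop) 0
    rw [zero_smul, norm_zero, add_zero] at this
    exact (this.eventually_lt_const hρc).filter_mono nhdsWithin_le_nhds
  have hmem : ∀ {ε : ℝ}, ρ + ‖ε • v‖ < c → ∀ ω : sphere (0 : EuclideanSpace ℝ (Fin d)) 1,
      ρ • (ω : EuclideanSpace ℝ (Fin d)) + ε • v ∈ closedBall 0 c := fun {ε} hε ω => by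
    rw [mem_closedBall_zero_iff]
    have := norm_add_le (ρ • (ω : EuclideanSpace ℝ (Fin d))) (ε • v)
    rw [norm_smul_sphere h0] at this
    exact this.trans hε.le
  have hmem0 : ∀ ω : sphere (0 : EuclideanSpace ℝ (Fin d)) 1,
      ρ • (ω : EuclideanSpace ℝ (Fin d)) ∈ closedBall 0 c := fun ω => by
    rw [mem_closedBall_zero_iff, norm_smul_sphere h0]
    exact hρc.le
  have hd : ∀ x ∈ closedBall (0 : EuclideanSpace ℝ (Fin d)) c, DifferentiableAt ℝ h x := fun x hx =>
    (hh.contDiffAt (isOpen_ball.mem_nhds (hcs hx))).differentiableAt one_ne_zero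
  refine tendsto_integral_filter_of_dominated_convergence (fun _ => (C * ‖v‖) * (C * ‖v‖)) ?_ ?_
    (integrable_const _) ?_
  · filter_upwards [hsm] with ε hε
    have hc : Continuous fun ω : sphere (0 : EuclideanSpace ℝ (Fin d)) 1 =>
        ε⁻¹ * (h (ρ • (ω : EuclideanSpace ℝ (Fin d)) + ε • v) -
          h (ρ • (ω : EuclideanSpace ℝ (Fin d)))) := by
      refine continuous_const.mul (Continuous.sub ?_ ?_)
      · exact (hh.continuousOn.mono hcs).comp_continuous (by fun_prop) (hmem hε)
      · exact (hh.continuousOn.mono hcs).comp_continuous (by fun_prop) hmem0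
    exact (hc.mul hc).aestronglyMeasurable
  · filter_upwards [hsm, self_mem_nhdsWithin] with ε hε hε0
    refine Eventually.of_forall fun ω => ?_
    have hb : ‖ε⁻¹ * (h (ρ • (ω : EuclideanSpace ℝ (Fin d)) + ε • v) -
          h (ρ • (ω : EuclideanSpace ℝ (Fin d))))‖ ≤ C * ‖v‖ := by
      have := (convex_closedBall (0 : EuclideanSpace ℝ (Fin d)) c).norm_image_sub_le_of_norm_fderiv_le
        hd hC (hmem0 ω) (hmem hε ω)
      rw [add_sub_cancel_left, norm_smul] at this
      rw [norm_mul, norm_inv, inv_mul_le_iff₀ (norm_pos_iff.2 hε0)]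
      linarith
    rw [norm_mul]
    exact mul_le_mul hb hb (norm_nonneg _) ((norm_nonneg _).trans hb)
  · refine Eventually.of_forall fun ω => ?_
    have : Tendsto (fun ε : ℝ => ε⁻¹ * (h (ρ • (ω : EuclideanSpace ℝ (Fin d)) + ε • v) -
          h (ρ • (ω : EuclideanSpace ℝ (Fin d))))) (𝓝[≠] 0)
          (𝓝 (fderiv ℝ h (ρ • (ω : EuclideanSpace ℝ (Fin d))) v)) := by
      have := ((hd _ (hmem0 ω)).hasFDerivAt.hasLineDerivAt v).tendsto_slope_zero
      simpa using this
    exact this.mul this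

lemma HarmonicBall.monotoneOn_sphInt_gradDot (hh : HarmonicBall h r) :
    MonotoneOn (sphInt (gradDot h h)) (Ico 0 r) := by
  intro a ha b hb hab
  have hcd := hh.1.of_le (m := 1) (by norm_num)
  have hv : ∀ v, sphPair (fun x => fderiv ℝ h x v) (fun x => fderiv ℝ h x v) a a ≤
      sphPair (fun x => fderiv ℝ h x v) (fun x => fderiv ℝ h x v) b b := fun v => by
    refine le_of_tendsto_of_tendsto (tendsto_sphPair_difference_quotient hcd v ha.1 ha.2)
      (tendsto_sphPair_difference_quotient hcd v hb.1 hb.2) ?_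
    have hsm : ∀ᶠ ε : ℝ in 𝓝[≠] 0, b + ‖ε • v‖ < r := by
      have : Tendsto (fun ε : ℝ => b + ‖ε • v‖) (𝓝 0) (𝓝 (b + ‖(0 : ℝ) • v‖)) := by
        exact Continuous.tendsto (by fun_prop) 0
      rw [zero_smul, norm_zero, add_zero] at this
      exact (this.eventually_lt_const hb.2).filter_mono nhdsWithin_le_nhds
    filter_upwards [hsm] with ε hε
    have hb' : b < r - ‖ε • v‖ := by linarith
    exact (hh.difference_quotient (ε • v) ε⁻¹).monotoneOn_sphPair_self
      ⟨ha.1, hab.trans_lt hb'⟩ ⟨hb.1, hb'⟩ hab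
  have hsum : ∀ ρ ∈ Ico 0 r, sphInt (gradDot h h) ρ = ∑ i : Fin (m + 2),
      sphPair (fun x => fderiv ℝ h x (EuclideanSpace.single i 1))
        (fun x => fderiv ℝ h x (EuclideanSpace.single i 1)) ρ ρ := fun ρ hρ => by
    simp only [sphInt, gradDot, sphPair]
    refine integral_finsetSum _ fun i _ => integrable_of_continuous_compactSpace ?_
    have : Continuous fun ω : sphere (0 : EuclideanSpace ℝ (Fin (m + 2))) 1 =>
        fderiv ℝ h (ρ • (ω : EuclideanSpace ℝ (Fin (m + 2)))) (EuclideanSpace.single i 1) :=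
      (hh.1.fderiv_single isOpen_ball _).continuousOn.comp_continuous (by fun_prop)
        (smul_sphere_mem_ball hρ.1 hρ.2)
    exact this.mul this
  rw [hsum a ha, hsum b hb]
  exact Finset.sum_le_sum fun i _ => hv _

lemma HarmonicBall.hasDerivAt_energy (hh : HarmonicBall h r) {ρ : ℝ} (hρ : ρ ∈ Ioo 0 r) :
    HasDerivAt (fun ρ => ρ ^ m * sphPair h (euler h) ρ ρ)
      (ρ ^ (m + 1) * sphInt (gradDot h h) ρ) ρ := by
  have hs : (norm ⁻¹' Ioo 0 r : Set (EuclideanSpace ℝ (Fin (m + 2)))) ⊆ ball 0 r := fun x hx => by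
    simpa using hx.2
  exact hasDerivAt_pow_mul_sphPair_euler le_rfl ((hh.1.of_le (by norm_num)).mono hs)
    (hh.1.mono hs) (fun x hx => hh.2 x (hs hx)) hρ

lemma HarmonicBall.continuousOn_sphPair_euler (hh : HarmonicBall h r) :
    ContinuousOn (fun ρ => sphPair h (euler h) ρ ρ) (Ico 0 r) := by
  have hm : ∀ ρ ∈ Ico 0 r, ∀ ω : sphere (0 : EuclideanSpace ℝ (Fin (m + 2))) 1,
    ρ • (ω : EuclideanSpace ℝ (Fin (m + 2))) ∈ ball 0 r := fun ρ hρ =>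
      smul_sphere_mem_ball hρ.1 hρ.2
  exact continuousOn_sphPair_comp hh.1.continuousOn (hh.1.euler isOpen_ball).continuousOn
    continuousOn_id continuousOn_id hm hm

/-- The average of `|∇h|²` over concentric balls is nondecreasing in the radius. -/
lemma HarmonicBall.monotoneOn_sphPair_euler_div (hh : HarmonicBall h r) :
    MonotoneOn (fun ρ => sphPair h (euler h) ρ ρ / ρ ^ 2) (Ioo 0 r) := by
  set K := sphInt (gradDot h h)
  set e : ℝ → ℝ := fun ρ => ρ ^ m * sphPair h (euler h) ρ ρ with he
  have hec : ContinuousOn e (Ico 0 r) :=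
    (by fun_prop : ContinuousOn (fun ρ : ℝ => ρ ^ m) _).fun_mul hh.continuousOn_sphPair_euler
  have hle : ∀ ρ ∈ Ioo 0 r, (m + 2) * e ρ ≤ ρ ^ (m + 2) * K ρ := by
    intro ρ hρ
    have hanti : AntitoneOn (fun x => (m + 2) * e x - x ^ (m + 2) * K ρ) (Icc 0 ρ) := by
      have hd : ∀ x ∈ Ioo 0 ρ, HasDerivAt (fun x => (m + 2) * e x - x ^ (m + 2) * K ρ)
          ((m + 2) * x ^ (m + 1) * (K x - K ρ)) x := fun x hx => by
        have h1 := ((hh.hasDerivAt_energy ⟨hx.1, hx.2.trans hρ.2⟩).const_mul ((m : ℝ) + 2)).sub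
          ((hasDerivAt_pow (m + 2) x).mul_const (K ρ))
        refine h1.congr_deriv ?_
        push_cast
        simp only [K]
        ring
      refine antitoneOn_of_deriv_nonpos (convex_Icc 0 ρ) ?_ ?_ ?_
      · have hsub : Icc 0 ρ ⊆ Ico 0 r := fun x hx => ⟨hx.1, hx.2.trans_lt hρ.2⟩
        exact (continuousOn_const.mul (hec.mono hsub)).sub (by fun_prop)
      · rw [interior_Icc]
        exact fun x hx => (hd x hx).differentiableAt.differentiableWithinAt
      · rw [interior_Icc]
        intro x hx
        rw [(hd x hx).deriv]
        have h1 := hh.monotoneOn_sphInt_gradDot ⟨hx.1.le, hx.2.trans hρ.2⟩ ⟨hρ.1.le, hρ.2⟩ hx.2.le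
        have h2 : 0 ≤ ((m : ℝ) + 2) * x ^ (m + 1) := by
          have := hx.1
          positivity
        exact mul_nonpos_of_nonneg_of_nonpos h2 (sub_nonpos.2 h1)
    have := hanti ⟨le_rfl, hρ.1.le⟩ ⟨hρ.1.le, le_rfl⟩ hρ.1.le
    simp only [he, sphPair_euler_zero] at this ⊢
    simp at this
    linarith
  have hd : ∀ ρ ∈ Ioo 0 r, HasDerivAt (fun ρ => e ρ / ρ ^ (m + 2))
      ((ρ ^ (m + 2) * K ρ - (m + 2) * e ρ) / ρ ^ (m + 3)) ρ := fun ρ hρ => by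
    have h0 := hρ.1.ne'
    refine ((hh.hasDerivAt_energy hρ).div (hasDerivAt_pow (m + 2) ρ) (pow_ne_zero _ h0)).congr_deriv
      ?_
    simp only [K, he]
    push_cast
    field_simp
    ring
  have hmono : MonotoneOn (fun ρ => e ρ / ρ ^ (m + 2)) (Ioo 0 r) := by
    refine monotoneOn_of_deriv_nonneg (convex_Ioo 0 r) ?_ ?_ ?_
    · exact fun ρ hρ => (hd ρ hρ).continuousAt.continuousWithinAt
    · rw [interior_Ioo]
      exact fun ρ hρ => (hd ρ hρ).differentiableAt.differentiableWithinAt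
    · rw [interior_Ioo]
      intro ρ hρ
      rw [(hd ρ hρ).deriv]
      have := hρ.1
      exact div_nonneg (sub_nonneg.2 (hle ρ hρ)) (by positivity)
  refine hmono.congr fun ρ hρ => ?_
  have := hρ.1.ne'
  simp only [he]
  field_simp
  ring

end HarmonicBall

section Comparison

/-- The one-dimensional comparison argument: an energy inequality from an Euler-type equation. -/
lemma comparison_of_euler_equation {m : ℕ} {κ s : ℝ} (hκ : 0 ≤ κ) (hs : s ∈ Ioo (0 : ℝ) 1)
    {G p p' J j : ℝ → ℝ}
    (hG : ∀ x ∈ Ioo (0 : ℝ) 1, HasDerivAt G (2 * p x / x) x)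
    (hp : ∀ x ∈ Ioo (0 : ℝ) 1, HasDerivAt p (p' x) x)
    (hJ : ∀ x ∈ Ioo (0 : ℝ) 1, HasDerivAt J (2 * j x / x) x)
    (hp'0 : ∀ x ∈ Ioo (0 : ℝ) 1, 0 ≤ p' x)
    (hp0 : ∀ x ∈ Ioo (0 : ℝ) 1, 0 ≤ p x)
    (hmono : MonotoneOn (fun x => p x / x ^ 2) (Ioo 0 1))
    (hpc : ContinuousOn p (Ico 0 1)) (hjc : ContinuousOn j (Ico 0 1))
    (hpz : p 0 = 0) (hjz : j 0 = 0)
    (hid : ∀ x ∈ Ioo (0 : ℝ) 1, 2 * j x + m * J x =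
      p x + (m - κ) * G x + s ^ m * (κ * G (s * x) + p (s * x)))
    {θ : ℝ} (hθ : θ ∈ Ioo (0 : ℝ) 1) : (1 - κ) * p θ ≤ 2 * j θ := by
  obtain ⟨hθ0, hθ1⟩ := hθ
  obtain ⟨hs0, hs1⟩ := hs
  set A : ℝ → ℝ := fun x => (m - κ) * G x + s ^ m * (κ * G (s * x) + p (s * x)) with hA
  set z : ℝ → ℝ := fun x => p x - 2 * j x - κ * p θ / θ ^ 2 * x ^ 2 with hz
  have hsx : ∀ x ∈ Ioo (0 : ℝ) 1, s * x ∈ Ioo (0 : ℝ) 1 := fun x hx =>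
    ⟨mul_pos hs0 hx.1, by nlinarith [hx.1, hx.2]⟩
  have hd : ∀ x ∈ Ioo (0 : ℝ) 1, HasDerivAt z
      (m * (2 * j x / x) - ((m - κ) * (2 * p x / x) + s ^ m * (κ * (2 * p (s * x) / x) +
        s * p' (s * x))) - κ * p θ / θ ^ 2 * (2 * x)) x := fun x hx => by
    have hx0 := hx.1.ne'
    have hlin : HasDerivAt (fun x => s * x) s x := by
      simpa using (hasDerivAt_id x).const_mul s
    have h1 := ((hG _ (hsx x hx)).comp x hlin).const_mul κ
    have h2 := (hp _ (hsx x hx)).comp x hlin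
    have hAd := ((hG x hx).const_mul ((m : ℝ) - κ)).add ((h1.add h2).const_mul (s ^ m))
    have hq := ((hJ x hx).const_mul (m : ℝ)).sub hAd
    have := hq.sub ((hasDerivAt_pow 2 x).const_mul (κ * p θ / θ ^ 2))
    refine (this.congr_of_eventuallyEq ?_).congr_deriv ?_
    · filter_upwards [isOpen_Ioo.mem_nhds hx] with y hy
      have := hid y hy
      simp [hz]
      linarith
    · field_simp
      simp
      ring
  have hanti : AntitoneOn (fun x => x ^ m * z x) (Icc 0 θ) := by
    have hd' : ∀ x ∈ Ioo (0 : ℝ) 1, HasDerivAt (fun x => x ^ m * z x) _ x := fun x hx =>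
      (hasDerivAt_pow m x).mul (hd x hx)
    refine antitoneOn_of_deriv_nonpos (convex_Icc 0 θ) ?_ ?_ ?_
    · have hsub : Icc 0 θ ⊆ Ico (0 : ℝ) 1 := fun x hx => ⟨hx.1, hx.2.trans_lt hθ1⟩
      exact (by fun_prop : ContinuousOn (fun x : ℝ => x ^ m) _).fun_mul
        (((hpc.mono hsub).sub (continuousOn_const.mul (hjc.mono hsub))).sub (by fun_prop))
    · rw [interior_Icc]
      exact fun x hx => (hd' x ⟨hx.1, hx.2.trans hθ1⟩).differentiableAt.differentiableWithinAt
    · rw [interior_Icc]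
      intro x hx
      have hx' : x ∈ Ioo (0 : ℝ) 1 := ⟨hx.1, hx.2.trans hθ1⟩
      have hx0 := hx.1
      rw [(hd' x hx').deriv]
      have key : m * z x + x * (m * (2 * j x / x) - ((m - κ) * (2 * p x / x) +
          s ^ m * (κ * (2 * p (s * x) / x) + s * p' (s * x))) - κ * p θ / θ ^ 2 * (2 * x)) ≤ 0 := by
        have h1 : p x ≤ p θ / θ ^ 2 * x ^ 2 := by
          have := hmono hx' ⟨hθ0, hθ1⟩ hx.2.le
          simp only at this
          rwa [div_le_iff₀ (by positivity)] at this
        have h2 := hp0 x hx'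
        have h3 := hp0 _ (hsx x hx')
        have h4 := hp'0 _ (hsx x hx')
        have h5 : 0 ≤ p θ / θ ^ 2 * x ^ 2 := h2.trans h1
        have h6 : 0 ≤ s ^ m * (κ * (2 * p (s * x)) + x * s * p' (s * x)) := by positivity
        have h7 : 0 ≤ κ * (p θ / θ ^ 2 * x ^ 2 - p x) := mul_nonneg hκ (sub_nonneg.2 h1)
        have h8 : 0 ≤ (m : ℝ) * κ * (p θ / θ ^ 2 * x ^ 2) := by positivity
        have h9 : 0 ≤ (m : ℝ) * p x := by positivity
        have e : m * z x + x * (m * (2 * j x / x) - ((m - κ) * (2 * p x / x) +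
            s ^ m * (κ * (2 * p (s * x) / x) + s * p' (s * x))) - κ * p θ / θ ^ 2 * (2 * x)) =
            - (m * p x) - m * κ * (p θ / θ ^ 2 * x ^ 2) - 2 * (κ * (p θ / θ ^ 2 * x ^ 2 - p x)) -
            s ^ m * (κ * (2 * p (s * x)) + x * s * p' (s * x)) := by
          simp only [hz]
          field_simp
          ring
        rw [e]
        linarith
      have hpow : (m : ℝ) * x ^ (m - 1) = m * x ^ m / x := by
        rcases m with _ | n
        · simp
        · field_simp
          simp
          ring
      rw [hpow]
      have h0 : 0 ≤ x ^ m / x := by positivity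
      have := mul_nonpos_of_nonneg_of_nonpos h0 key
      refine le_trans (le_of_eq ?_) this
      field_simp
  have := hanti ⟨le_rfl, hθ0.le⟩ ⟨hθ0.le, le_rfl⟩ hθ0.le
  have hz0 : z 0 = 0 := by simp [hz, hpz, hjz]
  simp only [hz0, mul_zero] at this
  have hzθ : z θ ≤ 0 := by
    by_contra h
    push Not at h
    have : 0 < θ ^ m * z θ := by positivity
    linarith
  simp only [hz] at hzθ
  have : κ * p θ / θ ^ 2 * θ ^ 2 = κ * p θ := by field_simp
  linarith

end Comparison

/-- `u` is `C²` near the closed shell `r ≤ |x| ≤ R`, harmonic inside it, and satisfies a Robin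
condition on the inner sphere. -/
structure RobinShell {d : ℕ} (u : EuclideanSpace ℝ (Fin d) → ℝ) (r R κ : ℝ)
    (V : Set (EuclideanSpace ℝ (Fin d))) : Prop where
  pos : 0 < r
  lt : r < R
  isOpen : IsOpen V
  subset : norm ⁻¹' Icc r R ⊆ V
  contDiffOn : ContDiffOn ℝ 2 u V
  lap_eq_zero : ∀ x ∈ norm ⁻¹' Ioo r R, lap u x = 0
  euler_eq : ∀ x, ‖x‖ = r → euler u x = -κ * u x

namespace RobinShell

variable {m : ℕ} {u h : EuclideanSpace ℝ (Fin (m + 2)) → ℝ} {r R κ : ℝ}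
  {V : Set (EuclideanSpace ℝ (Fin (m + 2)))}

lemma smul_mem (hu : RobinShell u r R κ V) {ρ : ℝ} (hρ : ρ ∈ Icc r R)
    (ω : sphere (0 : EuclideanSpace ℝ (Fin (m + 2))) 1) :
    ρ • (ω : EuclideanSpace ℝ (Fin (m + 2))) ∈ V := by
  refine hu.subset ?_
  rwa [mem_preimage, norm_smul_sphere (hu.pos.le.trans hρ.1)]

lemma sphPair_second_order (hu : RobinShell u r R κ V) (hh : HarmonicBall h r) {ρ b : ℝ}
    (hρ : ρ ∈ Ioo r R) (hb : b ∈ Ioo 0 r) :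
    m * sphPair u (euler h) ρ b + sphPair u (euler (euler h)) ρ b =
      m * sphPair (euler u) h ρ b + sphPair (euler (euler u)) h ρ b := by
  have hρ0 : 0 < ρ := hu.pos.trans hρ.1
  have hl : 0 < b / ρ := div_pos hb.1 hρ0
  have hlt : ρ < r / (b / ρ) := by
    rw [lt_div_iff₀ hl, mul_div_cancel₀ _ hρ0.ne']
    exact hb.2
  set g : EuclideanSpace ℝ (Fin (m + 2)) → ℝ := fun x => h ((b / ρ) • x) with hg
  have hgh : HarmonicBall g (r / (b / ρ)) := hh.comp_smul hl
  set c := min R (r / (b / ρ)) with hc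
  have hρc : ρ ∈ Ioo r c := ⟨hρ.1, lt_min hρ.2 hlt⟩
  have hsV : (norm ⁻¹' Ioo r c : Set (EuclideanSpace ℝ (Fin (m + 2)))) ⊆ norm ⁻¹' Ioo r R :=
    fun x hx => ⟨hx.1, hx.2.trans_le (min_le_left _ _)⟩
  have hsV' : (norm ⁻¹' Ioo r c : Set (EuclideanSpace ℝ (Fin (m + 2)))) ⊆ V :=
    (hsV.trans (preimage_mono Ioo_subset_Icc_self)).trans hu.subset
  have hsb : (norm ⁻¹' Ioo r c : Set (EuclideanSpace ℝ (Fin (m + 2)))) ⊆ ball 0 (r / (b / ρ)) :=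
    fun x hx => by
      rw [mem_ball_zero_iff]
      exact hx.2.trans_le (min_le_right _ _)
  have hu2 := hu.contDiffOn.mono hsV'
  have hg2 := hgh.1.mono hsb
  have hu1 := hu2.of_le (m := 1) (by norm_num)
  have hg1 := hg2.of_le (m := 1) (by norm_num)
  have h1 := (hasDerivAt_pow_mul_sphPair_euler hu.pos.le hu1 hg2
    (fun x hx => hgh.2 x (hsb hx)) hρc).unique
    (hasDerivAt_pow_mul_sphPair_euler_aux hu.pos.le hu1 hg2 hρc)
  have h2 := (hasDerivAt_pow_mul_sphPair_euler hu.pos.le hg1 hu2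
    (fun x hx => hu.lap_eq_zero x (hsV hx)) hρc).unique
    (hasDerivAt_pow_mul_sphPair_euler_aux hu.pos.le hg1 hu2 hρc)
  rw [gradDot_comm g u, h1, sphPair_comm g, sphPair_comm (euler g), sphPair_comm g] at h2
  simp only [hg, euler_comp_smul, sphPair_comp_smul_right, div_mul_cancel₀ _ hρ0.ne'] at h2
  have hpow : (m : ℝ) * ρ ^ (m - 1) = m * ρ ^ m / ρ := by
    rcases m with _ | n
    · simp
    · field_simp
      simp
      ring
  rw [hpow] at h2
  field_simp at h2
  linarith

lemma sphPair_euler_sum_eq (hu : RobinShell u r R κ V) (hh : HarmonicBall h r) {x : ℝ}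
    (hx : x ∈ Ioo (0 : ℝ) 1) :
    sphPair (euler u) h R (r / R * r * x ^ 2) + m * sphPair u h R (r / R * r * x ^ 2) +
        sphPair u (euler h) R (r / R * r * x ^ 2) =
      sphPair (euler u) h r (r * x ^ 2) + m * sphPair u h r (r * x ^ 2) +
        sphPair u (euler h) r (r * x ^ 2) := by
  obtain ⟨hx0, hx1⟩ := hx
  have hr := hu.pos
  have hR := hr.trans hu.lt
  set C := r ^ 2 * x ^ 2 with hC
  have hC0 : 0 < C := by positivity
  have hpos : ∀ a ∈ Icc r R, 0 < a := fun a ha => hr.trans_le ha.1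
  have hdiv : ∀ a ∈ Icc r R, C / a ∈ Ioo 0 r := fun a ha => by
    refine ⟨div_pos hC0 (hpos a ha), ?_⟩
    rw [div_lt_iff₀ (hpos a ha), hC]
    have : x ^ 2 < 1 := by nlinarith
    have h1 : r * r ≤ r * a := mul_le_mul_of_nonneg_left ha.1 hr.le
    nlinarith [mul_pos hr hr]
  have hu1 := hu.contDiffOn.of_le (m := 1) (by norm_num)
  have hh1 := hh.1.of_le (m := 1) (by norm_num)
  have hEu := hu.contDiffOn.euler hu.isOpen
  have hEh := hh.1.euler isOpen_ball
  have hm1 := fun a (ha : a ∈ Icc r R) => hu.smul_mem ha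
  have hm2 : ∀ a ∈ Icc r R, ∀ ω : sphere (0 : EuclideanSpace ℝ (Fin (m + 2))) 1,
      (C / a) • (ω : EuclideanSpace ℝ (Fin (m + 2))) ∈ ball 0 r := fun a ha =>
    smul_sphere_mem_ball (hdiv a ha).1.le (hdiv a ha).2
  set X : ℝ → ℝ := fun a => sphPair (euler u) h a (C / a) + m * sphPair u h a (C / a) +
    sphPair u (euler h) a (C / a) with hX
  have hder : ∀ a ∈ Icc r R, HasDerivAt X
      (1 / a * (sphPair (euler (euler u)) h a (C / a) + m * sphPair (euler u) h a (C / a) -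
        m * sphPair u (euler h) a (C / a) - sphPair u (euler (euler h)) a (C / a))) a := by
    intro a ha
    have ha0 := hpos a ha
    have hb0 := (hdiv a ha).1
    have hβ : HasDerivAt (fun a : ℝ => C / a) (-C / a ^ 2) a := by
      have := (hasDerivAt_inv ha0.ne').const_mul C
      refine this.congr_deriv ?_
      ring
    have d1 := hasDerivAt_sphPair hu.isOpen isOpen_ball hEu hh1 (hasDerivAt_id a) hβ ha0.ne' hb0.ne'
      (hm1 a ha) (hm2 a ha)
    have d2 := hasDerivAt_sphPair hu.isOpen isOpen_ball hu1 hh1 (hasDerivAt_id a) hβ ha0.ne' hb0.ne'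
      (hm1 a ha) (hm2 a ha)
    have d3 := hasDerivAt_sphPair hu.isOpen isOpen_ball hu1 hEh (hasDerivAt_id a) hβ ha0.ne' hb0.ne'
      (hm1 a ha) (hm2 a ha)
    refine ((d1.add (d2.const_mul (m : ℝ))).add d3).congr_deriv ?_
    simp only [id]
    field_simp
    ring
  obtain ⟨a, ha, hXa⟩ := exists_hasDerivAt_eq_slope X _ hu.lt
    (fun a ha => (hder a ha).continuousAt.continuousWithinAt)
    (fun a ha => hder a (Ioo_subset_Icc_self ha))
  have hW := hu.sphPair_second_order hh ha (hdiv a (Ioo_subset_Icc_self ha))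
  have hz : X R - X r = 0 := by
    have hne : R - r ≠ 0 := sub_ne_zero.2 hu.lt.ne'
    rw [eq_div_iff hne] at hXa
    rw [← hXa]
    have : sphPair (euler (euler u)) h a (C / a) + m * sphPair (euler u) h a (C / a) -
        m * sphPair u (euler h) a (C / a) - sphPair u (euler (euler h)) a (C / a) = 0 := by
      linarith
    rw [this]
    simp
  have e1 : C / R = r / R * r * x ^ 2 := by
    rw [hC]
    field_simp
  have e2 : C / r = r * x ^ 2 := by
    rw [hC]
    field_simp
  simp only [hX, e1, e2] at hz
  linarith

lemma sphPair_euler_inner (hu : RobinShell u r R κ V)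
    (g : EuclideanSpace ℝ (Fin (m + 2)) → ℝ) (b : ℝ) :
    sphPair (euler u) g r b = -κ * sphPair u g r b := by
  simp only [sphPair]
  rw [← integral_const_mul]
  refine integral_congr_ae (Eventually.of_forall fun ω => ?_)
  simp only
  rw [hu.euler_eq _ (norm_smul_sphere hu.pos.le ω)]
  ring

lemma integral_gradDot_comp_smul (hu : RobinShell u r R κ V) (hh : HarmonicBall h r) {c : ℝ}
    (hc : 0 < c) (hcR : c * R < r) :
    ∫ x in norm ⁻¹' Ioo r R, gradDot u (fun x => h (c • x)) x =
      R ^ m * sphPair u (euler h) R (c * R) - r ^ m * sphPair u (euler h) r (c * r) := by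
  have hg := hh.comp_smul hc
  have hlt : R < r / c := by
    rw [lt_div_iff₀ hc]
    linarith
  have hsub := preimage_norm_Icc_subset_ball (d := m + 2) (a := r) hlt
  have := (integral_gradDot_shell (hu.isOpen.inter isOpen_ball) hu.pos.le hu.lt.le
    (subset_inter hu.subset hsub)
    ((hu.contDiffOn.of_le (by norm_num)).mono inter_subset_left) (hg.1.mono inter_subset_right)
    (fun x hx => hg.2 x (hsub (Ioo_subset_Icc_self hx)))).2
  rwa [euler_comp_smul, sphPair_comp_smul_right, sphPair_comp_smul_right] at this

lemma integral_gradDot_comp_smul_swap (hu : RobinShell u r R κ V) (hh : HarmonicBall h r) {c : ℝ}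
    (hc : 0 < c) (hcR : c * R < r) :
    ∫ x in norm ⁻¹' Ioo r R, gradDot u (fun x => h (c • x)) x =
      R ^ m * sphPair (euler u) h R (c * R) - r ^ m * sphPair (euler u) h r (c * r) := by
  have hg := hh.comp_smul hc
  have hlt : R < r / c := by
    rw [lt_div_iff₀ hc]
    linarith
  have hsub := preimage_norm_Icc_subset_ball (d := m + 2) (a := r) hlt
  have := (integral_gradDot_shell (hu.isOpen.inter isOpen_ball) hu.pos.le hu.lt.le
    (subset_inter hu.subset hsub)
    ((hg.1.of_le (by norm_num)).mono inter_subset_right) (hu.contDiffOn.mono inter_subset_left)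
    hu.lap_eq_zero).2
  rwa [gradDot_comm, sphPair_comm _ (euler u), sphPair_comm _ (euler u), sphPair_comp_smul_right,
    sphPair_comp_smul_right] at this

/-- The inner boundary values of `u` and `h` agree in spherical pairings. -/
lemma sphPair_inner_eq (hu : RobinShell u r R κ V) (hhu : ∀ x, ‖x‖ = r → h x = u x)
    (g : EuclideanSpace ℝ (Fin (m + 2)) → ℝ) (b : ℝ) : sphPair u g r b = sphPair h g r b := by
  simp only [sphPair]
  refine integral_congr_ae (Eventually.of_forall fun ω => ?_)
  simp only
  rw [hhu _ (norm_smul_sphere hu.pos.le ω)]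

end RobinShell

section EnergyBound

variable {m : ℕ} {u h : EuclideanSpace ℝ (Fin (m + 2)) → ℝ} {r R κ : ℝ}
  {V : Set (EuclideanSpace ℝ (Fin (m + 2)))}

lemma HarmonicBall.hasDerivAt_sphPair_self (hh : HarmonicBall h r) (hr : 0 < r) {x : ℝ}
    (hx : x ∈ Ioo (0 : ℝ) 1) :
    HasDerivAt (fun x => sphPair h h (r * x) (r * x))
      (2 * sphPair h (euler h) (r * x) (r * x) / x) x := by
  have hh1 := hh.1.of_le (m := 1) (by norm_num)
  have hlin : HasDerivAt (fun x => r * x) r x := by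
    simpa using (hasDerivAt_id x).const_mul r
  have h0 : 0 < r * x := mul_pos hr hx.1
  have h1 : r * x < r := by nlinarith [hx.2]
  have hm := smul_sphere_mem_ball (d := m + 2) h0.le h1
  refine (hasDerivAt_sphPair isOpen_ball isOpen_ball hh1 hh1 hlin hlin h0.ne' h0.ne' hm
    hm).congr_deriv ?_
  rw [sphPair_comm (euler h)]
  field_simp
  ring

lemma HarmonicBall.differentiableAt_sphPair_euler (hh : HarmonicBall h r) (hr : 0 < r) {x : ℝ}
    (hx : x ∈ Ioo (0 : ℝ) 1) :
    DifferentiableAt ℝ (fun x => sphPair h (euler h) (r * x) (r * x)) x := by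
  have hlin : HasDerivAt (fun x => r * x) r x := by
    simpa using (hasDerivAt_id x).const_mul r
  have h0 : 0 < r * x := mul_pos hr hx.1
  have h1 : r * x < r := by nlinarith [hx.2]
  have hm := smul_sphere_mem_ball (d := m + 2) h0.le h1
  exact (hasDerivAt_sphPair isOpen_ball isOpen_ball (hh.1.of_le (by norm_num))
    (hh.1.euler isOpen_ball) hlin hlin h0.ne' h0.ne' hm hm).differentiableAt

lemma HarmonicBall.monotoneOn_sphPair_euler_mul_div (hh : HarmonicBall h r) (hr : 0 < r) :
    MonotoneOn (fun x => sphPair h (euler h) (r * x) (r * x) / x ^ 2) (Ioo 0 1) := by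
  intro x hx y hy hxy
  have hm : ∀ z ∈ Ioo (0 : ℝ) 1, r * z ∈ Ioo 0 r := fun z hz =>
    ⟨mul_pos hr hz.1, by nlinarith [hz.2]⟩
  have := hh.monotoneOn_sphPair_euler_div (hm x hx) (hm y hy) (by gcongr)
  simp only [mul_pow, ← div_div] at this ⊢
  rw [div_right_comm, div_right_comm _ (r ^ 2)] at this
  exact (div_le_div_iff_of_pos_right (by positivity)).1 this

namespace RobinShell

lemma sphPair_self_eq (hu : RobinShell u r R κ V) (hh : HarmonicBall h r)
    (hc : ContinuousOn h (closedBall 0 r)) (hhu : ∀ x, ‖x‖ = r → h x = u x) {x : ℝ}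
    (hx : x ∈ Ioo (0 : ℝ) 1) : sphPair u h r (r * x ^ 2) = sphPair h h (r * x) (r * x) := by
  rw [hu.sphPair_inner_eq hhu, hh.sphPair_self_eq hc hu.pos hx]

lemma hasDerivAt_sphPair_sq (hu : RobinShell u r R κ V) (hh : HarmonicBall h r) {ρ b x : ℝ}
    (hρ : ρ ∈ Icc r R) (hb : 0 < b) (hbr : b ≤ r) (hx : x ∈ Ioo (0 : ℝ) 1) :
    HasDerivAt (fun x => sphPair u h ρ (b * x ^ 2))
      (2 * sphPair u (euler h) ρ (b * x ^ 2) / x) x := by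
  have hx0 := hx.1
  have hβ : HasDerivAt (fun x => b * x ^ 2) (b * (2 * x)) x := by
    simpa using (hasDerivAt_pow 2 x).const_mul b
  have h0 : 0 < b * x ^ 2 := by positivity
  have h1 : b * x ^ 2 < r := by
    have : x ^ 2 < 1 := by nlinarith [hx.1, hx.2]
    nlinarith
  refine (hasDerivAt_sphPair hu.isOpen isOpen_ball (hu.contDiffOn.of_le (by norm_num))
    (hh.1.of_le (by norm_num)) (hasDerivAt_const x ρ) hβ (hu.pos.trans_le hρ.1).ne' h0.ne'
    (hu.smul_mem hρ) (smul_sphere_mem_ball h0.le h1)).congr_deriv ?_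
  field_simp
  ring

lemma sphPair_euler_eq (hu : RobinShell u r R κ V) (hh : HarmonicBall h r)
    (hc : ContinuousOn h (closedBall 0 r)) (hhu : ∀ x, ‖x‖ = r → h x = u x) {x : ℝ}
    (hx : x ∈ Ioo (0 : ℝ) 1) :
    sphPair u (euler h) r (r * x ^ 2) = sphPair h (euler h) (r * x) (r * x) := by
  have h1 := hu.hasDerivAt_sphPair_sq hh ⟨le_rfl, hu.lt.le⟩ hu.pos le_rfl hx
  have h2 := (hh.hasDerivAt_sphPair_self hu.pos hx).congr_of_eventuallyEq (by
    filter_upwards [isOpen_Ioo.mem_nhds hx] with y hy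
    exact hu.sphPair_self_eq hh hc hhu hy)
  have := h1.unique h2
  have hx0 := hx.1.ne'
  field_simp at this
  exact this

/-- The outer flux pairing controls the inner energy. -/
lemma sphPair_euler_le (hu : RobinShell u r R κ V) (hκ : 0 ≤ κ) (hh : HarmonicBall h r)
    (hc : ContinuousOn h (closedBall 0 r)) (hhu : ∀ x, ‖x‖ = r → h x = u x) {θ : ℝ}
    (hθ : θ ∈ Ioo (0 : ℝ) 1) :
    (1 - κ) * sphPair h (euler h) (r * θ) (r * θ) ≤
      2 * sphPair u (euler h) R (r / R * r * θ ^ 2) := by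
  have hr := hu.pos
  have hR := hr.trans hu.lt
  have hs : r / R ∈ Ioo (0 : ℝ) 1 := ⟨by positivity, (div_lt_one hR).2 hu.lt⟩
  have hb : 0 < r / R * r := by positivity
  have hbr : r / R * r ≤ r := by nlinarith [hs.2]
  have hRm : R ∈ Icc r R := ⟨hu.lt.le, le_rfl⟩
  have hp0 : ∀ x ∈ Ioo (0 : ℝ) 1, 0 ≤ sphPair h (euler h) (r * x) (r * x) := fun x hx =>
    hh.sphPair_euler_nonneg (by have := hx.1; positivity) (by nlinarith [hx.2])
  have hmono := hh.monotoneOn_sphPair_euler_mul_div hr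
  refine comparison_of_euler_equation (m := m) (s := r / R)
    (G := fun x => sphPair h h (r * x) (r * x))
    (p := fun x => sphPair h (euler h) (r * x) (r * x))
    (p' := deriv fun x => sphPair h (euler h) (r * x) (r * x))
    (J := fun x => sphPair u h R (r / R * r * x ^ 2))
    (j := fun x => sphPair u (euler h) R (r / R * r * x ^ 2)) hκ hs
    (fun x hx => hh.hasDerivAt_sphPair_self hr hx)
    (fun x hx => (hh.differentiableAt_sphPair_euler hr hx).hasDerivAt)
    (fun x hx => hu.hasDerivAt_sphPair_sq hh hRm hb hbr hx) ?_ hp0 hmono ?_ ?_ ?_ ?_ ?_ hθ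
  · intro x hx
    have hmono' : MonotoneOn (fun x => sphPair h (euler h) (r * x) (r * x)) (Ioo 0 1) := by
      intro y hy z hz hyz
      have h1 := hmono hy hz hyz
      have hy0 := hy.1
      have hz0 := hz.1
      simp only at h1 ⊢
      rw [div_le_div_iff₀ (by positivity) (by positivity)] at h1
      have h2 : y ^ 2 ≤ z ^ 2 := by gcongr
      have h3 := mul_le_mul_of_nonneg_left h2 (hp0 z hz)
      exact le_of_mul_le_mul_right (h1.trans h3) (by positivity)
    rw [← derivWithin_of_isOpen isOpen_Ioo hx]
    exact hmono'.derivWithin_nonneg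
  · exact hh.continuousOn_sphPair_euler.comp (f := fun x => r * x) (by fun_prop) fun x hx =>
      ⟨mul_nonneg hr.le hx.1, by nlinarith [hx.2]⟩
  · refine continuousOn_sphPair_comp (hu.contDiffOn.continuousOn)
      (hh.1.euler isOpen_ball).continuousOn continuousOn_const (by fun_prop)
      (fun x _ => hu.smul_mem hRm) fun x hx => ?_
    have h0 := hx.1
    refine smul_sphere_mem_ball (by positivity) ?_
    have : x ^ 2 < 1 := by nlinarith [hx.1, hx.2]
    nlinarith
  · simp [sphPair_euler_zero]
  · simp [sphPair_euler_zero]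
  · intro x hx
    have hx0 := hx.1
    have hsx : r / R * x ∈ Ioo (0 : ℝ) 1 :=
      ⟨mul_pos hs.1 hx.1, by nlinarith [hx.1, hx.2, hs.1, hs.2]⟩
    have e1 := hu.sphPair_euler_sum_eq hh hx
    rw [hu.sphPair_euler_inner, hu.sphPair_self_eq hh hc hhu hx,
      hu.sphPair_euler_eq hh hc hhu hx] at e1
    have hc0 : 0 < (r / R) ^ 2 * x ^ 2 := by
      have := hs.1
      positivity
    have hcR : (r / R) ^ 2 * x ^ 2 * R = r / R * r * x ^ 2 := by field_simp
    have hcr : (r / R) ^ 2 * x ^ 2 * r = r * (r / R * x) ^ 2 := by ring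
    have hlt : (r / R) ^ 2 * x ^ 2 * R < r := by
      rw [hcR]
      have : x ^ 2 < 1 := by nlinarith [hx.1, hx.2]
      nlinarith
    have e2 := (hu.integral_gradDot_comp_smul hh hc0 hlt).symm.trans
      (hu.integral_gradDot_comp_smul_swap hh hc0 hlt)
    rw [hcR, hcr, hu.sphPair_euler_inner, hu.sphPair_self_eq hh hc hhu hsx,
      hu.sphPair_euler_eq hh hc hhu hsx] at e2
    have hpow : r ^ m = (r / R) ^ m * R ^ m := by
      rw [← mul_pow, div_mul_cancel₀ _ hR.ne']
    rw [hpow] at e2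
    have hRm' : R ^ m ≠ 0 := by positivity
    have e3 : sphPair u (euler h) R (r / R * r * x ^ 2) -
        (r / R) ^ m * sphPair h (euler h) (r * (r / R * x)) (r * (r / R * x)) =
        sphPair (euler u) h R (r / R * r * x ^ 2) -
        (r / R) ^ m * (-κ * sphPair h h (r * (r / R * x)) (r * (r / R * x))) := by
      apply mul_left_cancel₀ hRm'
      linarith
    linarith

lemma energy_le_of_lt_one (hu : RobinShell u r R κ V) (hκ : 0 ≤ κ) (hh : HarmonicBall h r)
    (hc : ContinuousOn h (closedBall 0 r)) (hhu : ∀ x, ‖x‖ = r → h x = u x) {θ k : ℝ}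
    (hθ : θ ∈ Ioo (0 : ℝ) 1) (hk0 : 0 ≤ k) (hk : k ≤ (1 - κ) / 2 - (r / R) ^ (m + 2)) :
    k ^ 2 * ∫ x in norm ⁻¹' Ioo 0 (r * θ), gradDot h h x ≤
      (r / R) ^ (m + 2) * ∫ x in norm ⁻¹' Ioo r R, gradDot u u x := by
  have hr := hu.pos
  have hR := hr.trans hu.lt
  obtain ⟨hθ0, hθ1⟩ := hθ
  have hs : r / R ∈ Ioo (0 : ℝ) 1 := ⟨by positivity, (div_lt_one hR).2 hu.lt⟩
  set s := r / R with hsdef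
  have hs0 := hs.1
  have hrs : r = s * R := by rw [hsdef, div_mul_cancel₀ _ hR.ne']
  set p : ℝ → ℝ := fun x => sphPair h (euler h) (r * x) (r * x) with hp
  have hp0 : ∀ x ∈ Ioo (0 : ℝ) 1, 0 ≤ p x := fun x hx =>
    hh.sphPair_euler_nonneg (by have := hx.1; positivity) (by nlinarith [hx.2])
  have hpθ := hp0 θ ⟨hθ0, hθ1⟩
  have hpm : ∀ x ∈ Ioo (0 : ℝ) 1, x ≤ s * θ → p x ≤ s ^ 2 * p θ := fun x hx hxs => by
    have hx0 := hx.1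
    have h1 := hh.monotoneOn_sphPair_euler_mul_div hr hx ⟨hθ0, hθ1⟩
      (hxs.trans (mul_le_of_le_one_left hθ0.le hs.2.le))
    simp only at h1
    change p x / x ^ 2 ≤ p θ / θ ^ 2 at h1
    rw [div_le_div_iff₀ (by positivity) (by positivity)] at h1
    have h2 : x ^ 2 ≤ (s * θ) ^ 2 := by gcongr
    have h3 := mul_le_mul_of_nonneg_left h2 hpθ
    refine le_of_mul_le_mul_right (h1.trans (h3.trans (le_of_eq ?_))) (by positivity : 0 < θ ^ 2)
    ring
  set c := s ^ 2 * θ ^ 2 with hcdef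
  have hc0 : 0 < c := by positivity
  have hcR : c * R = s * r * θ ^ 2 := by
    rw [hcdef, hrs]
    ring
  have hsθ : s * θ ∈ Ioo (0 : ℝ) 1 := ⟨by positivity, by nlinarith [hs.2]⟩
  have hsθ2 : s * θ ^ 2 ∈ Ioo (0 : ℝ) 1 := ⟨by positivity, by nlinarith [hsθ.2]⟩
  have hcr : c * r = r * (s * θ) ^ 2 := by
    rw [hcdef]
    ring
  have hcR' : c * R = r * (s * θ ^ 2) := by
    rw [hcR]
    ring
  have hlt : c * R < r := by
    rw [hcR']
    nlinarith [hsθ2.2]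
  set φ : EuclideanSpace ℝ (Fin (m + 2)) → ℝ := fun x => h (c • x) with hφ
  have hφh : HarmonicBall φ (r / c) := hh.comp_smul hc0
  have hRlt : R < r / c := by
    rw [lt_div_iff₀ hc0]
    linarith
  have hsub := preimage_norm_Icc_subset_ball (d := m + 2) (a := r) hRlt
  have hu1 := hu.contDiffOn.of_le (m := 1) (by norm_num)
  have hφ1 := hφh.1.of_le (m := 1) (by norm_num)
  have hP := hu.integral_gradDot_comp_smul hh hc0 hlt
  have hPi : IntegrableOn (gradDot u φ) (norm ⁻¹' Ioo r R) :=
    (integral_gradDot_shell (hu.isOpen.inter isOpen_ball) hr.le hu.lt.le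
      (subset_inter hu.subset hsub) (hu1.mono inter_subset_left) (hφh.1.mono inter_subset_right)
      (fun x hx => hφh.2 x (hsub (Ioo_subset_Icc_self hx)))).1
  obtain ⟨hQi, hQ⟩ := integral_gradDot_shell isOpen_ball hr.le hu.lt.le hsub hφ1 hφh.1
    (fun x hx => hφh.2 x (hsub (Ioo_subset_Icc_self hx)))
  have hEi : IntegrableOn (gradDot u u) (norm ⁻¹' Ioo r R) :=
    (integral_gradDot_shell hu.isOpen hr.le hu.lt.le hu.subset hu1 hu.contDiffOn
      hu.lap_eq_zero).1
  set EA := ∫ x in norm ⁻¹' Ioo r R, gradDot u u x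
  set P := ∫ x in norm ⁻¹' Ioo r R, gradDot u φ x
  set Q := ∫ x in norm ⁻¹' Ioo r R, gradDot φ φ x
  have hCS : ∀ l : ℝ, 0 ≤ EA - 2 * l * P + l ^ 2 * Q := fun l => by
    have hi : IntegrableOn (fun x => gradDot u u x - 2 * l * gradDot u φ x)
        (norm ⁻¹' Ioo r R) := hEi.sub (hPi.const_mul _)
    rw [← integral_const_mul, ← integral_const_mul, ← integral_sub hEi (hPi.const_mul _),
      ← integral_add hi (hQi.const_mul _)]
    refine integral_nonneg fun x => ?_
    simp only [gradDot, Finset.mul_sum, ← Finset.sum_sub_distrib, ← Finset.sum_add_distrib]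
    refine Finset.sum_nonneg fun i _ => le_of_le_of_eq (sq_nonneg
      (fderiv ℝ u x (EuclideanSpace.single i 1) - l * fderiv ℝ φ x (EuclideanSpace.single i 1))) ?_
    ring
  have hRm : 0 < R ^ m := by positivity
  have hrm : r ^ m = s ^ m * R ^ m := by rw [hrs, mul_pow]
  have hQle : Q ≤ R ^ m * (s ^ 2 * p θ) := by
    have h1 : 0 ≤ r ^ m * sphPair φ (euler φ) r r :=
      mul_nonneg (by positivity) (hφh.sphPair_euler_nonneg hr.le (hu.lt.trans hRlt))
    have h2 : sphPair φ (euler φ) R R = p (s * θ ^ 2) := by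
      rw [hφ, euler_comp_smul, sphPair_comp_smul_right, sphPair_comm, sphPair_comp_smul_right,
        sphPair_comm, hcR']
    have h3 := hpm _ hsθ2
      (mul_le_mul_of_nonneg_left (by nlinarith : θ ^ 2 ≤ θ) hs0.le)
    rw [hQ, h2]
    nlinarith
  have hPle : R ^ m * p θ * k ≤ P := by
    have h1 := hu.sphPair_euler_le hκ hh hc hhu ⟨hθ0, hθ1⟩
    rw [← hsdef] at h1
    change (1 - κ) * p θ ≤ _ at h1
    rw [hcR, hcr, hu.sphPair_euler_eq hh hc hhu hsθ] at hP
    change P = R ^ m * _ - r ^ m * p (s * θ) at hP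
    have h2 := hpm _ hsθ le_rfl
    rw [hP, hrm]
    have h3 : s ^ m * p (s * θ) ≤ s ^ (m + 2) * p θ :=
      (mul_le_mul_of_nonneg_left h2 (by positivity)).trans (le_of_eq (by ring))
    have h4 := mul_le_mul_of_nonneg_right hk hpθ
    have h5 : p θ * k ≤ sphPair u (euler h) R (s * r * θ ^ 2) - s ^ m * p (s * θ) := by
      linarith
    have h6 := mul_le_mul_of_nonneg_left h5 hRm.le
    linarith
  have hmain : k ^ 2 * (R ^ m * p θ) ≤ s ^ 2 * EA := by
    have h1 := hCS (k / s ^ 2)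
    have h2 : 2 * (k / s ^ 2) * (R ^ m * p θ * k) ≤ 2 * (k / s ^ 2) * P :=
      mul_le_mul_of_nonneg_left hPle (by positivity)
    have h3 : (k / s ^ 2) ^ 2 * Q ≤ (k / s ^ 2) ^ 2 * (R ^ m * (s ^ 2 * p θ)) :=
      mul_le_mul_of_nonneg_left hQle (by positivity)
    have h4 : 2 * (k / s ^ 2) * (R ^ m * p θ * k) - (k / s ^ 2) ^ 2 * (R ^ m * (s ^ 2 * p θ)) =
        k ^ 2 * (R ^ m * p θ) / s ^ 2 := by
      field_simp
      ring
    have h5 : k ^ 2 * (R ^ m * p θ) / s ^ 2 ≤ EA := by linarith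
    rw [div_le_iff₀ (by positivity)] at h5
    linarith
  have henergy : ∫ x in norm ⁻¹' Ioo 0 (r * θ), gradDot h h x ≤ r ^ m * p θ := by
    rw [hh.integral_gradDot (hh.1.of_le (by norm_num)) (by positivity)
      (by nlinarith : r * θ < r)]
    refine mul_le_mul_of_nonneg_right ?_ hpθ
    exact pow_le_pow_left₀ (by positivity) (by nlinarith) m
  calc k ^ 2 * ∫ x in norm ⁻¹' Ioo 0 (r * θ), gradDot h h x
      ≤ k ^ 2 * (r ^ m * p θ) := mul_le_mul_of_nonneg_left henergy (by positivity)
    _ = s ^ m * (k ^ 2 * (R ^ m * p θ)) := by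
        rw [hrm]
        ring
    _ ≤ s ^ m * (s ^ 2 * EA) := mul_le_mul_of_nonneg_left hmain (by positivity)
    _ = s ^ (m + 2) * EA := by ring

lemma energy_le (hu : RobinShell u r R κ V) (hκ : 0 ≤ κ) (hh : HarmonicBall h r)
    (hc : ContinuousOn h (closedBall 0 r)) (hhu : ∀ x, ‖x‖ = r → h x = u x) {k : ℝ}
    (hk0 : 0 ≤ k) (hk : k ≤ (1 - κ) / 2 - (r / R) ^ (m + 2)) :
    k ^ 2 * ∫ x in norm ⁻¹' Ioo 0 r, gradDot h h x ≤
      (r / R) ^ (m + 2) * ∫ x in norm ⁻¹' Ioo r R, gradDot u u x := by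
  have hr := hu.pos
  have hR := hr.trans hu.lt
  by_cases hi : IntegrableOn (gradDot h h) (norm ⁻¹' Ioo 0 r)
  · set θ : ℕ → ℝ := fun n => 1 - 1 / ((n : ℝ) + 2) with hθ
    have hθm : ∀ n, θ n ∈ Ioo (0 : ℝ) 1 := fun n => by
      have h2 : (0 : ℝ) < (n : ℝ) + 2 := by positivity
      refine ⟨sub_pos.2 ((div_lt_one h2).2 (by linarith [(Nat.cast_nonneg n : (0 : ℝ) ≤ n)])), ?_⟩
      have : 0 < 1 / ((n : ℝ) + 2) := by positivity
      simp only [hθ]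
      linarith
    have hmono : Monotone θ := fun a b hab => by
      simp only [hθ]
      gcongr
    have hlim : Tendsto θ atTop (𝓝 1) := by
      have h1 : Tendsto (fun n : ℕ => 1 / ((n : ℝ) + 2)) atTop (𝓝 0) :=
        tendsto_const_nhds.div_atTop
          (tendsto_atTop_add_const_right _ _ tendsto_natCast_atTop_atTop)
      have h2 := (tendsto_const_nhds (x := (1 : ℝ))).sub h1
      rw [sub_zero] at h2
      exact h2
    have hU : (⋃ n, norm ⁻¹' Ioo 0 (r * θ n) : Set (EuclideanSpace ℝ (Fin (m + 2)))) =
        norm ⁻¹' Ioo 0 r := by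
      refine subset_antisymm (iUnion_subset fun n => preimage_mono
        (Ioo_subset_Ioo_right (by nlinarith [(hθm n).2]))) fun x hx => ?_
      have h1 : ‖x‖ / r < 1 := (div_lt_one hr).2 hx.2
      obtain ⟨n, hn⟩ := (hlim.eventually_const_lt h1).exists
      refine mem_iUnion.2 ⟨n, hx.1, ?_⟩
      rw [div_lt_iff₀ hr] at hn
      linarith
    have := tendsto_setIntegral_of_monotone (f := gradDot h h) (μ := volume)
      (s := fun n => (norm ⁻¹' Ioo 0 (r * θ n) : Set (EuclideanSpace ℝ (Fin (m + 2)))))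
      (fun n => measurable_norm measurableSet_Ioo)
      (fun a b hab => preimage_mono (Ioo_subset_Ioo_right (by
        have := hmono hab
        gcongr))) (by rwa [hU])
    rw [hU] at this
    exact le_of_tendsto (this.const_mul (k ^ 2)) (Eventually.of_forall fun n =>
      hu.energy_le_of_lt_one hκ hh hc hhu (hθm n) hk0 hk)
  · rw [integral_undef hi, mul_zero]
    exact mul_nonneg (by positivity) (integral_nonneg fun x => gradDot_self_nonneg u x)

end RobinShell

lemma norm_gradient_sq {d : ℕ} (f : EuclideanSpace ℝ (Fin d) → ℝ) (x : EuclideanSpace ℝ (Fin d)) :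
    ‖gradient f x‖ ^ 2 = gradDot f f x := by
  rw [EuclideanSpace.norm_sq_eq, gradDot]
  refine Finset.sum_congr rfl fun i _ => ?_
  rw [← inner_gradient_left, EuclideanSpace.inner_single_right]
  simp
  ring

lemma ann_eq_preimage_norm {d : ℕ} {r R : ℝ} : ann d r R = norm ⁻¹' Ioo r R := by
  ext x
  simp [ann, and_comm]

lemma preimage_norm_Icc_subset_closure {d : ℕ} {r R : ℝ} (hr : 0 < r) (hrR : r < R) :
    norm ⁻¹' Icc r R ⊆ closure (norm ⁻¹' Ioo r R : Set (EuclideanSpace ℝ (Fin d))) := by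
  intro x hx
  have hx0 : 0 < ‖x‖ := hr.trans_le hx.1
  have hcl : ‖x‖ ∈ closure (Ioo r R) := by rwa [closure_Ioo hrR.ne]
  have := map_mem_closure (f := fun t : ℝ => (t / ‖x‖) • x) (t := norm ⁻¹' Ioo r R)
    (by fun_prop) hcl fun t ht => by
      have ht0 : 0 < t := hr.trans ht.1
      rw [mem_preimage, norm_smul, Real.norm_eq_abs, abs_of_pos (by positivity),
        div_mul_cancel₀ _ hx0.ne']
      exact ht
  simpa [div_self hx0.ne'] using this

lemma setIntegral_ball_eq {m : ℕ} (k : EuclideanSpace ℝ (Fin (m + 2)) → ℝ) (r : ℝ) :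
    ∫ x in ball 0 r, k x = ∫ x in norm ⁻¹' Ioo 0 r, k x := by
  refine setIntegral_congr_set ?_
  have : (norm ⁻¹' Ioo 0 r : Set (EuclideanSpace ℝ (Fin (m + 2)))) = ball 0 r \ {0} := by
    ext x
    simp [and_comm]
  rw [this]
  exact (sdiff_null_ae_eq_self (measure_singleton _)).symm

end EnergyBound

theorem stmt0 (d : ℕ) (hd : 2 ≤ d) (σ : ℝ) (hσ : 0 < σ) :
    ∃ δ C : ℝ, δ ∈ Set.Ioo (0:ℝ) 1 ∧ 0 < C ∧
      ∀ r R : ℝ, 0 < r → r < R → R ≤ 1 → r / R ≤ δ →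
      ∀ u h : EuclideanSpace ℝ (Fin d) → ℝ,
      -- u is C² on a neighbourhood of the closed annulus
      (∃ V : Set (EuclideanSpace ℝ (Fin d)),
        IsOpen V ∧ closure (ann d r R) ⊆ V ∧ ContDiffOn ℝ 2 u V) →
      -- u is harmonic in the annulus
      (∀ x ∈ ann d r R, lap u x = 0) →
      -- Steklov condition on the inner sphere
      (∀ x : EuclideanSpace ℝ (Fin d), ‖x‖ = r →
        -⟪gradient u x, r⁻¹ • x⟫ = σ * u x) →
      -- h continuous on the closed ball, harmonic in the open ball
      ContinuousOn h (Metric.closedBall (0:EuclideanSpace ℝ (Fin d)) r) →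
      ContDiffOn ℝ 2 h (Metric.ball (0:EuclideanSpace ℝ (Fin d)) r) →
      (∀ x ∈ Metric.ball (0:EuclideanSpace ℝ (Fin d)) r, lap h x = 0) →
      -- h = u on the inner sphere
      (∀ x : EuclideanSpace ℝ (Fin d), ‖x‖ = r → h x = u x) →
      (∫ x in Metric.ball (0:EuclideanSpace ℝ (Fin d)) r, ‖gradient h x‖^2) ≤
        5 * (r/R)^d * (1 + C * (r/R)^d) * ∫ x in ann d r R, ‖gradient u x‖^2 := by
  obtain ⟨m, rfl⟩ : ∃ m, d = m + 2 := ⟨d - 2, by omega⟩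
  have hσ1 : 0 < 40 * (1 + σ) := by positivity
  refine ⟨1 / (40 * (1 + σ)), 1, ⟨by positivity, ?_⟩, one_pos, ?_⟩
  · rw [div_lt_one hσ1]
    linarith
  intro r R hr hrR hR1 hδ u h ⟨V, hV, hVs, huV⟩ hlu hst hhc hh2 hlh hhu
  have hR : 0 < R := hr.trans hrR
  have hs0 : 0 < r / R := by positivity
  have hu : RobinShell u r R (σ * r) V := by
    refine ⟨hr, hrR, hV, (preimage_norm_Icc_subset_closure hr hrR).trans ?_, huV, ?_, ?_⟩
    · rwa [← ann_eq_preimage_norm]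
    · rwa [← ann_eq_preimage_norm]
    · intro x hx
      have h1 := hst x hx
      rw [inner_gradient_left, map_smul, smul_eq_mul] at h1
      change -(r⁻¹ * euler u x) = _ at h1
      field_simp at h1
      linarith
  rw [le_div_iff₀ hσ1] at hδ
  have hrs : r ≤ r / R := by
    rw [le_div_iff₀ hR]
    nlinarith
  have hs1 : r / R ≤ 1 := ((div_lt_one hR).2 hrR).le
  have hpow : (r / R) ^ (m + 2) ≤ r / R :=
    pow_le_of_le_one hs0.le hs1 (by omega)
  have hk : (9 / 20 : ℝ) ≤ (1 - σ * r) / 2 - (r / R) ^ (m + 2) := by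
    have : σ * r ≤ σ * (r / R) := mul_le_mul_of_nonneg_left hrs hσ.le
    nlinarith [mul_pos hσ hs0]
  have key := hu.energy_le (by positivity) ⟨hh2, hlh⟩ hhc hhu (by norm_num) hk
  simp only [norm_gradient_sq]
  rw [setIntegral_ball_eq, ann_eq_preimage_norm]
  have h0 : 0 ≤ ∫ x in norm ⁻¹' Ioo r R, gradDot u u x :=
    integral_nonneg fun x => gradDot_self_nonneg u x
  have h1 : 0 ≤ ∫ x in norm ⁻¹' Ioo 0 r, gradDot h h x :=
    integral_nonneg fun x => gradDot_self_nonneg h x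
  have h2 : 0 ≤ (r / R) ^ (m + 2) * ∫ x in norm ⁻¹' Ioo r R, gradDot u u x := by positivity
  have h3 : 0 ≤ (r / R) ^ (m + 2) * ((r / R) ^ (m + 2) * ∫ x in norm ⁻¹' Ioo r R, gradDot u u x) :=
    mul_nonneg (by positivity) h2
  nlinarith
end

section
/- Fix an integer d ≥ 2 and a real number c > 0. There exists C > 0, depending only on d and c, such that for all 0 < r < R < 1 satisfying R ≥ c·r^{(d−1)/d} and R ≥ 2r, and every function u that is C¹ on a neighbourhood of the closed annulus closure(A_{r,R}), one has ∫_{A_{r,R}} (|∇u|² + u²) dx ≥ C · min{R^d·r^{1−d}, r^{1/d − 1}} · ∫_{{x : |x| = r}} u² dH^{d−1}. -/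
open MeasureTheory

open Set Metric Filter
open scoped ENNReal NNReal Topology Pointwise

theorem hausdorffMeasure_le_smul_of_le_measure_closedBall {X : Type*} [MetricSpace X]
    [TopologicalSpace.SeparableSpace X]
    [MeasurableSpace X] [BorelSpace X] (ν : Measure X) [ν.OuterRegular] {s : ℝ} (hs : 0 ≤ s)
    {a : ℝ≥0∞} (ha₀ : a ≠ 0) (ha : a ≠ ∞)
    (h : ∀ x : X, ∀ ε : ℝ, 0 < ε → ε ≤ 1 → a * ENNReal.ofReal ε ^ s ≤ ν (closedBall x ε)) :
    (μH[s] : Measure X) ≤ ((10 : ℝ≥0∞) ^ s * a⁻¹) • ν := by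
  have key : ∀ U : Set X, IsOpen U → μH[s] U ≤ ((10 : ℝ≥0∞) ^ s * a⁻¹) * ν U := by
    intro U hU
    let t : ℕ → Set (X × ℝ) := fun n =>
      {p | 0 < p.2 ∧ p.2 ≤ 1 / ((n : ℝ) + 1) ∧ closedBall p.1 p.2 ⊆ U}
    have hle1 : ∀ n : ℕ, 1 / ((n : ℝ) + 1) ≤ 1 := fun n => by
      rw [div_le_one (by positivity)]; linarith [n.cast_nonneg (α := ℝ)]
    choose u hut hdisj hcov using fun n =>
      Vitali.exists_disjoint_subfamily_covering_enlargement_closedBall (t n) Prod.fst Prod.snd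
        (1 / ((n : ℝ) + 1)) (fun p hp => hp.2.1) 5 (by norm_num)
    have hcount : ∀ n, (u n).Countable := fun n =>
      (hdisj n).countable_of_nonempty_interior fun p hp =>
        ⟨p.1, ball_subset_interior_closedBall (mem_ball_self (hut n hp).1)⟩
    have : ∀ n, Countable (u n) := fun n => (hcount n).to_subtype
    have hdiam : ∀ n (p : u n),
        ediam (closedBall p.1.1 (5 * p.1.2)) ≤ 10 * ENNReal.ofReal p.1.2 := by
      intro n p
      have hp := (hut n p.2).1
      rw [← Metric.closedEBall_ofReal (by linarith)]
      refine Metric.ediam_closedEBall_le.trans_eq ?_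
      rw [ENNReal.ofReal_mul (by norm_num), ← mul_assoc]
      norm_num
    have hlim : Tendsto (fun n : ℕ => 10 * ENNReal.ofReal (1 / ((n : ℝ) + 1))) atTop (𝓝 0) := by
      have h1 := (ENNReal.continuous_ofReal.tendsto _).comp
        (tendsto_one_div_add_atTop_nhds_zero_nat (𝕜 := ℝ))
      have := ENNReal.Tendsto.const_mul (a := 10) h1 (Or.inr (by norm_num))
      simpa using this
    refine (Measure.hausdorffMeasure_le_liminf_tsum s U _ hlim
      (fun n (p : u n) => closedBall p.1.1 (5 * p.1.2)) ?_ ?_).trans ?_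
    · filter_upwards with n p
      refine (hdiam n p).trans ?_
      gcongr
      exact (hut n p.2).2.1
    · filter_upwards with n x hx
      obtain ⟨ε, hε, hεU⟩ := nhds_basis_closedBall.mem_iff.1 (hU.mem_nhds hx)
      have hpos : 0 < min ε (1 / ((n : ℝ) + 1)) := lt_min hε (by positivity)
      obtain ⟨b, hb, hsub⟩ := hcov n (x, min ε (1 / ((n : ℝ) + 1)))
        ⟨hpos, min_le_right _ _, (closedBall_subset_closedBall (min_le_left _ _)).trans hεU⟩
      exact mem_iUnion.2 ⟨⟨b, hb⟩, hsub (mem_closedBall_self hpos.le)⟩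
    · refine liminf_le_of_le (by isBoundedDefault) fun b hb => ?_
      obtain ⟨n, hn⟩ := hb.exists
      refine hn.trans ?_
      calc ∑' p : u n, ediam (closedBall p.1.1 (5 * p.1.2)) ^ s
          ≤ ∑' p : u n, (10 : ℝ≥0∞) ^ s * a⁻¹ * ν (closedBall p.1.1 p.1.2) := by
            refine ENNReal.tsum_le_tsum fun p => ?_
            have hp := hut n p.2
            calc _ ≤ (10 * ENNReal.ofReal p.1.2) ^ s := by gcongr; exact hdiam n p
              _ = (10 : ℝ≥0∞) ^ s * a⁻¹ * (a * ENNReal.ofReal p.1.2 ^ s) := by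
                rw [ENNReal.mul_rpow_of_nonneg _ _ hs, mul_assoc, ← mul_assoc a⁻¹,
                  ENNReal.inv_mul_cancel ha₀ ha, one_mul]
              _ ≤ _ := by gcongr; exact h _ _ hp.1 (hp.2.1.trans (hle1 n))
        _ = (10 : ℝ≥0∞) ^ s * a⁻¹ * ∑' p : u n, ν (closedBall p.1.1 p.1.2) :=
            ENNReal.tsum_mul_left
        _ = (10 : ℝ≥0∞) ^ s * a⁻¹ * ν (⋃ p ∈ u n, closedBall p.1 p.2) := by
            rw [measure_biUnion (hcount n) (hdisj n) fun p _ => isClosed_closedBall.measurableSet]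
        _ ≤ _ := by
            gcongr
            exact iUnion₂_subset fun p hp => (hut n hp).2.2
  have hK : (10 : ℝ≥0∞) ^ s * a⁻¹ ≠ ∞ :=
    ENNReal.mul_ne_top (ENNReal.rpow_ne_top_of_nonneg hs (by norm_num)) (ENNReal.inv_ne_top.2 ha₀)
  refine Measure.le_iff'.2 fun A => ?_
  rw [Measure.smul_apply, smul_eq_mul]
  have hK₀ : (10 : ℝ≥0∞) ^ s * a⁻¹ ≠ 0 :=
    mul_ne_zero (by simp [ENNReal.rpow_eq_zero_iff]) (ENNReal.inv_ne_zero.2 ha)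
  simp_rw [A.measure_eq_iInf_isOpen ν, ENNReal.mul_iInf_of_ne hK₀ hK]
  exact le_iInf₂ fun U hAU => le_iInf fun hU => (measure_mono hAU).trans (key U hU)

theorem le_toSphere_closedBall {E : Type*} [NormedAddCommGroup E] [NormedSpace ℝ E]
    [MeasurableSpace E] [BorelSpace E] [FiniteDimensional ℝ E] [Nontrivial E]
    (μ : Measure E) [μ.IsAddHaarMeasure] (x : sphere (0 : E) 1) {ε : ℝ} (hε : 0 < ε) (hε1 : ε ≤ 1) :
    ENNReal.ofReal ((1 / 8) ^ Module.finrank ℝ E) * μ (ball 0 1) *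
      ENNReal.ofReal ε ^ ((Module.finrank ℝ E : ℝ) - 1) ≤ μ.toSphere (closedBall x ε) := by
  set n := Module.finrank ℝ E with hn
  have hn0 : 0 < n := Module.finrank_pos
  have hx : ‖(x : E)‖ = 1 := by simp
  set N := ⌈1 / ε⌉₊ with hN
  let τ : ℕ → ℝ := fun k => 1 / 2 + k * (ε / 4)
  have hτ : ∀ k ∈ Finset.range N, τ k ≤ 3 / 4 := by
    intro k hk
    have h1 : (k : ℝ) < 1 / ε := Nat.lt_ceil.1 (Finset.mem_range.1 hk)
    have := (lt_div_iff₀ hε).1 h1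
    simp only [τ]; linarith
  have hτ0 : ∀ k, 1 / 2 ≤ τ k := fun k => by simp only [τ]; simp; positivity
  have hsub : (⋃ k ∈ Finset.range N, ball (τ k • (x : E)) (ε / 8)) ⊆
      Ioo (0 : ℝ) 1 • ((↑) '' (closedBall x ε) : Set E) := by
    refine iUnion₂_subset fun k hk y hy => ?_
    rw [mem_ball, dist_eq_norm] at hy
    have hτk : ‖τ k • (x : E)‖ = τ k := by
      rw [norm_smul, hx, mul_one, Real.norm_of_nonneg (by linarith [hτ0 k])]
    have h1 : |‖y‖ - τ k| < ε / 8 := by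
      have := abs_norm_sub_norm_le y (τ k • (x : E))
      rw [hτk] at this; linarith
    obtain ⟨h2, h3⟩ := abs_lt.1 h1
    have hy0 : 0 < ‖y‖ := by linarith [hτ0 k]
    have hy1 : ‖y‖ < 1 := by linarith [hτ k hk]
    have hu1 : ‖‖y‖⁻¹ • y‖ = 1 := by rw [norm_smul, norm_inv, norm_norm, inv_mul_cancel₀ hy0.ne']
    refine ⟨‖y‖, ⟨hy0, hy1⟩, ‖y‖⁻¹ • y, ⟨⟨‖y‖⁻¹ • y, by simp [hu1]⟩, ?_, rfl⟩, ?_⟩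
    · rw [mem_closedBall, Subtype.dist_eq, dist_eq_norm]
      have e : ‖y‖⁻¹ • y - (x : E) = ‖y‖⁻¹ • ((y - τ k • (x : E)) + (τ k - ‖y‖) • (x : E)) := by
        rw [sub_smul, sub_add_sub_cancel, smul_sub, smul_smul, inv_mul_cancel₀ hy0.ne', one_smul]
      rw [e, norm_smul, norm_inv, norm_norm, inv_mul_le_iff₀ hy0]
      refine (norm_add_le _ _).trans ?_
      rw [norm_smul, hx, mul_one, Real.norm_eq_abs, abs_sub_comm]
      nlinarith [hτ0 k]
    · simp [smul_smul, mul_inv_cancel₀ hy0.ne']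
  have hdisj : (↑(Finset.range N) : Set ℕ).PairwiseDisjoint
      fun k => ball (τ k • (x : E)) (ε / 8) := by
    intro j _ k _ hjk
    refine ball_disjoint_ball ?_
    rw [dist_eq_norm, ← sub_smul, norm_smul, hx, mul_one, Real.norm_eq_abs]
    have h1 : (1 : ℝ) ≤ |(j : ℝ) - k| := by
      have : (1 : ℤ) ≤ |(j : ℤ) - k| := Int.one_le_abs (by omega)
      exact_mod_cast this
    have : τ j - τ k = (j - k) * (ε / 4) := by simp only [τ]; ring
    rw [this, abs_mul, abs_of_pos (by positivity : 0 < ε / 4)]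
    nlinarith
  rw [μ.toSphere_apply' isClosed_closedBall.measurableSet]
  calc _ ≤ (N : ℝ≥0∞) * (ENNReal.ofReal ((ε / 8) ^ n) * μ (ball 0 1)) := by
        rw [ENNReal.ofReal_rpow_of_pos hε, mul_right_comm, ← mul_assoc,
          ← ENNReal.ofReal_natCast, ← ENNReal.ofReal_mul (by positivity),
          ← ENNReal.ofReal_mul (by positivity)]
        gcongr ENNReal.ofReal ?_ * _
        have h1 : 1 / ε ≤ N := Nat.le_ceil _
        rw [Real.rpow_sub_one hε.ne', Real.rpow_natCast, div_pow ε]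
        calc _ = 1 / ε * (ε ^ n / 8 ^ n) := by rw [one_div, inv_pow]; field_simp
          _ ≤ _ := by gcongr
    _ = μ (⋃ k ∈ Finset.range N, ball (τ k • (x : E)) (ε / 8)) := by
        rw [measure_biUnion_finset hdisj fun _ _ => measurableSet_ball]
        simp [μ.addHaar_ball_of_pos _ (by positivity : 0 < ε / 8), ← hn]
    _ ≤ μ (Ioo (0 : ℝ) 1 • ((↑) '' (closedBall x ε) : Set E)) := measure_mono hsub
    _ ≤ _ := le_mul_of_one_le_left zero_le (by exact_mod_cast hn0)

theorem exists_hausdorffMeasure_restrict_sphere_le (E : Type*) [NormedAddCommGroup E]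
    [NormedSpace ℝ E] [MeasurableSpace E] [BorelSpace E] [FiniteDimensional ℝ E] [Nontrivial E]
    (μ : Measure E) [μ.IsAddHaarMeasure] :
    ∃ K : ℝ≥0∞, K ≠ 0 ∧ K ≠ ∞ ∧ ∀ r : ℝ, 0 < r →
      (μH[(Module.finrank ℝ E : ℝ) - 1] : Measure E).restrict (sphere 0 r) ≤
        (ENNReal.ofReal (r ^ (Module.finrank ℝ E - 1)) * K) •
          μ.toSphere.map (fun θ : sphere (0 : E) 1 => r • (θ : E)) := by
  set n := Module.finrank ℝ E with hn
  have hn0 : 0 < n := Module.finrank_pos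
  have hs : (0 : ℝ) ≤ (n : ℝ) - 1 := by
    rw [sub_nonneg]; exact_mod_cast hn0
  set a := ENNReal.ofReal ((1 / 8) ^ n) * μ (ball 0 1) with ha_def
  have ha₀ : a ≠ 0 := mul_ne_zero (by simp) (measure_ball_pos μ 0 one_pos).ne'
  have ha : a ≠ ∞ := ENNReal.mul_ne_top ENNReal.ofReal_ne_top measure_ball_lt_top.ne
  have hle := hausdorffMeasure_le_smul_of_le_measure_closedBall μ.toSphere hs ha₀ ha
    fun x ε hε hε1 => le_toSphere_closedBall μ x hε hε1
  refine ⟨(10 : ℝ≥0∞) ^ ((n : ℝ) - 1) * a⁻¹,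
    mul_ne_zero (by simp [ENNReal.rpow_eq_zero_iff]) (ENNReal.inv_ne_zero.2 ha),
    ENNReal.mul_ne_top (ENNReal.rpow_ne_top_of_nonneg hs (by norm_num)) (ENNReal.inv_ne_top.2 ha₀),
    fun r hr => ?_⟩
  have hm : Measurable fun θ : sphere (0 : E) 1 => r • (θ : E) := by fun_prop
  refine Measure.le_iff.2 fun A hA => ?_
  rw [Measure.restrict_apply hA, Measure.smul_apply, Measure.map_apply hm hA]
  have himg : A ∩ sphere 0 r =
      r • ((↑) '' ((fun θ : sphere (0 : E) 1 => r • (θ : E)) ⁻¹' A) : Set E) := by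
    ext y
    constructor
    · rintro ⟨hyA, hy⟩
      rw [mem_sphere_zero_iff_norm] at hy
      have hry : r • r⁻¹ • y = y := by rw [smul_smul, mul_inv_cancel₀ hr.ne', one_smul]
      refine ⟨r⁻¹ • y, ⟨⟨r⁻¹ • y, ?_⟩, ?_, rfl⟩, hry⟩
      · rw [mem_sphere_zero_iff_norm, norm_smul, hy, norm_inv, Real.norm_of_nonneg hr.le,
          inv_mul_cancel₀ hr.ne']
      · simpa [hry] using hyA
    · rintro ⟨_, ⟨θ, hθ, rfl⟩, rfl⟩
      exact ⟨hθ, by simp [norm_smul, abs_of_pos hr]⟩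
  rw [himg, Measure.hausdorffMeasure_smul₀ hs hr.ne', isometry_subtype_coe.hausdorffMeasure_image
    (Or.inl hs), ENNReal.smul_def, smul_eq_mul, smul_eq_mul, mul_assoc]
  have hr' : ((‖r‖₊ ^ ((n : ℝ) - 1) : ℝ≥0) : ℝ≥0∞) = ENNReal.ofReal (r ^ (n - 1)) := by
    rw [← ENNReal.ofReal_coe_nnreal, NNReal.coe_rpow, coe_nnnorm, Real.norm_of_nonneg hr.le,
      ← Real.rpow_natCast, Nat.cast_pred hn0]
  rw [hr']
  gcongr
  exact Measure.le_iff'.1 hle _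

theorem setLIntegral_hausdorffMeasure_sphere_le {E : Type*} [NormedAddCommGroup E]
    [NormedSpace ℝ E] [MeasurableSpace E] [BorelSpace E] [FiniteDimensional ℝ E]
    {ν : Measure E} {σ : Measure (sphere (0 : E) 1)} {k : ℝ≥0∞} {r : ℝ} (hr : 0 < r)
    (h : ν.restrict (sphere 0 r) ≤ k • σ.map (fun θ : sphere (0 : E) 1 => r • (θ : E)))
    (g : E → ℝ≥0∞) :
    ∫⁻ x in sphere 0 r, g x ∂ν ≤ k * ∫⁻ θ, g (r • (θ : E)) ∂σ := by
  have hemb : MeasurableEmbedding fun θ : sphere (0 : E) 1 => r • (θ : E) :=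
    ((Homeomorph.smulOfNeZero r hr.ne').measurableEmbedding).comp
      (MeasurableEmbedding.subtype_coe isClosed_sphere.measurableSet)
  refine (lintegral_mono' h le_rfl).trans_eq ?_
  rw [lintegral_smul_measure, hemb.lintegral_map, smul_eq_mul]

theorem lintegral_eq_lintegral_toSphere {E : Type*} [NormedAddCommGroup E]
    [NormedSpace ℝ E] [MeasurableSpace E] [BorelSpace E] [FiniteDimensional ℝ E] [Nontrivial E]
    (μ : Measure E) [μ.IsAddHaarMeasure] {h : E → ℝ≥0∞} (hh : Measurable h) :
    ∫⁻ x, h x ∂μ = ∫⁻ θ : sphere (0 : E) 1, ∫⁻ t in Ioi (0 : ℝ),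
      ENNReal.ofReal (t ^ (Module.finrank ℝ E - 1)) * h (t • (θ : E)) ∂volume ∂μ.toSphere := by
  have hm : Measurable fun p : sphere (0 : E) 1 × Ioi (0 : ℝ) => h ((p.2 : ℝ) • (p.1 : E)) := by
    fun_prop
  calc ∫⁻ x, h x ∂μ = ∫⁻ x : ({(0)}ᶜ : Set E), h x ∂(μ.comap (↑)) := by
        rw [lintegral_subtype_comap (measurableSet_singleton _).compl,
          restrict_compl_singleton]
    _ = ∫⁻ p, h ((p.2 : ℝ) • (p.1 : E))
          ∂μ.toSphere.prod (.volumeIoiPow (Module.finrank ℝ E - 1)) := by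
        rw [← μ.measurePreserving_homeomorphUnitSphereProd.lintegral_comp hm]
        refine lintegral_congr fun x => ?_
        have hx : ‖(x : E)‖ ≠ 0 := norm_ne_zero_iff.2 x.2
        simp [smul_smul, mul_inv_cancel₀ hx]
    _ = _ := by
        rw [lintegral_prod _ hm.aemeasurable]
        refine lintegral_congr fun θ => ?_
        rw [Measure.volumeIoiPow, lintegral_withDensity_eq_lintegral_mul _ (by fun_prop)
          (by fun_prop), ← lintegral_subtype_comap measurableSet_Ioi]
        rfl

theorem sq_mul_le_integral_of_hasDerivAt {d : ℕ} (hd : 2 ≤ d) {r R M : ℝ} (hr : 0 < r)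
    (hR : R < 1) (hrR : 2 * r ≤ R) (hM0 : 0 ≤ M) (hMR : M ≤ R ^ d)
    (hMr : M ≤ r ^ ((d : ℝ) - 2 + 1 / d)) {f f' : ℝ → ℝ}
    (hf : ∀ t ∈ Icc r R, HasDerivAt f (f' t) t) (hf' : ContinuousOn f' (Icc r R)) :
    M * f r ^ 2 ≤ 4 * d * ∫ t in r..R, t ^ (d - 1) * (f' t ^ 2 + f t ^ 2) := by
  have hle : r ≤ R := by linarith
  have hR0 : 0 < R := by linarith
  have hd0 : (0 : ℝ) < d := by positivity
  have hd1 : ((d - 1 : ℕ) : ℝ) = d - 1 := by rw [Nat.cast_pred (by omega)]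
  have hfc : ContinuousOn f (Icc r R) := fun t ht => (hf t ht).continuousAt.continuousWithinAt
  have ii : ∀ {g : ℝ → ℝ} {s : ℝ}, ContinuousOn g (Icc r R) → s ∈ Icc r R →
      IntervalIntegrable g volume r s := fun hg hs =>
    (hg.mono (by rw [uIcc_of_le hs.1]; exact Icc_subset_Icc_right hs.2)).intervalIntegrable
  have hRm : R ∈ Icc r R := ⟨hle, le_rfl⟩
  set q : ℝ := r ^ (2 - (d : ℝ) - 1 / d) with hq
  have hq0 : 0 < q := Real.rpow_pos_of_pos hr _
  have hMq : M * q ≤ 1 := by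
    calc M * q ≤ r ^ ((d : ℝ) - 2 + 1 / d) * q := by gcongr
      _ = 1 := by rw [hq, ← Real.rpow_add hr]; ring_nf; simp
  have cD : ContinuousOn (fun t => t ^ (d - 1) * f' t ^ 2) (Icc r R) := by fun_prop
  have cF : ContinuousOn (fun t => t ^ (d - 1) * f t ^ 2) (Icc r R) := by fun_prop
  have cw : ContinuousOn (fun t : ℝ => q * t ^ (-1 + 1 / (d : ℝ))) (Icc r R) :=
    continuousOn_const.mul (continuousOn_id.rpow_const fun t ht => Or.inl (by
      simpa using (hr.trans_le ht.1).ne'))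
  set D := ∫ t in r..R, t ^ (d - 1) * f' t ^ 2 with hD
  set F := ∫ t in r..R, t ^ (d - 1) * f t ^ 2 with hF
  have hD0 : 0 ≤ D := intervalIntegral.integral_nonneg hle fun t ht => by
    have := hr.trans_le ht.1; positivity
  have hF0 : 0 ≤ F := intervalIntegral.integral_nonneg hle fun t ht => by
    have := hr.trans_le ht.1; positivity
  have hosc : ∀ s ∈ Icc r R, (f s - f r) ^ 2 ≤ D * (q * d) := by
    intro s hs
    have hquad : ∀ a : ℝ, 0 ≤ D * (a * a) + (-2 * (f s - f r)) * a + q * d := by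
      intro a
      have hpt : ∀ t ∈ Icc r s, 2 * a * f' t ≤
          a ^ 2 * (t ^ (d - 1) * f' t ^ 2) + q * t ^ (-1 + 1 / (d : ℝ)) := by
        intro t ht
        have ht0 : 0 < t := hr.trans_le ht.1
        have hw : (t ^ (d - 1))⁻¹ ≤ q * t ^ (-1 + 1 / (d : ℝ)) := by
          rw [← Real.rpow_natCast, hd1, ← Real.rpow_neg ht0.le]
          have e : -((d : ℝ) - 1) = (2 - (d : ℝ) - 1 / d) + (-1 + 1 / (d : ℝ)) := by ring
          rw [e, Real.rpow_add ht0]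
          gcongr
          refine Real.rpow_le_rpow_of_nonpos hr ht.1 ?_
          have : (2 : ℝ) ≤ d := by exact_mod_cast hd
          have : 0 < 1 / (d : ℝ) := by positivity
          linarith
        have hp : 0 < t ^ (d - 1) := by positivity
        have h2 : 0 ≤ (t ^ (d - 1))⁻¹ * (a * f' t * t ^ (d - 1) - 1) ^ 2 := by positivity
        have h3 : (t ^ (d - 1))⁻¹ * (a * f' t * t ^ (d - 1) - 1) ^ 2 =
            a ^ 2 * (t ^ (d - 1) * f' t ^ 2) + (t ^ (d - 1))⁻¹ - 2 * a * f' t := by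
          field_simp; ring
        linarith
      have hsub : Icc r s ⊆ Icc r R := Icc_subset_Icc_right hs.2
      have hint := intervalIntegral.integral_mono_on hs.1 ((ii hf' hs).const_mul (2 * a))
        (((ii cD hs).const_mul (a ^ 2)).add (ii cw hs)) hpt
      rw [intervalIntegral.integral_add ((ii cD hs).const_mul (a ^ 2)) (ii cw hs),
        intervalIntegral.integral_const_mul, intervalIntegral.integral_const_mul,
        intervalIntegral.integral_const_mul,
        intervalIntegral.integral_eq_sub_of_hasDerivAt
          (fun t ht => hf t (hsub (by rwa [uIcc_of_le hs.1] at ht))) (ii hf' hs),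
        integral_rpow (Or.inl (by linarith [show 0 < 1 / (d : ℝ) by positivity]))] at hint
      have hDs : ∫ t in r..s, t ^ (d - 1) * f' t ^ 2 ≤ D :=
        intervalIntegral.integral_mono_interval le_rfl hs.1 hs.2
          ((ae_restrict_mem measurableSet_Ioc).mono fun t ht => by
            have := hr.trans ht.1; positivity) (ii cD hRm)
      have hw : (s ^ (-1 + 1 / (d : ℝ) + 1) - r ^ (-1 + 1 / (d : ℝ) + 1)) /
          (-1 + 1 / (d : ℝ) + 1) ≤ d := by
        have e : -1 + 1 / (d : ℝ) + 1 = 1 / d := by ring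
        rw [e, div_le_iff₀ (by positivity), mul_one_div_cancel hd0.ne']
        have h1 : s ^ (1 / (d : ℝ)) ≤ 1 :=
          Real.rpow_le_one (hr.le.trans hs.1) (hs.2.trans hR.le) (by positivity)
        have h2 : 0 ≤ r ^ (1 / (d : ℝ)) := by positivity
        linarith
      nlinarith [mul_le_mul_of_nonneg_left hw hq0.le, mul_le_mul_of_nonneg_left hDs (sq_nonneg a)]
    have := discrim_le_zero hquad
    rw [discrim] at this
    linarith
  have hmean : f r ^ 2 * ((R ^ d - r ^ d) / d) ≤
      2 * F + 2 * (D * (q * d)) * ((R ^ d - r ^ d) / d) := by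
    have hpow : ∫ t in r..R, t ^ (d - 1) = (R ^ d - r ^ d) / d := by
      rw [integral_pow, hd1, Nat.sub_add_cancel (by omega), sub_add_cancel]
    have ip : IntervalIntegrable (fun t : ℝ => t ^ (d - 1)) volume r R := ii (by fun_prop) hRm
    have hint := intervalIntegral.integral_mono_on hle (ip.const_mul (f r ^ 2))
      (((ii cF hRm).const_mul 2).add (ip.const_mul (2 * (D * (q * d))))) (fun t ht => ?_)
    · rwa [intervalIntegral.integral_add ((ii cF hRm).const_mul 2) (ip.const_mul _),
        intervalIntegral.integral_const_mul, intervalIntegral.integral_const_mul,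
        intervalIntegral.integral_const_mul, hpow] at hint
    · have hp : 0 ≤ t ^ (d - 1) := by have := hr.trans_le ht.1; positivity
      have h1 : f r ^ 2 ≤ 2 * f t ^ 2 + 2 * (D * (q * d)) := by
        nlinarith [hosc t ht, sq_nonneg (f t + (f t - f r))]
      nlinarith
  have hsplit : ∫ t in r..R, t ^ (d - 1) * (f' t ^ 2 + f t ^ 2) = D + F := by
    simp_rw [mul_add]
    exact intervalIntegral.integral_add (ii cD hRm) (ii cF hRm)
  have hRd : 0 < R ^ d := by positivity
  have hrd : 2 * r ^ d ≤ R ^ d := by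
    have h1 : (2 * r) ^ d ≤ R ^ d := by gcongr
    rw [mul_pow] at h1
    have h2 : (2 : ℝ) ^ 1 ≤ 2 ^ d := pow_le_pow_right₀ (by norm_num) (by omega)
    nlinarith [pow_pos hr d]
  rw [hsplit]
  have hk : f r ^ 2 * R ^ d ≤ 4 * d * F + 4 * D * q * d * R ^ d := by
    have h1 : f r ^ 2 * (R ^ d - r ^ d) ≤ 2 * d * F + 2 * (D * (q * d)) * (R ^ d - r ^ d) := by
      have := mul_le_mul_of_nonneg_right hmean hd0.le
      field_simp at this
      linarith
    have h3 : 0 ≤ D * (q * d) := by positivity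
    nlinarith [sq_nonneg (f r), pow_pos hr d, mul_nonneg h3 (pow_pos hr d).le]
  have hfin : M * f r ^ 2 * R ^ d ≤ 4 * d * (D + F) * R ^ d := by
    calc M * f r ^ 2 * R ^ d = M * (f r ^ 2 * R ^ d) := by ring
      _ ≤ M * (4 * d * F + 4 * D * q * d * R ^ d) := by gcongr
      _ = 4 * d * F * M + 4 * d * D * R ^ d * (M * q) := by ring
      _ ≤ 4 * d * F * R ^ d + 4 * d * D * R ^ d * 1 := by gcongr
      _ = _ := by ring
  exact le_of_mul_le_mul_right hfin hRd

theorem smul_mem_closure_ann {d : ℕ} {r R t : ℝ} (hr : 0 < r) (hrR : r < R) (ht : t ∈ Icc r R)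
    (θ : sphere (0 : EuclideanSpace ℝ (Fin d)) 1) :
    t • (θ : EuclideanSpace ℝ (Fin d)) ∈ closure (ann d r R) := by
  have hc : Continuous fun s : ℝ => s • (θ : EuclideanSpace ℝ (Fin d)) := by fun_prop
  rw [← closure_Ioo hrR.ne] at ht
  refine map_mem_closure (f := fun s : ℝ => s • (θ : EuclideanSpace ℝ (Fin d))) hc ht fun s hs => ?_
  simp [ann, norm_smul, abs_of_pos (hr.trans hs.1), hs.1, hs.2]

theorem mul_sq_le_lintegral_ray {d : ℕ} (hd : 2 ≤ d) {r R M : ℝ} (hr : 0 < r)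
    (hR : R < 1) (hrR : 2 * r ≤ R) (hM0 : 0 ≤ M) (hMR : M ≤ R ^ d)
    (hMr : M ≤ r ^ ((d : ℝ) - 2 + 1 / d)) {u : EuclideanSpace ℝ (Fin d) → ℝ}
    {V : Set (EuclideanSpace ℝ (Fin d))} (hV : IsOpen V) (hsub : closure (ann d r R) ⊆ V)
    (hu : ContDiffOn ℝ 1 u V) (θ : sphere (0 : EuclideanSpace ℝ (Fin d)) 1) :
    ENNReal.ofReal (1 / (4 * d) * M * u (r • (θ : EuclideanSpace ℝ (Fin d))) ^ 2) ≤
      ∫⁻ t in Ioi (0 : ℝ), ENNReal.ofReal (t ^ (d - 1)) * (ann d r R).indicator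
        (fun x => ENNReal.ofReal (‖gradient u x‖ ^ 2 + u x ^ 2))
        (t • (θ : EuclideanSpace ℝ (Fin d))) := by
  have hlt : r < R := by linarith
  have hd0 : (0 : ℝ) < d := by positivity
  have hθ : ‖(θ : EuclideanSpace ℝ (Fin d))‖ = 1 := by simp
  have hmem : ∀ t ∈ Icc r R, t • (θ : EuclideanSpace ℝ (Fin d)) ∈ V := fun t ht =>
    hsub (smul_mem_closure_ann hr hlt ht θ)
  set f' : ℝ → ℝ := fun t => fderiv ℝ u (t • (θ : EuclideanSpace ℝ (Fin d))) θ with hf'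
  have hderiv : ∀ t ∈ Icc r R,
      HasDerivAt (fun t : ℝ => u (t • (θ : EuclideanSpace ℝ (Fin d)))) (f' t) t := by
    intro t ht
    have h1 : HasFDerivAt u _ (t • (θ : EuclideanSpace ℝ (Fin d))) :=
      ((hu.differentiableOn one_ne_zero).differentiableAt (hV.mem_nhds (hmem t ht))).hasFDerivAt
    have h2 : HasDerivAt (fun t : ℝ => t • (θ : EuclideanSpace ℝ (Fin d))) θ t := by
      simpa using (hasDerivAt_id t).smul_const (θ : EuclideanSpace ℝ (Fin d))
    exact h1.comp_hasDerivAt t h2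
  have hcont : ContinuousOn f' (Icc r R) := by
    have h1 : ContinuousOn (fun t : ℝ => fderiv ℝ u (t • (θ : EuclideanSpace ℝ (Fin d))))
        (Icc r R) :=
      (hu.continuousOn_fderiv_of_isOpen hV le_rfl).comp (by fun_prop) hmem
    exact h1.clm_apply continuousOn_const
  have hfc : ContinuousOn (fun t : ℝ => u (t • (θ : EuclideanSpace ℝ (Fin d)))) (Icc r R) :=
    fun t ht => (hderiv t ht).continuousAt.continuousWithinAt
  have hmain := sq_mul_le_integral_of_hasDerivAt hd hr hR hrR hM0 hMR hMr hderiv hcont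
  have hint : IntegrableOn (fun t : ℝ => t ^ (d - 1) *
      (f' t ^ 2 + u (t • (θ : EuclideanSpace ℝ (Fin d))) ^ 2)) (Icc r R) :=
    ((continuousOn_pow _).mul ((hcont.pow 2).add (hfc.pow 2))).integrableOn_Icc
  calc _ ≤ ENNReal.ofReal (∫ t in r..R, t ^ (d - 1) *
        (f' t ^ 2 + u (t • (θ : EuclideanSpace ℝ (Fin d))) ^ 2)) := by
        refine ENNReal.ofReal_le_ofReal ?_
        rw [mul_assoc, one_div, inv_mul_le_iff₀ (by positivity)]
        exact hmain
    _ = ∫⁻ t in Ioo r R, ENNReal.ofReal (t ^ (d - 1) *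
        (f' t ^ 2 + u (t • (θ : EuclideanSpace ℝ (Fin d))) ^ 2)) := by
        rw [intervalIntegral.integral_of_le hlt.le, ← Measure.restrict_congr_set Ioo_ae_eq_Ioc,
          ofReal_integral_eq_lintegral_ofReal (hint.mono_set Ioo_subset_Icc_self)]
        refine (ae_restrict_mem measurableSet_Ioo).mono fun t ht => ?_
        have := hr.trans ht.1
        simp only [Pi.zero_apply]
        positivity
    _ ≤ ∫⁻ t in Ioo r R, ENNReal.ofReal (t ^ (d - 1)) * (ann d r R).indicator
        (fun x => ENNReal.ofReal (‖gradient u x‖ ^ 2 + u x ^ 2))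
        (t • (θ : EuclideanSpace ℝ (Fin d))) := by
        refine setLIntegral_mono' measurableSet_Ioo fun t ht => ?_
        have ht0 := hr.trans ht.1
        have hA : t • (θ : EuclideanSpace ℝ (Fin d)) ∈ ann d r R := by
          simp [ann, norm_smul, abs_of_pos ht0, ht.1, ht.2]
        rw [indicator_of_mem hA, ← ENNReal.ofReal_mul (by positivity)]
        have hg : |f' t| ≤ ‖gradient u (t • (θ : EuclideanSpace ℝ (Fin d)))‖ := by
          rw [gradient, LinearIsometryEquiv.norm_map]
          simpa [hθ] using (fderiv ℝ u (t • (θ : EuclideanSpace ℝ (Fin d)))).le_opNorm θ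
        have hg2 := sq_le_sq' (abs_le.1 hg).1 (abs_le.1 hg).2
        gcongr
    _ ≤ _ := lintegral_mono_set fun t ht => hr.trans ht.1

theorem stmt1 (d : ℕ) (hd : 2 ≤ d) (c : ℝ) (hc : 0 < c) :
    ∃ C : ℝ, 0 < C ∧
      ∀ r R : ℝ, 0 < r → r < R → R < 1 →
      c * r ^ (((d:ℝ) - 1) / d) ≤ R → 2 * r ≤ R →
      ∀ u : EuclideanSpace ℝ (Fin d) → ℝ,
      (∃ V : Set (EuclideanSpace ℝ (Fin d)),
        IsOpen V ∧ closure (ann d r R) ⊆ V ∧ ContDiffOn ℝ 1 u V) →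
      C * min (R ^ d * r ^ ((1:ℝ) - d)) (r ^ ((1:ℝ)/d - 1)) *
          ∫ x in Metric.sphere (0:EuclideanSpace ℝ (Fin d)) r, (u x)^2 ∂(μH[(d:ℝ) - 1]) ≤
        ∫ x in ann d r R, (‖gradient u x‖^2 + (u x)^2) := by
  have hfin : Module.finrank ℝ (EuclideanSpace ℝ (Fin d)) = d := finrank_euclideanSpace_fin
  have : Nontrivial (EuclideanSpace ℝ (Fin d)) :=
    Module.nontrivial_of_finrank_pos (R := ℝ) (by omega)
  have hd0 : (0 : ℝ) < d := by positivity
  obtain ⟨K, hK0, hKtop, hK⟩ := exists_hausdorffMeasure_restrict_sphere_le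
    (EuclideanSpace ℝ (Fin d)) volume
  rw [hfin] at hK
  have hKpos : 0 < K.toReal := ENNReal.toReal_pos hK0 hKtop
  refine ⟨1 / (4 * d) / K.toReal, by positivity, ?_⟩
  rintro r R hr hlt hR - hrR u ⟨V, hV, hsub, hu⟩
  have hR0 := hr.trans hlt
  set m := min (R ^ d * r ^ ((1:ℝ) - d)) (r ^ ((1:ℝ)/d - 1)) with hm
  have hm0 : 0 ≤ m := by positivity
  have hrpow : r ^ (d - 1) = r ^ ((d : ℝ) - 1) := by
    rw [← Real.rpow_natCast, Nat.cast_pred (by omega)]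
  have hMR : m * r ^ (d - 1) ≤ R ^ d := by
    calc m * r ^ (d - 1) ≤ R ^ d * r ^ ((1:ℝ) - d) * r ^ (d - 1) := by
          gcongr; exact min_le_left _ _
      _ = R ^ d := by rw [hrpow, mul_assoc, ← Real.rpow_add hr]; simp
  have hMr : m * r ^ (d - 1) ≤ r ^ ((d : ℝ) - 2 + 1 / d) := by
    calc m * r ^ (d - 1) ≤ r ^ ((1:ℝ)/d - 1) * r ^ (d - 1) := by
          gcongr; exact min_le_right _ _
      _ = _ := by rw [hrpow, ← Real.rpow_add hr]; ring_nf
  have hA : IsOpen (ann d r R) := isOpen_ball.sdiff isClosed_closedBall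
  have hG : ContinuousOn (fun x => ‖gradient u x‖ ^ 2 + u x ^ 2) V := by
    have h1 : ContinuousOn (gradient u) V :=
      (LinearIsometryEquiv.continuous _).comp_continuousOn
        (hu.continuousOn_fderiv_of_isOpen hV le_rfl)
    have h2 := hu.continuousOn
    fun_prop
  have hcpt : IsCompact (closure (ann d r R)) :=
    (isBounded_ball.subset sdiff_subset).isCompact_closure
  have hGint : IntegrableOn (fun x => ‖gradient u x‖ ^ 2 + u x ^ 2) (ann d r R) :=
    ((hG.mono hsub).integrableOn_compact hcpt).mono_set subset_closure
  have hmeas : Measurable ((ann d r R).indicator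
      fun x => ENNReal.ofReal (‖gradient u x‖ ^ 2 + u x ^ 2)) := by
    have h1 : ContinuousOn (fun x => ENNReal.ofReal (‖gradient u x‖ ^ 2 + u x ^ 2)) (ann d r R) :=
      ENNReal.continuous_ofReal.comp_continuousOn (hG.mono (subset_closure.trans hsub))
    classical
    rw [← piecewise_eq_indicator]
    exact h1.measurable_piecewise continuousOn_const hA.measurableSet
  have hnn : 0 ≤ ∫ x in ann d r R, (‖gradient u x‖ ^ 2 + u x ^ 2) :=
    integral_nonneg fun x => by positivity
  have hS0 : 0 ≤ ∫ x in sphere (0 : EuclideanSpace ℝ (Fin d)) r, u x ^ 2 ∂(μH[(d:ℝ) - 1]) :=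
    integral_nonneg fun x => by positivity
  rw [← ENNReal.ofReal_le_ofReal_iff hnn, ofReal_integral_eq_lintegral_ofReal hGint
    (ae_of_all _ fun x => by positivity), ← lintegral_indicator hA.measurableSet,
    lintegral_eq_lintegral_toSphere volume hmeas, hfin, ENNReal.ofReal_mul (by positivity)]
  calc _ ≤ ENNReal.ofReal (1 / (4 * d) / K.toReal * m) *
        (ENNReal.ofReal (r ^ (d - 1)) * K *
          ∫⁻ θ : sphere (0 : EuclideanSpace ℝ (Fin d)) 1,
            ENNReal.ofReal (u (r • (θ : EuclideanSpace ℝ (Fin d))) ^ 2)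
              ∂(volume : Measure (EuclideanSpace ℝ (Fin d))).toSphere) := by
        gcongr
        refine le_trans ?_ (setLIntegral_hausdorffMeasure_sphere_le hr (hK r hr)
          fun x => ENNReal.ofReal (u x ^ 2))
        rw [← Real.enorm_of_nonneg hS0]
        refine (enorm_integral_le_lintegral_enorm _).trans_eq ?_
        exact lintegral_congr fun x => Real.enorm_of_nonneg (by positivity)
    _ = ∫⁻ θ : sphere (0 : EuclideanSpace ℝ (Fin d)) 1,
          ENNReal.ofReal (1 / (4 * d) * (m * r ^ (d - 1)) *
            u (r • (θ : EuclideanSpace ℝ (Fin d))) ^ 2)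
              ∂(volume : Measure (EuclideanSpace ℝ (Fin d))).toSphere := by
        have hcoef : ENNReal.ofReal (1 / (4 * d) / K.toReal * m) *
            (ENNReal.ofReal (r ^ (d - 1)) * K) =
            ENNReal.ofReal (1 / (4 * d) * (m * r ^ (d - 1))) := by
          nth_rewrite 2 [← ENNReal.ofReal_toReal hKtop]
          rw [← ENNReal.ofReal_mul (by positivity), ← ENNReal.ofReal_mul (by positivity)]
          congr 1
          field_simp
        rw [← mul_assoc, hcoef, ← lintegral_const_mul' _ _ ENNReal.ofReal_ne_top]
        exact lintegral_congr fun θ => (ENNReal.ofReal_mul (by positivity)).symm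
    _ ≤ _ := lintegral_mono fun θ =>
        mul_sq_le_lintegral_ray hd hr hR hrR (by positivity) hMR hMr hV hsub hu θ
end

section
/- Fix an integer d ≥ 2 and a real number c > 0. There exists C > 0, depending only on d and c, such that for all 0 < r < R < 1 satisfying R ≥ c·r^{(d−1)/d} and R ≥ 2r, and every C¹ function f : [r,R] → ℝ, one has ∫_r^R (f'(ρ)² + f(ρ)²)·(ρ/r)^{d−1} dρ ≥ C · min{R^d·r^{1−d}, r^{1/d − 1}} · f(r)². -/
open MeasureTheory intervalIntegral

/-- A pointwise weighted Cauchy–Schwarz bound on the increment of `f` away from the left endpoint,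
for a weight dominating `s / r`. -/
theorem sq_sub_le_mul_weighted_energy {f f' w : ℝ → ℝ} {r R A : ℝ} (hr : 0 < r) (hA : 0 < A)
    (hf : ∀ s ∈ Set.Icc r R, HasDerivWithinAt f (f' s) (Set.Icc r R) s)
    (hf' : ContinuousOn f' (Set.Icc r R)) (hw : ContinuousOn w (Set.Icc r R))
    (hw_le : ∀ s ∈ Set.Icc r R, s / r ≤ w s) (hlog : r * Real.log (R / r) ≤ A)
    {ρ : ℝ} (hρ : ρ ∈ Set.Icc r R) :
    (f r - f ρ) ^ 2 ≤ A * ∫ s in r..R, f' s ^ 2 * w s := by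
  obtain ⟨hrρ, hρR⟩ := hρ
  have hsub : Set.Icc r ρ ⊆ Set.Icc r R := Set.Icc_subset_Icc_right hρR
  have hE_cont : ContinuousOn (fun s => f' s ^ 2 * w s) (Set.Icc r R) := (hf'.pow 2).mul hw
  have hdiv_cont : ContinuousOn (fun s : ℝ => r / s) (Set.Icc r ρ) :=
    continuousOn_const.div continuousOn_id fun s hs => (hr.trans_le hs.1).ne'
  have hftc : ∫ s in r..ρ, f' s = f ρ - f r := by
    refine integral_eq_sub_of_hasDerivAt_of_le hrρ
      (fun s hs => ((hf s (hsub hs)).continuousWithinAt).mono hsub) (fun s hs => ?_)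
      ((hf'.mono hsub).intervalIntegrable_of_Icc hrρ)
    exact (hf s (hsub (Set.Ioo_subset_Icc_self hs))).hasDerivAt
      (Icc_mem_nhds hs.1 (hs.2.trans_le hρR))
  set D := f r - f ρ with hD
  have hdiv : ∫ s in r..ρ, r / s = r * Real.log (ρ / r) := by
    simp only [div_eq_mul_inv r]
    rw [intervalIntegral.integral_const_mul, integral_inv_of_pos hr (hr.trans_le hrρ)]
  have hmono : ∫ s in r..ρ, (-2 * D) * f' s ≤
      ∫ s in r..ρ, (A * (f' s ^ 2 * w s) + D ^ 2 / A * (r / s)) := by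
    refine integral_mono_on hrρ
      ((continuousOn_const.mul (hf'.mono hsub)).intervalIntegrable_of_Icc hrρ)
      (((continuousOn_const.mul (hE_cont.mono hsub)).add
        (continuousOn_const.mul hdiv_cont)).intervalIntegrable_of_Icc hrρ) fun s hs => ?_
    have hs0 : 0 < s := hr.trans_le hs.1
    have h1 : A * (f' s ^ 2 * (s / r)) ≤ A * (f' s ^ 2 * w s) := by
      gcongr
      exact hw_le s (hsub hs)
    have h2 : A * (f' s ^ 2 * (s / r)) + D ^ 2 / A * (r / s) + 2 * D * f' s
        = (A * f' s * (s / r) + D) ^ 2 / (A * (s / r)) := by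
      field_simp
      ring
    have h3 : 0 ≤ (A * f' s * (s / r) + D) ^ 2 / (A * (s / r)) := by positivity
    linarith
  rw [intervalIntegral.integral_const_mul, hftc, intervalIntegral.integral_add
    (((hE_cont.mono hsub).intervalIntegrable_of_Icc hrρ).const_mul A)
    ((hdiv_cont.intervalIntegrable_of_Icc hrρ).const_mul (D ^ 2 / A)),
    intervalIntegral.integral_const_mul, intervalIntegral.integral_const_mul, hdiv] at hmono
  have hE : ∫ s in r..ρ, f' s ^ 2 * w s ≤ ∫ s in r..R, f' s ^ 2 * w s := by
    refine integral_mono_interval le_rfl hrρ hρR ?_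
      (hE_cont.intervalIntegrable_of_Icc (hrρ.trans hρR))
    refine (ae_restrict_iff' measurableSet_Ioc).2 (.of_forall fun s hs => ?_)
    have hs0 : 0 < s := hr.trans hs.1
    have : 0 ≤ w s := (by positivity : 0 ≤ s / r).trans (hw_le s ⟨hs.1.le, hs.2⟩)
    exact mul_nonneg (sq_nonneg _) this
  have hlogρ : r * Real.log (ρ / r) ≤ A := by
    have hρ0 : 0 < ρ := hr.trans_le hrρ
    refine le_trans ?_ hlog
    gcongr
  have hDA : D ^ 2 / A * (r * Real.log (ρ / r)) ≤ D ^ 2 := by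
    calc D ^ 2 / A * (r * Real.log (ρ / r)) ≤ D ^ 2 / A * A := by gcongr
      _ = D ^ 2 := by field_simp
  have hAE := mul_le_mul_of_nonneg_left hE hA.le
  have : -2 * D * (f ρ - f r) = 2 * D ^ 2 := by rw [hD]; ring
  linarith

/-- Mass of the radial weight on `[r, R]` when the outer radius is at least twice the inner one. -/
theorem le_integral_radial_weight {d : ℕ} (hd : 1 ≤ d) {r R : ℝ} (hr : 0 < r) (hR : 2 * r ≤ R) :
    R ^ d * r ^ ((1 : ℝ) - d) ≤ 2 * d * ∫ ρ in r..R, (ρ / r) ^ (d - 1) := by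
  obtain ⟨n, rfl⟩ := Nat.exists_eq_add_of_le' hd
  have hpow : r ^ ((1 : ℝ) - (n + 1 : ℕ)) = (r ^ n)⁻¹ := by
    rw [← Real.rpow_natCast, ← Real.rpow_neg hr.le]
    push_cast
    ring_nf
  have hint : ∫ ρ in r..R, (ρ / r) ^ (n + 1 - 1) =
      (R ^ (n + 1) - r ^ (n + 1)) / (n + 1) * (r ^ n)⁻¹ := by
    simp only [Nat.add_sub_cancel, div_pow, div_eq_mul_inv (_ ^ n : ℝ)]
    rw [intervalIntegral.integral_mul_const, integral_pow]
  have h2 : 2 * r ^ (n + 1) ≤ R ^ (n + 1) := by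
    calc 2 * r ^ (n + 1) ≤ 2 ^ (n + 1) * r ^ (n + 1) := by
          gcongr
          exact le_self_pow₀ one_le_two n.succ_ne_zero
      _ = (2 * r) ^ (n + 1) := (mul_pow _ _ _).symm
      _ ≤ R ^ (n + 1) := by gcongr
  rw [hpow, hint]
  calc R ^ (n + 1) * (r ^ n)⁻¹ ≤ (2 * (R ^ (n + 1) - r ^ (n + 1))) * (r ^ n)⁻¹ := by
        gcongr
        linarith
    _ = _ := by
        push_cast
        field_simp

theorem mul_log_div_le_rpow {d : ℕ} (hd : 1 ≤ d) {r R : ℝ} (hr : 0 < r) (hR0 : 0 < R)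
    (hR1 : R ≤ 1) : r * Real.log (R / r) ≤ d * r ^ (1 - (1 : ℝ) / d) := by
  have hd0 : (0 : ℝ) < d := by exact_mod_cast hd
  have hlog : Real.log (R / r) ≤ d * r ^ (-((1 : ℝ) / d)) := by
    calc Real.log (R / r) ≤ Real.log r⁻¹ := by
          gcongr
          rw [div_eq_mul_inv]
          exact mul_le_of_le_one_left (by positivity) hR1
      _ ≤ r⁻¹ ^ ((1 : ℝ) / d) / ((1 : ℝ) / d) :=
          Real.log_le_rpow_div (by positivity) (by positivity)
      _ = d * r ^ (-((1 : ℝ) / d)) := by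
          rw [Real.inv_rpow hr.le, Real.rpow_neg hr.le]
          field_simp
  calc r * Real.log (R / r) ≤ r * (d * r ^ (-((1 : ℝ) / d))) := by gcongr
    _ = d * r ^ (1 - (1 : ℝ) / d) := by
        rw [sub_eq_add_neg, Real.rpow_add hr, Real.rpow_one]
        ring

theorem stmt2 (d : ℕ) (hd : 2 ≤ d) (c : ℝ) (hc : 0 < c) :
    ∃ C : ℝ, 0 < C ∧
      ∀ r R : ℝ, 0 < r → r < R → R < 1 →
      c * r ^ (((d:ℝ) - 1) / d) ≤ R → 2 * r ≤ R →
      ∀ f f' : ℝ → ℝ,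
      (∀ ρ ∈ Set.Icc r R, HasDerivWithinAt f (f' ρ) (Set.Icc r R) ρ) →
      ContinuousOn f' (Set.Icc r R) →
      C * min (R ^ d * r ^ ((1:ℝ) - d)) (r ^ ((1:ℝ)/d - 1)) * (f r)^2 ≤
        ∫ ρ in Set.Icc r R, ((f' ρ)^2 + (f ρ)^2) * (ρ / r)^(d-1) := by
  have hd0 : (0 : ℝ) < d := by exact_mod_cast (by lia : 0 < d)
  refine ⟨1 / (4 * d), by positivity, ?_⟩
  intro r R hr hrR hR1 _ hR2 f f' hf hf'
  have hw : ContinuousOn (fun ρ : ℝ => (ρ / r) ^ (d - 1)) (Set.Icc r R) := by fun_prop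
  have hfc : ContinuousOn f (Set.Icc r R) := fun s hs => (hf s hs).continuousWithinAt
  have hw_le : ∀ s ∈ Set.Icc r R, s / r ≤ (s / r) ^ (d - 1) := fun s hs =>
    le_self_pow₀ ((one_le_div hr).2 hs.1) (by lia)
  have hw_nonneg : ∀ s ∈ Set.Icc r R, 0 ≤ (s / r) ^ (d - 1) := fun s hs =>
    pow_nonneg (div_nonneg (hr.le.trans hs.1) hr.le) _
  have hA : 0 < d * r ^ (1 - (1 : ℝ) / d) := by positivity
  have hinc : ∀ ρ ∈ Set.Icc r R, _ := fun ρ hρ => sq_sub_le_mul_weighted_energy hr hA hf hf' hw hw_le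
    (mul_log_div_le_rpow (by lia) hr (hr.trans hrR) hR1.le) hρ
  have hmass := le_integral_radial_weight (d := d) (by lia) hr hR2
  have hint1 : IntervalIntegrable (fun s => f' s ^ 2 * (s / r) ^ (d - 1)) volume r R :=
    ((hf'.pow 2).mul hw).intervalIntegrable_of_Icc hrR.le
  have hint2 : IntervalIntegrable (fun s => f s ^ 2 * (s / r) ^ (d - 1)) volume r R :=
    ((hfc.pow 2).mul hw).intervalIntegrable_of_Icc hrR.le
  have hwint : IntervalIntegrable (fun s => (s / r) ^ (d - 1)) volume r R :=
    hw.intervalIntegrable_of_Icc hrR.le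
  rw [integral_Icc_eq_integral_Ioc, ← integral_of_le hrR.le]
  simp only [add_mul]
  rw [intervalIntegral.integral_add hint1 hint2]
  have hE1 : 0 ≤ ∫ s in r..R, f' s ^ 2 * (s / r) ^ (d - 1) :=
    integral_nonneg hrR.le fun s hs => mul_nonneg (sq_nonneg _) (hw_nonneg s hs)
  have hE2 : 0 ≤ ∫ s in r..R, f s ^ 2 * (s / r) ^ (d - 1) :=
    integral_nonneg hrR.le fun s hs => mul_nonneg (sq_nonneg _) (hw_nonneg s hs)
  set E₁ := ∫ s in r..R, f' s ^ 2 * (s / r) ^ (d - 1)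
  set E₂ := ∫ s in r..R, f s ^ 2 * (s / r) ^ (d - 1)
  set W := ∫ s in r..R, (s / r) ^ (d - 1)
  set A := d * r ^ (1 - (1 : ℝ) / d) with hA_def
  set m := min (R ^ d * r ^ ((1 : ℝ) - d)) (r ^ ((1 : ℝ) / d - 1))
  have hmain : (f r ^ 2 - 2 * (A * E₁)) * W ≤ 2 * E₂ := by
    simp only [W, E₂, ← intervalIntegral.integral_const_mul]
    refine integral_mono_on hrR.le (hwint.const_mul _) (hint2.const_mul _) fun s hs => ?_
    rw [← mul_assoc 2 (f s ^ 2)]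
    refine mul_le_mul_of_nonneg_right ?_ (hw_nonneg s hs)
    linarith [hinc s hs, sq_nonneg (f r - 2 * f s)]
  have hm0 : 0 ≤ m := by
    have : 0 < R := hr.trans hrR
    exact le_min (by positivity) (by positivity)
  have hmW : m ≤ 2 * d * W := (min_le_left _ _).trans hmass
  have hmA : m * A ≤ d := by
    calc m * A ≤ r ^ ((1 : ℝ) / d - 1) * A := by
          gcongr
          exact min_le_right _ _
      _ = d * (r ^ ((1 : ℝ) / d - 1) * r ^ (1 - (1 : ℝ) / d)) := by rw [hA_def]; ring
      _ = d := by rw [← Real.rpow_add hr]; simp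
  have hgoal : m * f r ^ 2 ≤ 4 * d * (E₁ + E₂) := by
    have h1 : m * (f r ^ 2 - 2 * (A * E₁)) ≤ 4 * d * E₂ := by
      rcases le_total (f r ^ 2 - 2 * (A * E₁)) 0 with h | h
      · exact (mul_nonpos_of_nonneg_of_nonpos hm0 h).trans (by positivity)
      · calc m * (f r ^ 2 - 2 * (A * E₁)) ≤ 2 * d * W * (f r ^ 2 - 2 * (A * E₁)) := by gcongr
          _ = 2 * d * ((f r ^ 2 - 2 * (A * E₁)) * W) := by ring
          _ ≤ 2 * d * (2 * E₂) := by gcongr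
          _ = 4 * d * E₂ := by ring
    have h2 : m * A * E₁ ≤ d * E₁ := by gcongr
    have h3 : 0 ≤ d * E₁ := by positivity
    linarith
  calc 1 / (4 * d) * m * f r ^ 2 = (m * f r ^ 2) / (4 * d) := by ring
    _ ≤ E₁ + E₂ := (div_le_iff₀' (by positivity)).2 hgoal
end

section
/- Let d ≥ 1 be an integer, let 0 < r < t < ρ₀ ≤ R < 1, and let f : [r,R] → ℝ be C¹. Then ∫_r^R f'(ρ)²·(ρ/r)^{d−1} dρ ≥ (1/2)·min{1/(t−r), (t/r)^{d−1}}·(f(ρ₀) − f(r))². -/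
open MeasureTheory intervalIntegral in
/-- Cauchy–Schwarz for the increment of a `C¹` function. -/
theorem sq_sub_le_mul_integral_deriv_sq {f f' : ℝ → ℝ} {a b : ℝ} (hab : a < b)
    (hf : ∀ x ∈ Set.Icc a b, HasDerivWithinAt f (f' x) (Set.Icc a b) x)
    (hf' : ContinuousOn f' (Set.Icc a b)) :
    (f b - f a) ^ 2 ≤ (b - a) * ∫ x in a..b, f' x ^ 2 := by
  have hint : IntervalIntegrable f' volume a b := hf'.intervalIntegrable_of_Icc hab.le
  have hint2 : IntervalIntegrable (fun x => f' x ^ 2) volume a b :=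
    (hf'.pow 2).intervalIntegrable_of_Icc hab.le
  have hftc : ∫ x in a..b, f' x = f b - f a :=
    integral_eq_sub_of_hasDerivAt_of_le hab.le (fun x hx => (hf x hx).continuousWithinAt)
      (fun x hx => (hf x (Set.Ioo_subset_Icc_self hx)).hasDerivAt (Icc_mem_nhds hx.1 hx.2)) hint
  set k := (f b - f a) / (b - a)
  have hba : 0 < b - a := sub_pos.2 hab
  have hkba : k * (b - a) = f b - f a := div_mul_cancel₀ _ hba.ne'
  have hmono : ∫ x in a..b, (2 * k * f' x - k ^ 2) ≤ ∫ x in a..b, f' x ^ 2 :=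
    integral_mono_on hab.le ((hint.const_mul _).sub intervalIntegrable_const) hint2
      fun x _ => by nlinarith [sq_nonneg (f' x - k)]
  rw [integral_sub (hint.const_mul _) intervalIntegrable_const,
    intervalIntegral.integral_const_mul, hftc, intervalIntegral.integral_const,
    smul_eq_mul] at hmono
  have := mul_le_mul_of_nonneg_left hmono hba.le
  calc (f b - f a) ^ 2 = (b - a) * (2 * k * (f b - f a) - (b - a) * k ^ 2) := by
        rw [← hkba]; ring
    _ ≤ _ := this

open MeasureTheory intervalIntegral in
theorem mul_sq_sub_le_mul_integral_deriv_sq_mul {f f' w : ℝ → ℝ} {a b c : ℝ} (hab : a < b)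
    (hc : 0 ≤ c) (hf : ∀ x ∈ Set.Icc a b, HasDerivWithinAt f (f' x) (Set.Icc a b) x)
    (hf' : ContinuousOn f' (Set.Icc a b)) (hw : ContinuousOn w (Set.Icc a b))
    (hcw : ∀ x ∈ Set.Icc a b, c ≤ w x) :
    c * (f b - f a) ^ 2 ≤ (b - a) * ∫ x in a..b, f' x ^ 2 * w x := by
  have hmono : ∫ x in a..b, c * f' x ^ 2 ≤ ∫ x in a..b, f' x ^ 2 * w x :=
    integral_mono_on hab.le (((hf'.pow 2).intervalIntegrable_of_Icc hab.le).const_mul c)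
      (((hf'.pow 2).mul hw).intervalIntegrable_of_Icc hab.le)
      fun x hx => by nlinarith [mul_le_mul_of_nonneg_left (hcw x hx) (sq_nonneg (f' x))]
  rw [intervalIntegral.integral_const_mul] at hmono
  calc c * (f b - f a) ^ 2 ≤ c * ((b - a) * ∫ x in a..b, f' x ^ 2) :=
        mul_le_mul_of_nonneg_left (sq_sub_le_mul_integral_deriv_sq hab hf hf') hc
    _ = (b - a) * (c * ∫ x in a..b, f' x ^ 2) := by ring
    _ ≤ _ := mul_le_mul_of_nonneg_left hmono (sub_pos.2 hab).le

theorem stmt4 (d : ℕ) (hd : 1 ≤ d) (r t ρ₀ R : ℝ)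
    (h1 : 0 < r) (h2 : r < t) (h3 : t < ρ₀) (h4 : ρ₀ ≤ R) (h5 : R < 1)
    (f f' : ℝ → ℝ)
    (hf : ∀ ρ ∈ Set.Icc r R, HasDerivWithinAt f (f' ρ) (Set.Icc r R) ρ)
    (hf' : ContinuousOn f' (Set.Icc r R)) :
    (1/2 : ℝ) * min (1 / (t - r)) ((t / r)^(d-1)) * (f ρ₀ - f r)^2 ≤
      ∫ ρ in Set.Icc r R, (f' ρ)^2 * (ρ / r)^(d-1) := by
  have hw : Continuous fun ρ : ℝ => (ρ / r) ^ (d - 1) := by fun_prop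
  have hcont : ContinuousOn (fun ρ => f' ρ ^ 2 * (ρ / r) ^ (d - 1)) (Set.Icc r R) :=
    (hf'.pow 2).mul hw.continuousOn
  have hs₁ : Set.Icc r t ⊆ Set.Icc r R := Set.Icc_subset_Icc_right (by linarith)
  have hs₂ : Set.Icc t ρ₀ ⊆ Set.Icc r R := Set.Icc_subset_Icc h2.le h4
  have hinner := mul_sq_sub_le_mul_integral_deriv_sq_mul (w := fun ρ => (ρ / r) ^ (d - 1)) h2
    zero_le_one (fun x hx => (hf x (hs₁ hx)).mono hs₁) (hf'.mono hs₁) hw.continuousOn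
    (fun x hx => one_le_pow₀ ((one_le_div h1).2 hx.1))
  have houter := mul_sq_sub_le_mul_integral_deriv_sq_mul (w := fun ρ => (ρ / r) ^ (d - 1))
    (c := (t / r) ^ (d - 1)) h3 (pow_nonneg (div_nonneg (by linarith) h1.le) _)
    (fun x hx => (hf x (hs₂ hx)).mono hs₂) (hf'.mono hs₂) hw.continuousOn
    (fun x hx => pow_le_pow_left₀ (div_nonneg (by linarith) h1.le)
      (div_le_div_of_nonneg_right hx.1 h1.le) _)
  have hnonneg : ∀ x, r ≤ x → 0 ≤ f' x ^ 2 * (x / r) ^ (d - 1) := fun x hx =>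
    mul_nonneg (sq_nonneg _) (pow_nonneg (div_nonneg (by linarith) h1.le) _)
  have hsplit : (∫ ρ in r..t, f' ρ ^ 2 * (ρ / r) ^ (d - 1)) +
      (∫ ρ in t..ρ₀, f' ρ ^ 2 * (ρ / r) ^ (d - 1)) ≤
      ∫ ρ in Set.Icc r R, f' ρ ^ 2 * (ρ / r) ^ (d - 1) := by
    rw [intervalIntegral.integral_add_adjacent_intervals
      ((hcont.mono hs₁).intervalIntegrable_of_Icc h2.le)
      ((hcont.mono hs₂).intervalIntegrable_of_Icc h3.le),
      intervalIntegral.integral_of_le (h2.trans h3).le]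
    refine MeasureTheory.setIntegral_mono_set hcont.integrableOn_Icc ?_
      (Set.Ioc_subset_Icc_self.trans (Set.Icc_subset_Icc_right h4)).eventuallyLE
    filter_upwards [MeasureTheory.ae_restrict_mem measurableSet_Icc] with x hx
    exact hnonneg x hx.1
  have hpos := intervalIntegral.integral_nonneg (μ := MeasureTheory.volume) h3.le
    fun x hx => hnonneg x (h2.le.trans hx.1)
  set I₁ := ∫ ρ in r..t, f' ρ ^ 2 * (ρ / r) ^ (d - 1)
  set I₂ := ∫ ρ in t..ρ₀, f' ρ ^ 2 * (ρ / r) ^ (d - 1)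
  set m := min (1 / (t - r)) ((t / r) ^ (d - 1))
  have htr : 0 < t - r := sub_pos.2 h2
  have hm0 : 0 ≤ m := le_min (by positivity) (pow_nonneg (div_nonneg (by linarith) h1.le) _)
  have hleft : m * (f t - f r) ^ 2 ≤ I₁ := by
    refine (mul_le_mul_of_nonneg_right (min_le_left _ _) (sq_nonneg _)).trans ?_
    rw [one_div_mul_eq_div, div_le_iff₀' htr]
    simpa using hinner
  have hright : m * (f ρ₀ - f t) ^ 2 ≤ I₂ := by
    refine (mul_le_mul_of_nonneg_right (min_le_right _ _) (sq_nonneg _)).trans (houter.trans ?_)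
    exact mul_le_of_le_one_left hpos (by linarith)
  have hsq := mul_nonneg hm0 (sq_nonneg ((f t - f r) - (f ρ₀ - f t)))
  calc 1 / 2 * m * (f ρ₀ - f r) ^ 2
      ≤ m * (f t - f r) ^ 2 + m * (f ρ₀ - f t) ^ 2 := by linarith
    _ ≤ I₁ + I₂ := add_le_add hleft hright
    _ ≤ _ := hsplit
end

section
/- Fix an integer d ≥ 2 and a real number c > 0. There exists C > 0, depending only on d and c, such that for all 0 < r < R ≤ 1 satisfying R ≥ c·r^{(d−1)/d}, and every function u that is C¹ on a neighbourhood of the closed ball closure(B(0,R)) ⊂ ℝ^d, one has ∫_{B(0,r)} u² dx ≤ C·r·∫_{B(0,R)} (u² + |∇u|²) dx. -/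
open MeasureTheory Set Metric

/-- Along a ray, `u²` at a point is controlled by `u²` at a dilated point and the integral of
`u² + ‖∇u‖²` over the segment joining them. -/
theorem sq_le_sq_smul_add_integral {E : Type*} [NormedAddCommGroup E] [InnerProductSpace ℝ E]
    [CompleteSpace E] {u : E → ℝ} {V : Set E} (hV : IsOpen V) (hu : ContDiffOn ℝ 1 u V)
    {x : E} {r T : ℝ} (hT : 1 ≤ T) (hx : ‖x‖ ≤ r) (hxV : ∀ t ∈ Icc 1 T, t • x ∈ V) :
    u x ^ 2 ≤ u (T • x) ^ 2 +
      ∫ t in (1 : ℝ)..T, r * (u (t • x) ^ 2 + ‖gradient u (t • x)‖ ^ 2) := by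
  have hmaps : MapsTo (fun t : ℝ => t • x) (uIcc 1 T) V := by
    rw [uIcc_of_le hT]; exact hxV
  have hsmul : ContinuousOn (fun t : ℝ => t • x) (uIcc 1 T) := by fun_prop
  have hfd : ContinuousOn (fderiv ℝ u) V := hu.continuousOn_fderiv_of_isOpen hV le_rfl
  have hcu : ContinuousOn (fun t : ℝ => u (t • x)) (uIcc 1 T) :=
    hu.continuousOn.comp hsmul hmaps
  have hcf : ContinuousOn (fun t : ℝ => fderiv ℝ u (t • x)) (uIcc 1 T) := hfd.comp hsmul hmaps
  have hnorm : ∀ y, ‖gradient u y‖ = ‖fderiv ℝ u y‖ := fun y => by simp [gradient]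
  have hd : ∀ t ∈ uIcc 1 T, HasDerivAt (fun t : ℝ => u (t • x) ^ 2)
      (2 * u (t • x) * fderiv ℝ u (t • x) x) t := by
    intro t ht
    have h1 : HasFDerivAt u (fderiv ℝ u (t • x)) (t • x) :=
      ((hu.contDiffAt (hV.mem_nhds (hmaps ht))).differentiableAt one_ne_zero).hasFDerivAt
    have h2 : HasDerivAt (fun t : ℝ => t • x) x t := by
      simpa using (hasDerivAt_id t).smul_const x
    simpa using (h1.comp_hasDerivAt t h2).fun_pow 2
  have hci : ContinuousOn (fun t : ℝ => 2 * u (t • x) * fderiv ℝ u (t • x) x) (uIcc 1 T) :=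
    (continuousOn_const.mul hcu).mul (hcf.clm_apply continuousOn_const)
  have hcW : ContinuousOn (fun t : ℝ => r * (u (t • x) ^ 2 + ‖gradient u (t • x)‖ ^ 2))
      (uIcc 1 T) := by
    simp only [hnorm]
    exact continuousOn_const.mul ((hcu.pow 2).add (hcf.norm.pow 2))
  have hftc := intervalIntegral.integral_eq_sub_of_hasDerivAt hd hci.intervalIntegrable
  have hmono : ∫ t in (1 : ℝ)..T, -(2 * u (t • x) * fderiv ℝ u (t • x) x) ≤
      ∫ t in (1 : ℝ)..T, r * (u (t • x) ^ 2 + ‖gradient u (t • x)‖ ^ 2) := by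
    refine intervalIntegral.integral_mono_on hT hci.neg.intervalIntegrable
      hcW.intervalIntegrable fun t _ => ?_
    rw [hnorm]
    have hop : |fderiv ℝ u (t • x) x| ≤ ‖fderiv ℝ u (t • x)‖ * r :=
      ((fderiv ℝ u (t • x)).le_opNorm x).trans (by gcongr)
    have hr : 0 ≤ r := (norm_nonneg x).trans hx
    calc -(2 * u (t • x) * fderiv ℝ u (t • x) x)
        ≤ |2 * u (t • x) * fderiv ℝ u (t • x) x| := neg_le_abs _
      _ = 2 * |u (t • x)| * |fderiv ℝ u (t • x) x| := by simp [abs_mul]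
      _ ≤ 2 * |u (t • x)| * (‖fderiv ℝ u (t • x)‖ * r) := by gcongr
      _ = r * (2 * |u (t • x)| * ‖fderiv ℝ u (t • x)‖) := by ring
      _ ≤ r * (|u (t • x)| ^ 2 + ‖fderiv ℝ u (t • x)‖ ^ 2) := by
        gcongr; exact two_mul_le_add_sq _ _
      _ = _ := by rw [sq_abs]
  rw [intervalIntegral.integral_neg, hftc, one_smul] at hmono
  linarith

/-- Dilation of the integral over a ball centred at the origin. -/
theorem setIntegral_ball_comp_smul {d : ℕ} (f : EuclideanSpace ℝ (Fin d) → ℝ) {t : ℝ}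
    (ht : 0 < t) (r : ℝ) :
    ∫ x in ball (0 : EuclideanSpace ℝ (Fin d)) r, f (t • x) =
      (t ^ d)⁻¹ * ∫ x in ball (0 : EuclideanSpace ℝ (Fin d)) (t * r), f x := by
  rw [Measure.setIntegral_comp_smul_of_pos _ _ _ ht, _root_.smul_ball ht.ne', smul_zero,
    Real.norm_of_nonneg ht.le, finrank_euclideanSpace_fin, smul_eq_mul]

theorem integral_inv_pow_le_one {d : ℕ} (hd : 2 ≤ d) {T : ℝ} (hT : 1 ≤ T) :
    ∫ t in (1 : ℝ)..T, (t ^ d)⁻¹ ≤ 1 := by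
  have hne : ∀ t ∈ uIcc 1 T, t ≠ 0 := fun t ht => by
    rw [uIcc_of_le hT] at ht; linarith [ht.1]
  have hc : ∀ n : ℕ, IntervalIntegrable (fun t : ℝ => (t ^ n)⁻¹) volume 1 T := fun n =>
    ContinuousOn.intervalIntegrable
      ((continuousOn_id.pow n).inv₀ fun t ht => pow_ne_zero n (hne t ht))
  calc ∫ t in (1 : ℝ)..T, (t ^ d)⁻¹ ≤ ∫ t in (1 : ℝ)..T, (t ^ 2)⁻¹ := by
        refine intervalIntegral.integral_mono_on hT (hc d) (hc 2) fun t ht => ?_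
        have : 0 < t := by linarith [ht.1]
        gcongr
        exact ht.1
    _ = -T⁻¹ - -(1 : ℝ)⁻¹ := by
        refine intervalIntegral.integral_eq_sub_of_hasDerivAt (f := fun t : ℝ => -t⁻¹)
          (fun t ht => ?_) (hc 2)
        simpa using (hasDerivAt_inv (hne t ht)).fun_neg
    _ ≤ 1 := by
        have : 0 < T⁻¹ := by positivity
        rw [inv_one]; linarith

/-- For a nonnegative function continuous on a closed ball, the integral over `t ∈ [1, R / r]` and
`x ∈ B(0, r)` of its dilates `f (t x)` is at most its integral over `B(0, R)`. -/
theorem integral_ball_integral_smul_le {d : ℕ} (hd : 2 ≤ d) {r R : ℝ} (hr : 0 < r) (hrR : r < R)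
    {f : EuclideanSpace ℝ (Fin d) → ℝ} (hf : ContinuousOn f (closedBall 0 R))
    (hf0 : ∀ x, 0 ≤ f x) :
    IntegrableOn (fun x => ∫ t in (1 : ℝ)..R / r, f (t • x)) (ball 0 r) ∧
    ∫ x in ball (0 : EuclideanSpace ℝ (Fin d)) r, ∫ t in (1 : ℝ)..R / r, f (t • x) ≤
      ∫ x in ball (0 : EuclideanSpace ℝ (Fin d)) R, f x := by
  have hT : 1 ≤ R / r := by rw [one_le_div hr]; exact hrR.le
  have hfR : IntegrableOn f (ball 0 R) :=
    (hf.integrableOn_compact (isCompact_closedBall _ _)).mono_set ball_subset_closedBall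
  have hprod : Integrable (fun p : EuclideanSpace ℝ (Fin d) × ℝ => f (p.2 • p.1))
      ((volume.restrict (ball 0 r)).prod (volume.restrict (Ioc 1 (R / r)))) := by
    rw [Measure.prod_restrict]
    have hK : IsCompact (closedBall (0 : EuclideanSpace ℝ (Fin d)) r ×ˢ Icc 1 (R / r)) :=
      (isCompact_closedBall _ _).prod isCompact_Icc
    have hc : ContinuousOn (fun p : EuclideanSpace ℝ (Fin d) × ℝ => f (p.2 • p.1))
        (closedBall 0 r ×ˢ Icc 1 (R / r)) := by
      refine hf.comp (by fun_prop) ?_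
      rintro ⟨x, t⟩ ⟨hx, ht⟩
      simp only [mem_closedBall, dist_zero_right, mem_Icc] at hx ht ⊢
      rw [norm_smul, Real.norm_of_nonneg (by linarith)]
      calc t * ‖x‖ ≤ R / r * r := by gcongr; exact ht.2
        _ = R := div_mul_cancel₀ _ hr.ne'
    exact (hc.integrableOn_compact hK).mono_set
      (prod_mono ball_subset_closedBall Ioc_subset_Icc_self)
  simp only [intervalIntegral.integral_of_le hT]
  refine ⟨hprod.integral_prod_left, ?_⟩
  rw [integral_integral_swap hprod, ← intervalIntegral.integral_of_le hT]
  have hcont : ContinuousOn (fun t : ℝ => (t ^ d)⁻¹) (uIcc 1 (R / r)) := by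
    refine (continuousOn_id.pow d).inv₀ fun t ht => pow_ne_zero d ?_
    rw [uIcc_of_le hT] at ht
    exact (zero_lt_one.trans_le ht.1).ne'
  calc ∫ t in (1 : ℝ)..R / r, ∫ x in ball (0 : EuclideanSpace ℝ (Fin d)) r, f (t • x)
      ≤ ∫ t in (1 : ℝ)..R / r, (t ^ d)⁻¹ * ∫ x in ball (0 : EuclideanSpace ℝ (Fin d)) R, f x := by
        refine intervalIntegral.integral_mono_on hT ?_
          (hcont.intervalIntegrable.mul_const _) fun t ht => ?_
        · rw [intervalIntegrable_iff_integrableOn_Ioc_of_le hT]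
          exact hprod.integral_prod_right
        · have ht0 : 0 < t := by linarith [ht.1]
          rw [setIntegral_ball_comp_smul f ht0]
          refine mul_le_mul_of_nonneg_left ?_ (by positivity)
          refine setIntegral_mono_set hfR (Filter.Eventually.of_forall hf0)
            (ball_subset_ball ?_).eventuallyLE
          rw [← le_div_iff₀ hr]
          exact ht.2
    _ = (∫ t in (1 : ℝ)..R / r, (t ^ d)⁻¹) *
          ∫ x in ball (0 : EuclideanSpace ℝ (Fin d)) R, f x := by
        rw [intervalIntegral.integral_mul_const]
    _ ≤ 1 * ∫ x in ball (0 : EuclideanSpace ℝ (Fin d)) R, f x := by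
        gcongr
        · exact integral_nonneg hf0
        · exact integral_inv_pow_le_one hd hT
    _ = _ := one_mul _

theorem inv_div_pow_le {d : ℕ} (hd : 2 ≤ d) {c r R : ℝ} (hc : 0 < c) (hr : 0 < r)
    (h : c * r ^ (((d : ℝ) - 1) / d) ≤ R) : ((R / r) ^ d)⁻¹ ≤ (c ^ d)⁻¹ * r := by
  have hd0 : (d : ℝ) ≠ 0 := by positivity
  have hpow : (r ^ (((d : ℝ) - 1) / d)) ^ d * r = r ^ d := by
    rw [← Real.rpow_natCast, ← Real.rpow_mul hr.le, div_mul_cancel₀ _ hd0,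
      Real.rpow_sub_one hr.ne', div_mul_cancel₀ _ hr.ne', Real.rpow_natCast]
  have hle : c ^ d * (r ^ (((d : ℝ) - 1) / d)) ^ d ≤ R ^ d := by
    rw [← mul_pow]; gcongr
  have hR : 0 < R := lt_of_lt_of_le (by positivity) h
  rw [div_pow, inv_div, div_le_iff₀ (by positivity), ← hpow]
  calc (r ^ (((d : ℝ) - 1) / d)) ^ d * r
      = (c ^ d)⁻¹ * r * (c ^ d * (r ^ (((d : ℝ) - 1) / d)) ^ d) := by
        field_simp
    _ ≤ (c ^ d)⁻¹ * r * R ^ d := by gcongr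

theorem stmt5 (d : ℕ) (hd : 2 ≤ d) (c : ℝ) (hc : 0 < c) :
    ∃ C : ℝ, 0 < C ∧
      ∀ r R : ℝ, 0 < r → r < R → R ≤ 1 → c * r ^ (((d:ℝ) - 1) / d) ≤ R →
      ∀ u : EuclideanSpace ℝ (Fin d) → ℝ,
      (∃ V : Set (EuclideanSpace ℝ (Fin d)),
        IsOpen V ∧ closure (Metric.ball (0:EuclideanSpace ℝ (Fin d)) R) ⊆ V ∧
          ContDiffOn ℝ 1 u V) →
      (∫ x in Metric.ball (0:EuclideanSpace ℝ (Fin d)) r, (u x)^2) ≤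
        C * r * ∫ x in Metric.ball (0:EuclideanSpace ℝ (Fin d)) R, ((u x)^2 + ‖gradient u x‖^2) := by
  refine ⟨(c ^ d)⁻¹ + 1, by positivity, ?_⟩
  rintro r R hr hrR - hcR u ⟨V, hV, hball, hu⟩
  have hR : 0 < R := hr.trans hrR
  have hT : 1 ≤ R / r := by rw [one_le_div hr]; exact hrR.le
  have hT0 : 0 < R / r := by positivity
  rw [closure_ball _ hR.ne'] at hball
  have hcu : ContinuousOn u (closedBall 0 R) := hu.continuousOn.mono hball
  have hcf : ContinuousOn (fderiv ℝ u) (closedBall 0 R) :=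
    (hu.continuousOn_fderiv_of_isOpen hV le_rfl).mono hball
  have hcW : ContinuousOn (fun x => u x ^ 2 + ‖gradient u x‖ ^ 2) (closedBall 0 R) := by
    have hnorm : ∀ y, ‖gradient u y‖ = ‖fderiv ℝ u y‖ := fun y => by simp [gradient]
    simp only [hnorm]
    exact (hcu.pow 2).add (hcf.norm.pow 2)
  have hmem : ∀ x ∈ closedBall (0 : EuclideanSpace ℝ (Fin d)) r, ∀ t ∈ Icc 1 (R / r),
      t • x ∈ closedBall (0 : EuclideanSpace ℝ (Fin d)) R := by
    intro x hx t ht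
    simp only [mem_closedBall, dist_zero_right, mem_Icc] at hx ht ⊢
    rw [norm_smul, Real.norm_of_nonneg (by linarith)]
    calc t * ‖x‖ ≤ R / r * r := by gcongr; exact ht.2
      _ = R := div_mul_cancel₀ _ hr.ne'
  obtain ⟨hint, hle⟩ := integral_ball_integral_smul_le hd hr hrR hcW fun x => by positivity
  have hintu : IntegrableOn (fun x => u x ^ 2) (closedBall 0 R) :=
    (hcu.pow 2).integrableOn_compact (isCompact_closedBall _ _)
  have hintW := hcW.integrableOn_compact (μ := volume) (isCompact_closedBall _ _)
  have hintT : IntegrableOn (fun x => u ((R / r) • x) ^ 2) (ball 0 r) := by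
    refine IntegrableOn.mono_set ?_ ball_subset_closedBall
    refine ContinuousOn.integrableOn_compact (isCompact_closedBall _ _) ?_
    exact (hcu.comp (by fun_prop) fun x hx => hmem x hx _ ⟨hT, le_rfl⟩).pow 2
  set I := ∫ x in ball (0 : EuclideanSpace ℝ (Fin d)) R, (u x ^ 2 + ‖gradient u x‖ ^ 2) with hI
  have hI0 : 0 ≤ I := integral_nonneg fun x => by positivity
  calc ∫ x in ball (0 : EuclideanSpace ℝ (Fin d)) r, u x ^ 2
      ≤ ∫ x in ball (0 : EuclideanSpace ℝ (Fin d)) r, (u ((R / r) • x) ^ 2 +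
          r * ∫ t in (1 : ℝ)..R / r, (u (t • x) ^ 2 + ‖gradient u (t • x)‖ ^ 2)) := by
        refine setIntegral_mono_on
          (hintu.mono_set (ball_subset_closedBall.trans (closedBall_subset_closedBall hrR.le)))
          (hintT.add (hint.const_mul r)) measurableSet_ball fun x hx => ?_
        have hx' := ball_subset_closedBall hx
        rw [← intervalIntegral.integral_const_mul]
        exact sq_le_sq_smul_add_integral hV hu hT (by simpa using hx')
          fun t ht => hball (hmem x hx' t ht)
    _ = ((R / r) ^ d)⁻¹ * (∫ x in ball (0 : EuclideanSpace ℝ (Fin d)) R, u x ^ 2) +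
          r * ∫ x in ball (0 : EuclideanSpace ℝ (Fin d)) r,
            ∫ t in (1 : ℝ)..R / r, (u (t • x) ^ 2 + ‖gradient u (t • x)‖ ^ 2) := by
        rw [integral_add hintT (hint.const_mul r), integral_const_mul,
          setIntegral_ball_comp_smul (fun x => u x ^ 2) hT0, div_mul_cancel₀ _ hr.ne']
    _ ≤ (c ^ d)⁻¹ * r * I + r * I := by
        have huI : ∫ x in ball (0 : EuclideanSpace ℝ (Fin d)) R, u x ^ 2 ≤ I :=
          integral_mono (hintu.mono_set ball_subset_closedBall)
            (hintW.mono_set ball_subset_closedBall) fun x => by simp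
        gcongr
        exact inv_div_pow_le hd hc hr hcR
    _ = ((c ^ d)⁻¹ + 1) * r * I := by ring
end

section
/- Let d ≥ 3 and ℓ ≥ 0 be integers, let σ > 0, and let 0 < r ≤ (d−2)/(2σ). Let c, c' ∈ ℝ and define a(ρ) := c·ρ^ℓ + c'·ρ^{2−d−ℓ} for ρ > 0. If −a'(r) = σ·a(r), then c' = M·r^{2ℓ+d−2}·c, where M := (ℓ + rσ)/(ℓ − 2 + d − rσ); moreover this M satisfies ℓ/(ℓ − 2 + d) ≤ M ≤ 1. -/
theorem stmt7 (d ℓ : ℕ) (hd : 3 ≤ d) (σ r : ℝ) (hσ : 0 < σ) (hr : 0 < r)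
    (hrσ : r ≤ ((d:ℝ) - 2) / (2 * σ)) (c c' : ℝ) (a : ℝ → ℝ)
    (ha : a = fun ρ : ℝ => c * ρ ^ (ℓ:ℝ) + c' * ρ ^ ((2:ℝ) - d - ℓ))
    (hSteklov : -deriv a r = σ * a r) :
    c' = ((ℓ + r * σ) / ((ℓ:ℝ) - 2 + d - r * σ)) * r ^ (2 * ℓ + d - 2) * c ∧
    (ℓ:ℝ) / ((ℓ:ℝ) - 2 + d) ≤ ((ℓ:ℝ) + r * σ) / ((ℓ:ℝ) - 2 + d - r * σ) ∧
    ((ℓ:ℝ) + r * σ) / ((ℓ:ℝ) - 2 + d - r * σ) ≤ 1 := by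
  have hd3 : (3 : ℝ) ≤ d := by exact_mod_cast hd
  have hℓ : (0 : ℝ) ≤ ℓ := Nat.cast_nonneg ℓ
  have hpos : 0 < r * σ := mul_pos hr hσ
  have hbound : 2 * (r * σ) ≤ (d : ℝ) - 2 := by
    rw [le_div_iff₀ (by positivity)] at hrσ
    linarith
  have hD : 0 < (ℓ : ℝ) - 2 + d - r * σ := by linarith
  refine ⟨?_, ?_, ?_⟩
  · have hderiv : HasDerivAt a (c * (ℓ * r ^ ((ℓ : ℝ) - 1)) +
        c' * (((2 : ℝ) - d - ℓ) * r ^ ((2 : ℝ) - d - ℓ - 1))) r := by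
      rw [ha]
      exact ((Real.hasDerivAt_rpow_const (Or.inl hr.ne')).const_mul c).add
        ((Real.hasDerivAt_rpow_const (Or.inl hr.ne')).const_mul c')
    rw [hderiv.deriv, ha, Real.rpow_sub_one hr.ne', Real.rpow_sub_one hr.ne'] at hSteklov
    have hpow : r ^ (ℓ : ℝ) = r ^ ((2 : ℝ) - d - ℓ) * r ^ (2 * ℓ + d - 2) := by
      rw [← Real.rpow_natCast r (2 * ℓ + d - 2), ← Real.rpow_add hr,
        Nat.cast_sub (by omega : 2 ≤ 2 * ℓ + d)]
      congr 1
      push_cast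
      ring
    have hB : 0 < r ^ ((2 : ℝ) - d - ℓ) := Real.rpow_pos_of_pos hr _
    simp only [hpow] at hSteklov
    generalize r ^ ((2 : ℝ) - d - ℓ) = B at hSteklov hB
    generalize r ^ (2 * ℓ + d - 2) = P at hSteklov ⊢
    field_simp at hSteklov
    rw [div_mul_eq_mul_div, div_mul_eq_mul_div, eq_div_iff hD.ne']
    linarith
  · rw [div_le_div_iff₀ (by linarith) hD]
    nlinarith [mul_nonneg hℓ hpos.le, mul_nonneg hpos.le (by linarith : (0 : ℝ) ≤ ℓ - 2 + d)]
  · rw [div_le_one hD]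
    linarith
end
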